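/- arXiv:1301.6144 — 4 statements merged into one kernel-verified Lean document; each statement's English description precedes it below -/
import Mathlib

section
/- There exist a bounded linear operator T acting on a complex separable infinite-dimensional Hilbert space H and a unitary operator V on H such that for every non-zero vector x of H, either the orbit {T^n x : n ≥ 0} of x or the orbit {T^n (V x) : n ≥ 0} of Vx is dense in H. -/
section SecP1

open Polynomial Filter Topology

theorem hb_nat (H : Type) [NormedAddCommGroup H] [InnerProductSpace ℂ H] [CompleteSpace H]
    [TopologicalSpace.SeparableSpace H] (hdim : ¬ FiniteDimensional ℂ H) :
    Nonempty (HilbertBasis ℕ ℂ H) := by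
  obtain ⟨w, b, hb⟩ := exists_hilbertBasis ℂ H
  have hd : ∀ i j : w, i ≠ j → dist (i : H) j = Real.sqrt 2 := by
    intro i j hij
    have ho := b.orthonormal
    rw [hb] at ho
    have h0 : inner ℂ (i : H) (j : H) = 0 := ho.2 hij
    have h1 := norm_sub_sq (𝕜 := ℂ) (i : H) (j : H)
    rw [h0, ho.1 i, ho.1 j] at h1
    rw [dist_eq_norm, ← Real.sqrt_sq (norm_nonneg _), h1]
    norm_num
  have hc : Countable w := by
    refine Pairwise.countable_of_isOpen_disjoint (α := H) (ι := w)
      (s := fun i : w => Metric.ball (i : H) (1/2)) ?_ (fun _ => Metric.isOpen_ball) ?_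
    · intro i j hij
      apply Metric.ball_disjoint_ball
      rw [hd i j hij]
      have : (1:ℝ) ≤ Real.sqrt 2 := Real.one_le_sqrt.mpr (by norm_num)
      linarith
    · intro i; exact ⟨i, Metric.mem_ball_self (by norm_num)⟩
  have hi : Infinite w := by
    by_contra hfin
    rw [not_infinite_iff_finite] at hfin
    have := Fintype.ofFinite w
    exact hdim (Module.Basis.finiteDimensional_of_finite b.toOrthonormalBasis.toBasis)
  obtain ⟨f⟩ := nonempty_equiv_of_countable (α := ℕ) (β := w)
  refine ⟨HilbertBasis.mk (v := b ∘ f) (b.orthonormal.comp f f.injective) ?_⟩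
  rw [Set.range_comp, f.surjective.range_eq, Set.image_univ]
  exact b.dense_span.ge

set_option linter.unusedSectionVars false

section
variable {H : Type} [NormedAddCommGroup H] [InnerProductSpace ℂ H] [CompleteSpace H]
  (e : HilbertBasis ℕ ℂ H)

theorem coord_le (x : H) (j : ℕ) : ‖e.repr x j‖ ≤ ‖x‖ := by
  rw [e.repr_apply_apply]
  calc _ ≤ ‖e j‖ * ‖x‖ := norm_inner_le_norm _ _
    _ = ‖x‖ := by rw [e.orthonormal.1 j, one_mul]

theorem coord_self (i j : ℕ) : e.repr (e i) j = if j = i then 1 else 0 := by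
  rw [e.repr_apply_apply]
  exact (orthonormal_iff_ite.mp e.orthonormal) j i

theorem l1_op (r : ℕ → H) (hr : Summable fun j => ‖r j‖) :
    ∃ R : H →L[ℂ] H, (∀ x, HasSum (fun j => e.repr x j • r j) (R x)) ∧
      ‖R‖ ≤ ∑' j, ‖r j‖ := by
  let F : ℕ → H →L[ℂ] H := fun j => (innerSL ℂ (e j)).smulRight (r j)
  have hF : ∀ j, ‖F j‖ = ‖r j‖ := by
    intro j
    simp [F, ContinuousLinearMap.norm_smulRight_apply, e.orthonormal.1 j]
  have hs : Summable fun j => ‖F j‖ := by simpa only [hF] using hr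
  refine ⟨∑' j, F j, fun x => ?_, ?_⟩
  · have := (ContinuousLinearMap.apply ℂ H x).hasSum hs.of_norm.hasSum
    have h2 : (fun j => e.repr x j • r j) = fun j => (ContinuousLinearMap.apply ℂ H x) (F j) := by
      funext j; simp [F, e.repr_apply_apply]
    rw [h2]; exact this
  · refine (norm_tsum_le_tsum_norm hs).trans ?_
    simp only [hF, le_refl]

theorem shift_op (a : ℕ → ℂ) (C : ℝ) (hC : 0 ≤ C) (ha : ∀ j, ‖a j‖ ≤ C) (m : ℕ) :
    ∃ W : H →L[ℂ] H, (∀ j, W (e j) = a j • e (j + m)) ∧ ‖W‖ ≤ C := by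
  have horth : Orthonormal ℂ (fun j => e (j + m)) :=
    e.orthonormal.comp (fun j => j + m) (add_left_injective m)
  let L := horth.orthogonalFamily.linearIsometry
  have hmem : ∀ f : lp (fun _ : ℕ => ℂ) 2, Memℓp (fun j => a j * f j) 2 := by
    intro f
    have hf := lp.memℓp f
    have h1 : Memℓp (fun j => C • f j) 2 := hf.const_smul C
    refine memℓp_gen ?_
    have h2 := h1.summable (by norm_num)
    refine Summable.of_nonneg_of_le (fun i => by positivity) (fun i => ?_) h2
    simp only [norm_mul, norm_smul, Real.norm_eq_abs, abs_of_nonneg hC]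
    gcongr
    exact ha i
  let Dg : lp (fun _ : ℕ => ℂ) 2 →ₗ[ℂ] lp (fun _ : ℕ => ℂ) 2 :=
    { toFun := fun f => ⟨fun j => a j * f j, hmem f⟩
      map_add' := by
        intro f g; ext j; exact mul_add (a j) (f j) (g j)
      map_smul' := by
        intro c f; ext j; simp; ring }
  have hb : ∀ f, ‖Dg f‖ ≤ C * ‖f‖ := by
    intro f
    refine lp.norm_le_of_forall_sum_le (by norm_num) (by positivity) ?_
    intro s
    have h3 := lp.sum_rpow_le_norm_rpow (p := 2) (by norm_num) f s
    rw [Real.mul_rpow hC (norm_nonneg _)]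
    calc ∑ i ∈ s, ‖(Dg f) i‖ ^ (2:ENNReal).toReal
        ≤ ∑ i ∈ s, C ^ (2:ENNReal).toReal * ‖f i‖ ^ (2:ENNReal).toReal := by
          refine Finset.sum_le_sum fun i _ => ?_
          rw [← Real.mul_rpow hC (norm_nonneg _)]
          refine Real.rpow_le_rpow (norm_nonneg _) ?_ (by norm_num)
          change ‖a i * f i‖ ≤ _
          rw [norm_mul]; gcongr; exact ha i
      _ ≤ _ := by rw [← Finset.mul_sum]; gcongr
  let Dc := Dg.mkContinuous C hb
  refine ⟨L.toContinuousLinearMap ∘L Dc ∘L e.repr.toLinearIsometry.toContinuousLinearMap, ?_, ?_⟩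
  · intro j
    have h4 : Dg (e.repr (e j)) = lp.single 2 j (a j) := by
      ext i
      change a i * (e.repr (e j)) i = _
      rw [e.repr_self, lp.single_apply, lp.single_apply]
      by_cases h : i = j
      · subst h; simp
      · simp [h]
    change L (Dg (e.repr (e j))) = _
    rw [h4, OrthogonalFamily.linearIsometry_apply_single]
    simp
  · refine ContinuousLinearMap.opNorm_le_bound _ hC fun x => ?_
    change ‖L (Dg (e.repr x))‖ ≤ _
    rw [L.norm_map]
    exact (hb _).trans (by rw [e.repr.norm_map])

theorem shift_l1_op (a : ℕ → ℂ) (r : ℕ → H) (C τ : ℝ) (hC : 0 ≤ C) (m : ℕ)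
    (ha : ∀ j, ‖a j‖ ≤ C) (t : ℕ → ℝ) (hrt : ∀ j, ‖r j‖ ≤ t j) (ht : Summable t)
    (hτ : ∑' j, t j ≤ τ) :
    ∃ U : H →L[ℂ] H, (∀ j, U (e j) = a j • e (j + m) + r j) ∧ ‖U‖ ≤ C + τ := by
  obtain ⟨W, hW, hWn⟩ := shift_op e a C hC ha m
  have hr : Summable fun j => ‖r j‖ := ht.of_nonneg_of_le (fun _ => norm_nonneg _) hrt
  obtain ⟨R, hR, hRn⟩ := l1_op e r hr
  refine ⟨W + R, fun j => ?_, (norm_add_le _ _).trans (add_le_add hWn (hRn.trans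
    ((hr.tsum_le_tsum hrt ht).trans hτ)))⟩
  rw [add_apply, hW]
  congr 1
  have h1 := hR (e j)
  refine h1.unique ?_
  have h2 : (fun i => e.repr (e j) i • r i) = fun i => if i = j then r j else 0 := by
    funext i
    rw [coord_self]
    by_cases h : i = j
    · subst h; simp
    · simp [h]
  rw [h2]
  exact hasSum_ite_eq j (r j)
end
end SecP1

section SecP1b
open Polynomial Filter Topology
set_option linter.unusedSectionVars false

noncomputable def gam (b : ℕ) : ℝ := 4 ^ ((b + 2) ^ 2)

noncomputable def thet (b : ℕ) : ℝ := (1 / 2) ^ ((b + 2) ^ 2)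

theorem thet_pos (b : ℕ) : 0 < thet b := by unfold thet; positivity

theorem gam_eq (b : ℕ) : 2 / gam b = 2 * thet b * thet b := by
  unfold gam thet
  rw [mul_assoc, ← mul_pow, div_eq_mul_inv, ← inv_pow]; norm_num

theorem thet_tail (b i : ℕ) : thet (b + 1 + i) ≤ thet b * (1/2)^(b+2) * (1/2)^(i+1) := by
  unfold thet
  rw [← pow_add, ← pow_add]
  apply pow_le_pow_of_le_one (by norm_num) (by norm_num)
  nlinarith [Nat.zero_le (b * i)]

theorem thet_le (b : ℕ) : thet b ≤ (1/16) * (1/2)^b := by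
  have : (1/16 : ℝ) = (1/2)^4 := by norm_num
  unfold thet
  rw [this, ← pow_add]
  apply pow_le_pow_of_le_one (by norm_num) (by norm_num)
  nlinarith

theorem thet_summable : Summable thet :=
  Summable.of_nonneg_of_le (fun b => (thet_pos b).le) thet_le (summable_geometric_two.mul_left _)

theorem thet_tsum : ∑' b, thet b ≤ 1/8 := by
  refine (thet_summable.tsum_le_tsum thet_le (summable_geometric_two.mul_left _)).trans ?_
  rw [tsum_mul_left, tsum_geometric_two]; norm_num

theorem thet_tail_tsum (b : ℕ) : ∑' i, thet (b + 1 + i) ≤ thet b * (1/2)^(b+2) := by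
  have hs : Summable fun i : ℕ => thet b * (1/2)^(b+2) * ((1/2:ℝ) * (1/2)^i) :=
    (summable_geometric_two.mul_left _).mul_left _
  have hle : ∀ i, thet (b + 1 + i) ≤ thet b * (1/2)^(b+2) * ((1/2:ℝ) * (1/2)^i) := by
    intro i
    refine (thet_tail b i).trans (le_of_eq ?_)
    rw [pow_succ' (1/2:ℝ) i]
  have hs2 : Summable fun i : ℕ => thet (b + 1 + i) :=
    Summable.of_nonneg_of_le (fun _ => (thet_pos _).le) hle hs
  refine (hs2.tsum_le_tsum hle hs).trans ?_
  rw [tsum_mul_left, tsum_mul_left, tsum_geometric_two]; norm_num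

section
variable {H : Type} [NormedAddCommGroup H] [InnerProductSpace ℂ H] [CompleteSpace H]
  (e : HilbertBasis ℕ ℂ H)

theorem exists_K (D k : ℕ → ℕ) (hD : StrictMono D) (hbD : ∀ b, b < D b) (hk : ∀ b, k b ≤ b) :
    ∃ K : H →L[ℂ] H, IsSelfAdjoint K ∧ ‖K‖ < 1 ∧
      ∀ w b, ‖inner ℂ (e (D b)) (K w) - thet b * inner ℂ (e (k b)) w‖
        ≤ ‖w‖ * (thet b * (1/2)^(b+2)) := by
  let G : ℕ → H →L[ℂ] H := fun b => (innerSL ℂ (e (D b))).smulRight (e (k b)) +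
    (innerSL ℂ (e (k b))).smulRight (e (D b))
  have hn : ∀ j, ‖e j‖ = 1 := e.orthonormal.1
  have hG : ∀ b, ‖G b‖ ≤ 2 := by
    intro b
    refine (norm_add_le _ _).trans ?_
    simp [ContinuousLinearMap.norm_smulRight_apply, hn]; norm_num
  have hGs : ∀ b, IsSelfAdjoint (G b) := by
    intro b
    rw [ContinuousLinearMap.isSelfAdjoint_iff_isSymmetric]
    intro x y
    simp [G, inner_add_left, inner_add_right, inner_smul_left, inner_smul_right]
    ring
  have hle : ∀ b, ‖(thet b : ℂ) • G b‖ ≤ thet b * 2 := by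
    intro b
    rw [norm_smul, Complex.norm_real, Real.norm_of_nonneg (thet_pos b).le]
    exact mul_le_mul_of_nonneg_left (hG b) (thet_pos b).le
  have hs2 := thet_summable.mul_right 2
  have hs : Summable fun b => ‖(thet b : ℂ) • G b‖ :=
    hs2.of_nonneg_of_le (fun _ => norm_nonneg _) hle
  refine ⟨∑' b, (thet b : ℂ) • G b, ?_, ?_, ?_⟩
  · have h0 := hs.of_norm.hasSum.star
    have h1 : (fun b => star ((thet b : ℂ) • G b)) = fun b => (thet b : ℂ) • G b := by
      funext b
      rw [star_smul, (hGs b).star_eq]; simp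
    rw [h1] at h0
    exact (h0.tsum_eq).symm
  · refine (norm_tsum_le_tsum_norm hs).trans_lt ?_
    refine (hs.tsum_le_tsum hle hs2).trans_lt ?_
    rw [tsum_mul_right]
    have := thet_tsum
    linarith
  · intro w b
    have h1 := ((innerSL ℂ (e (D b))) ∘L (ContinuousLinearMap.apply ℂ H w)).hasSum hs.of_norm.hasSum
    set f : ℕ → ℂ := fun b' => ((innerSL ℂ (e (D b))) ∘L (ContinuousLinearMap.apply ℂ H w))
      ((thet b' : ℂ) • G b') with hf
    have hfv : ∀ b', f b' = thet b' * (inner ℂ (e (D b')) w * (if D b = k b' then 1 else 0) +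
        inner ℂ (e (k b')) w * (if D b = D b' then 1 else 0)) := by
      intro b'
      have := orthonormal_iff_ite.mp e.orthonormal
      change inner ℂ (e (D b)) ((thet b' : ℂ) • (inner ℂ (e (D b')) w • e (k b') +
        inner ℂ (e (k b')) w • e (D b'))) = _
      rw [inner_smul_right, inner_add_right, inner_smul_right, inner_smul_right, this, this]
    have h2 : (fun i => f i) = f := rfl
    change HasSum f (inner ℂ (e (D b)) ((∑' b, (thet b : ℂ) • G b) w)) at h1
    rw [← h1.tsum_eq, ← h1.summable.sum_add_tsum_nat_add (b+1), Finset.sum_range_succ]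
    have h3 : ∑ x ∈ Finset.range b, f x = 0 := by
      refine Finset.sum_eq_zero fun i hi => ?_
      rw [Finset.mem_range] at hi
      have a1 : D b ≠ k i := by have := hk i; have := hbD b; omega
      have a2 : D b ≠ D i := fun h => by have := hD.injective h; omega
      simp [hfv, a1, a2]
    have h4 : f b = thet b * inner ℂ (e (k b)) w := by
      have a1 : D b ≠ k b := by have := hk b; have := hbD b; omega
      simp [hfv, a1]
    rw [h3, h4, zero_add, add_sub_cancel_left]
    have h5 : ∀ i, ‖f (i + (b+1))‖ ≤ ‖w‖ * thet (b + 1 + i) := by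
      intro i
      have a2 : D b ≠ D (i + (b+1)) := fun h => by have := hD.injective h; omega
      rw [hfv, if_neg a2, mul_zero, add_zero, norm_mul, Complex.norm_real,
        Real.norm_of_nonneg (thet_pos _).le, mul_comm, add_comm i]
      refine mul_le_mul_of_nonneg_right ?_ (thet_pos _).le
      split_ifs
      · rw [mul_one]; simpa [hn] using norm_inner_le_norm (𝕜 := ℂ) (e (D (b+1+i))) w
      · simp
    have hs3 : Summable fun i => ‖w‖ * thet (b + 1 + i) := by
      apply Summable.mul_left
      have := (summable_nat_add_iff (b+1)).mpr thet_summable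
      simpa [add_comm] using this
    refine (tsum_of_norm_bounded hs3.hasSum h5).trans ?_
    rw [tsum_mul_left]
    exact mul_le_mul_of_nonneg_left (thet_tail_tsum b) (norm_nonneg _)

theorem exists_V (D : ℕ → ℕ) (hD : StrictMono D) (hbD : ∀ b, b < D b) (S : ℕ → Prop)
    (hS : {b | S b}.Infinite) :
    ∃ V : H ≃ₗᵢ[ℂ] H, ∀ x : H,
      (∀ᶠ b in atTop, S b → ‖e.repr x (D b)‖ ≤ 2 / gam b) →
      (∀ᶠ b in atTop, S b → ‖e.repr (V x) (D b)‖ ≤ 2 / gam b) → x = 0 := by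
  classical
  let k : ℕ → ℕ := fun b => (Nat.unpair (Nat.count S b)).1
  have hk : ∀ b, k b ≤ b := fun b => (Nat.unpair_left_le _).trans (Nat.count_le S)
  have hkh : ∀ κ n, ∃ b, n ≤ b ∧ S b ∧ k b = κ := by
    intro κ n
    refine ⟨Nat.nth S (Nat.pair κ n), ?_, Nat.nth_mem_of_infinite hS _, ?_⟩
    · exact (Nat.right_le_pair κ n).trans (Nat.nth_strictMono hS).le_apply
    · simp [k, Nat.count_nth_of_infinite hS]
  obtain ⟨K, hsa, hK1, hKe⟩ := exists_K e D k hD hbD hk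
  have hIK : ‖Complex.I • K‖ < 1 := by simpa [norm_smul] using hK1
  have hIK' : ‖-(Complex.I • K)‖ < 1 := by simpa using hIK
  let P := ContinuousLinearEquiv.ofUnit (Units.oneSub (Complex.I • K) hIK)
  let P' := ContinuousLinearEquiv.ofUnit (Units.oneSub (-(Complex.I • K)) hIK')
  have hP : ∀ w, P w = w - Complex.I • K w := fun w => rfl
  have hP' : ∀ w, P' w = w + Complex.I • K w := by
    intro w
    change w - (-(Complex.I • K)) w = _
    simp
  have hnorm : ∀ w, ‖P' w‖ = ‖P w‖ := by
    intro w
    have hr : (inner ℂ w (K w)).im = 0 := by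
      have h1 := (ContinuousLinearMap.isSelfAdjoint_iff_isSymmetric.mp hsa) w w
      have h2 : inner ℂ w (K w) = (starRingEnd ℂ) (inner ℂ w (K w)) := by
        rw [inner_conj_symm]; exact h1.symm
      exact Complex.conj_eq_iff_im.mp h2.symm
    have h1 := norm_add_sq (𝕜 := ℂ) w (Complex.I • K w)
    have h2 := norm_sub_sq (𝕜 := ℂ) w (Complex.I • K w)
    have h3 : RCLike.re (inner ℂ w (Complex.I • K w)) = 0 := by
      rw [inner_smul_right]; simp [hr]
    rw [h3] at h1 h2
    rw [hP, hP', ← sq_eq_sq₀ (norm_nonneg _) (norm_nonneg _), h1, h2]; ring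
  let V : H ≃ₗᵢ[ℂ] H :=
    { toLinearEquiv := (P.symm.trans P').toLinearEquiv
      norm_map' := by
        intro x
        change ‖P' (P.symm x)‖ = ‖x‖
        rw [hnorm, ContinuousLinearEquiv.apply_symm_apply] }
  refine ⟨V, fun x h1 h2 => ?_⟩
  set w := P.symm x with hw
  have hx : x = w - Complex.I • K w := by rw [← hP, hw, ContinuousLinearEquiv.apply_symm_apply]
  have hVx : V x = w + Complex.I • K w := hP' w
  have hw0 : ∀ κ, inner ℂ (e κ) w = 0 := by
    intro κ
    obtain ⟨b1, hb1⟩ := eventually_atTop.mp (h1.and h2)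
    have hest : ∀ n, b1 ≤ n → ‖inner ℂ (e κ) w‖ ≤ (2 + ‖w‖) * (1/2)^n := by
      intro n hn
      obtain ⟨b, hb, hSb, hkb⟩ := hkh κ n
      obtain ⟨u1, u2⟩ := hb1 b (hn.trans hb)
      have u1 := u1 hSb
      have u2 := u2 hSb
      have hKe := hKe w b
      rw [hkb] at hKe
      rw [e.repr_apply_apply] at u1 u2
      have h5 : inner ℂ (e (D b)) (V x) - inner ℂ (e (D b)) x =
          2 * (Complex.I * inner ℂ (e (D b)) (K w)) := by
        rw [← inner_sub_right, hVx]
        have hq : w + Complex.I • K w - x = (2 * Complex.I) • K w := by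
          calc w + Complex.I • K w - x = w + Complex.I • K w - (w - Complex.I • K w) := by rw [← hx]
            _ = _ := by module
        rw [hq, inner_smul_right]; ring
      have h6 : ‖inner ℂ (e (D b)) (K w)‖ ≤ 2 / gam b := by
        have := norm_sub_le (inner ℂ (e (D b)) (V x)) (inner ℂ (e (D b)) x)
        rw [h5] at this
        simp only [norm_mul, Complex.norm_I, Complex.norm_ofNat] at this
        linarith
      rw [gam_eq] at h6
      have h7 : ‖(thet b : ℂ) * inner ℂ (e κ) w‖ ≤ 2 * thet b * thet b + ‖w‖ * (thet b * (1/2)^(b+2)) := by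
        have := norm_sub_norm_le ((thet b : ℂ) * inner ℂ (e κ) w) (inner ℂ (e (D b)) (K w))
        rw [norm_sub_rev] at this
        linarith
      rw [norm_mul, Complex.norm_real, Real.norm_of_nonneg (thet_pos b).le] at h7
      have h8 : ‖inner ℂ (e κ) w‖ ≤ 2 * thet b + ‖w‖ * (1/2)^(b+2) := by
        refine le_of_mul_le_mul_left ?_ (thet_pos b)
        linarith
      have h9 : thet b ≤ (1/2)^n := by
        refine (thet_le b).trans ?_
        have : (1/2:ℝ)^b ≤ (1/2)^n := pow_le_pow_of_le_one (by norm_num) (by norm_num) hb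
        have : (0:ℝ) ≤ (1/2)^b := by positivity
        linarith
      have h10 : (1/2:ℝ)^(b+2) ≤ (1/2)^n := pow_le_pow_of_le_one (by norm_num) (by norm_num) (by omega)
      nlinarith [norm_nonneg w]
    have ht : Tendsto (fun n : ℕ => (2 + ‖w‖) * (1/2:ℝ)^n) atTop (𝓝 ((2 + ‖w‖) * 0)) :=
      (tendsto_pow_atTop_nhds_zero_of_lt_one (by norm_num) (by norm_num)).const_mul _
    rw [mul_zero] at ht
    have := ge_of_tendsto ht (eventually_atTop.mpr ⟨b1, hest⟩)
    simpa using this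
  have hwz : w = 0 := by
    apply e.repr.injective
    ext κ
    rw [e.repr_apply_apply, hw0]; simp
  rw [hx, hwz]; simp
end
end SecP1b

section SecP2
open Polynomial Filter Topology
set_option linter.unusedSectionVars false

noncomputable def norm1 (p : ℂ[X]) : ℝ := ∑ i ∈ p.support, ‖p.coeff i‖

theorem norm1_eq (p : ℂ[X]) (s : Finset ℕ) (h : p.support ⊆ s) :
    norm1 p = ∑ i ∈ s, ‖p.coeff i‖ := by
  refine Finset.sum_subset h fun i _ hi => ?_
  rw [notMem_support_iff.mp hi, norm_zero]

theorem norm1_nonneg (p : ℂ[X]) : 0 ≤ norm1 p := Finset.sum_nonneg fun _ _ => norm_nonneg _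

theorem coeff_le_norm1 (p : ℂ[X]) (i : ℕ) : ‖p.coeff i‖ ≤ norm1 p := by
  rw [norm1_eq p (insert i p.support) (Finset.subset_insert _ _)]
  exact Finset.single_le_sum (f := fun i => ‖p.coeff i‖) (fun _ _ => norm_nonneg _)
    (Finset.mem_insert_self _ _)

theorem norm1_add_le (p q : ℂ[X]) : norm1 (p + q) ≤ norm1 p + norm1 q := by
  have h := norm1_eq (p + q) (p.support ∪ q.support) support_add
  rw [h, norm1_eq p _ Finset.subset_union_left, norm1_eq q _ Finset.subset_union_right,
    ← Finset.sum_add_distrib]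
  exact Finset.sum_le_sum fun i _ => by rw [coeff_add]; exact norm_add_le _ _

theorem norm1_zero : norm1 0 = 0 := by simp [norm1]

theorem norm1_sum_le {ι : Type*} (s : Finset ι) (f : ι → ℂ[X]) :
    norm1 (∑ i ∈ s, f i) ≤ ∑ i ∈ s, norm1 (f i) := by
  classical
  induction s using Finset.induction_on with
  | empty => simp [norm1_zero]
  | insert a s ha ih =>
    rw [Finset.sum_insert ha, Finset.sum_insert ha]
    exact (norm1_add_le _ _).trans (by linarith)

theorem norm1_smul (c : ℂ) (p : ℂ[X]) : norm1 (c • p) ≤ ‖c‖ * norm1 p := by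
  rw [norm1_eq (c • p) p.support (support_smul _ _), norm1, Finset.mul_sum]
  exact Finset.sum_le_sum fun i _ => by rw [coeff_smul, norm_smul]

theorem norm1_neg (p : ℂ[X]) : norm1 (-p) = norm1 p := by simp [norm1]

theorem norm1_sub_le (p q : ℂ[X]) : norm1 (p - q) ≤ norm1 p + norm1 q := by
  rw [sub_eq_add_neg, ← norm1_neg q]; exact norm1_add_le _ _

theorem norm1_X_pow (n : ℕ) : norm1 (X ^ n) ≤ 1 := by
  rw [norm1_eq (X ^ n) {n} (by
    intro i hi
    rw [mem_support_iff, coeff_X_pow] at hi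
    simpa using hi)]
  simp

theorem norm1_X_pow_mul (n : ℕ) (p : ℂ[X]) : norm1 (X ^ n * p) ≤ norm1 p := by
  have h : (X ^ n * p).support ⊆ p.support.map ⟨fun i => i + n, add_left_injective n⟩ := by
    intro i hi
    rw [mem_support_iff, coeff_X_pow_mul'] at hi
    split_ifs at hi with hn
    · rw [Finset.mem_map]
      exact ⟨i - n, mem_support_iff.mpr hi, by simp; omega⟩
    · simp at hi
  rw [norm1_eq _ _ h, Finset.sum_map]
  simp [norm1, coeff_X_pow_mul]

theorem norm1_mul_le (p q : ℂ[X]) : norm1 (p * q) ≤ norm1 p * norm1 q := by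
  have h : p * q = ∑ i ∈ p.support, p.coeff i • (X ^ i * q) := by
    conv_lhs => rw [p.as_sum_support_C_mul_X_pow]
    rw [Finset.sum_mul]
    exact Finset.sum_congr rfl fun i _ => by rw [smul_eq_C_mul, mul_assoc]
  rw [h]
  refine (norm1_sum_le _ _).trans ?_
  rw [norm1, Finset.sum_mul]
  refine Finset.sum_le_sum fun i _ => (norm1_smul _ _).trans ?_
  exact mul_le_mul_of_nonneg_left (norm1_X_pow_mul _ _) (norm_nonneg _)

theorem norm1_le_of_coeff (p : ℂ[X]) (n : ℕ) (hn : p.natDegree ≤ n) (R : ℝ)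
    (h : ∀ a, ‖p.coeff a‖ ≤ R) : norm1 p ≤ (n + 1) * R := by
  rw [norm1_eq p (Finset.range (n+1)) (by
    intro i hi
    rw [Finset.mem_range]
    have := le_natDegree_of_mem_supp i hi
    omega)]
  refine (Finset.sum_le_card_nsmul _ _ R fun i _ => h i).trans ?_
  simp

theorem net_lemma (ν : ℕ) (R ε : ℝ) (hε : 0 < ε) :
    ∃ L : List ℂ[X], (∀ p ∈ L, p.natDegree ≤ ν) ∧
      ∀ Y q : ℂ[X], (∀ a, ‖Y.coeff a‖ ≤ R) → (∀ a, ‖q.coeff a‖ ≤ R) → 1 ≤ ‖Y.coeff 0‖ →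
        ∃ p ∈ L, ∀ a ≤ ν, ‖(p * Y).coeff a - q.coeff a‖ ≤ ε := by
  classical
  let Kc : Set ((ℕ → ℂ) × (ℕ → ℂ)) :=
    ((Set.univ.pi fun _ => Metric.closedBall 0 R) ×ˢ (Set.univ.pi fun _ => Metric.closedBall 0 R))
      ∩ {yz | 1 ≤ ‖yz.1 0‖}
  have hKc : IsCompact Kc := by
    refine IsCompact.inter_right ?_ (isClosed_le continuous_const (by fun_prop))
    exact (isCompact_univ_pi fun _ => isCompact_closedBall _ _).prod
      (isCompact_univ_pi fun _ => isCompact_closedBall _ _)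
  let F : ℂ[X] → (ℕ → ℂ) × (ℕ → ℂ) → ℕ → ℂ := fun p yz a =>
    ∑ x ∈ Finset.HasAntidiagonal.antidiagonal a, p.coeff x.1 * yz.1 x.2 - yz.2 a
  let U : {p : ℂ[X] // p.natDegree ≤ ν} → Set ((ℕ → ℂ) × (ℕ → ℂ)) := fun p =>
    ⋂ a ∈ Finset.range (ν + 1), {yz | ‖F p yz a‖ < ε}
  have hU : ∀ p, IsOpen (U p) := by
    intro p
    refine isOpen_biInter_finset fun a _ => isOpen_lt ?_ continuous_const
    simp only [F]
    fun_prop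
  have hcov : Kc ⊆ ⋃ p, U p := by
    rintro ⟨y, z⟩ ⟨-, h1⟩
    simp only [Set.mem_setOf_eq] at h1
    have hy0 : PowerSeries.constantCoeff (PowerSeries.mk y) ≠ 0 := by
      intro h
      rw [← PowerSeries.coeff_zero_eq_constantCoeff_apply, PowerSeries.coeff_mk] at h
      rw [h, norm_zero] at h1; linarith
    let φ : PowerSeries ℂ := PowerSeries.mk z * (PowerSeries.mk y)⁻¹
    have hφ : φ * PowerSeries.mk y = PowerSeries.mk z := by
      rw [mul_assoc, PowerSeries.inv_mul_cancel _ hy0, mul_one]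
    have hd : (PowerSeries.trunc (ν + 1) φ).natDegree ≤ ν := by
      have := PowerSeries.natDegree_trunc_lt φ ν
      omega
    rw [Set.mem_iUnion]
    refine ⟨⟨_, hd⟩, ?_⟩
    simp only [U, Set.mem_iInter, Finset.mem_range, Set.mem_setOf_eq]
    intro a ha
    have : F (PowerSeries.trunc (ν + 1) φ) (y, z) a = 0 := by
      simp only [F]
      have h2 : z a = PowerSeries.coeff a (φ * PowerSeries.mk y) := by
        rw [hφ, PowerSeries.coeff_mk]
      rw [h2, PowerSeries.coeff_mul, sub_eq_zero]
      refine Finset.sum_congr rfl fun x hx => ?_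
      rw [Finset.HasAntidiagonal.mem_antidiagonal] at hx
      rw [PowerSeries.coeff_trunc, if_pos (by omega), PowerSeries.coeff_mk]
    rw [this, norm_zero]; exact hε
  obtain ⟨t, ht⟩ := hKc.elim_finite_subcover U hU hcov
  refine ⟨t.toList.map Subtype.val, ?_, ?_⟩
  · intro p hp
    rw [List.mem_map] at hp
    obtain ⟨p', -, rfl⟩ := hp
    exact p'.2
  · intro Y q hY hq h1
    have hmem : (Y.coeff, q.coeff) ∈ Kc := by
      refine ⟨⟨?_, ?_⟩, h1⟩
      · intro a _; simpa using hY a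
      · intro a _; simpa using hq a
    have := ht hmem
    simp only [Set.mem_iUnion] at this
    obtain ⟨p, hpt, hp⟩ := this
    refine ⟨p, List.mem_map.mpr ⟨p, Finset.mem_toList.mpr hpt, rfl⟩, fun a ha => ?_⟩
    simp only [U, Set.mem_iInter, Finset.mem_range, Set.mem_setOf_eq] at hp
    have := hp a (by omega)
    rw [coeff_mul]
    exact this.le
end SecP2

section SecP3
open Polynomial Filter Topology
set_option linter.unusedSectionVars false

theorem gam_ge_one (b : ℕ) : 1 ≤ gam b := one_le_pow₀ (by norm_num)

noncomputable def Rf (b N : ℕ) (M : ℝ) : ℝ := b * ((N + 1) * M + gam b) + b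
noncomputable def epsf (b N : ℕ) (B : ℝ) : ℝ := 1 / ((b + 1) * (N + 1) * (B + 2))

structure RData where
  N : ℕ → ℕ
  D : ℕ → ℕ
  ν : ℕ → ℕ
  s : ℕ → ℕ
  β : ℕ → ℕ
  η : ℕ → ℝ
  ζ : ℕ → ℝ
  Q : ℕ → ℝ
  B : ℕ → ℝ
  M : ℕ → ℝ
  p : ℕ → ℂ[X]
  N0 : N 0 = 1
  Nsucc : ∀ b, N (b + 1) = D b + ν b
  hND : ∀ b, 3 * N b < D b
  hν : ∀ b, ν b ≤ N b
  hsν : ∀ b, s b + ν b ≤ N b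
  hp : ∀ b, (p b).natDegree ≤ ν b
  hp1 : ∀ b, norm1 (p b) ≤ Q b
  hζ1 : ∀ b, 1 ≤ ζ b
  hζQ : ∀ b, ζ b ≤ Q b
  h2Q : ∀ b, 2 ^ b ≤ Q b
  hη : ∀ b, 0 < η b
  hη5 : ∀ b, 9 * η b * (N b + 1) * (M b + 1) * Q b ^ 3 * 2 ^ b ≤ 1
  hG : ∀ b, 3 * (N b + 1) * 2 ^ b * (2 + Q b * (B b + 1)) ≤
    η b * (1 + 1 / ((N b : ℝ) + 1)) ^ (D b - N b)
  B0 : 1 ≤ B 0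
  Bsucc : ∀ b, B (b + 1) =
    B b + η b * (1 + 1 / ((N b : ℝ) + 1)) ^ (D b - N b) + 1 + Q b * (B b + 1)
  M0 : 1 ≤ M 0
  Msucc : ∀ b, M (b + 1) = M b + 1 / η b + Q b * (1 + Q b)
  hβ : ∀ b, β b ≤ b
  hS : ∀ b, β b = b → ν b = N b ∧ s b = 0 ∧ p b = 1 ∧ ζ b = gam b
  hW : ∀ b, β b ≠ b → ν b = N (β b) ∧ s b = D (β b) ∧ Q b = Q (β b) ∧
    (β b + 1) * (N (β b) + 1) * Rf (β b) (N (β b)) (M (β b)) ≤ ζ b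
  hββ : ∀ b i, β b ≤ i → i ≤ b → β i = β b
  hRQ : ∀ b, β b = b → (N b + 1) * Rf b (N b) (M b) ≤ Q b
  hnet : ∀ b, β b = b → ∀ Y q : ℂ[X], (∀ a, ‖Y.coeff a‖ ≤ Rf b (N b) (M b)) →
    (∀ a, ‖q.coeff a‖ ≤ Rf b (N b) (M b)) → 1 ≤ ‖Y.coeff 0‖ →
    ∃ k, b < k ∧ β k = b ∧
      ∀ a ≤ N b, ‖(p k * Y).coeff a - q.coeff a‖ ≤ epsf b (N b) (B b)
  hinf : {b | β b = b}.Infinite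

structure RSt where
  b : ℕ
  N : ℕ
  B : ℝ
  M : ℝ
  β : ℕ
  νs : ℕ
  c : ℕ
  Q : ℝ
  ζW : ℝ
  L : List ℂ[X]

namespace RSt
open Classical in
noncomputable def netL (x : RSt) : List ℂ[X] :=
  if h : 0 < epsf x.b x.N x.B then
    Classical.choose (net_lemma x.N (Rf x.b x.N x.M) (epsf x.b x.N x.B) h) else []

noncomputable def zWnew (x : RSt) : ℝ := (x.b + 1) * (x.N + 1) * Rf x.b x.N x.M + 1

noncomputable def Qnew (x : RSt) : ℝ := 2 ^ (x.b + x.netL.length + 1) + gam x.b + x.zWnew +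
  (x.netL.map norm1).sum + (x.N + 1) * Rf x.b x.N x.M

open Classical in
noncomputable def bQ (x : RSt) : ℝ := if x.L = [] then x.Qnew else x.Q

noncomputable def bη (x : RSt) : ℝ := 1 / (9 * (x.N + 1) * (x.M + 1) * x.bQ ^ 3 * 2 ^ x.b)

theorem exists_D (N : ℕ) (η C : ℝ) (hη : 0 < η) :
    ∃ D, 3 * N < D ∧ C ≤ η * (1 + 1 / ((N : ℝ) + 1)) ^ (D - N) := by
  have h1 : (1:ℝ) < 1 + 1 / ((N : ℝ) + 1) := by
    have : (0:ℝ) < 1 / ((N : ℝ) + 1) := by positivity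
    linarith
  obtain ⟨n, hn⟩ := pow_unbounded_of_one_lt (C / η) h1
  refine ⟨3 * N + 1 + n, by omega, ?_⟩
  rw [div_lt_iff₀ hη] at hn
  have h2 : (1 + 1 / ((N : ℝ) + 1)) ^ n ≤ (1 + 1 / ((N : ℝ) + 1)) ^ (3 * N + 1 + n - N) :=
    pow_le_pow_right₀ h1.le (by omega)
  nlinarith

open Classical in
noncomputable def bD (x : RSt) : ℕ :=
  if h : 0 < x.bη then Classical.choose (exists_D x.N x.bη
    (3 * (x.N + 1) * 2 ^ x.b * (2 + x.bQ * (x.B + 1))) h) else 0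

open Classical in
noncomputable def next (x : RSt) : RSt where
  b := x.b + 1
  N := x.bD + (if x.L = [] then x.N else x.νs)
  B := x.B + x.bη * (1 + 1 / ((x.N : ℝ) + 1)) ^ (x.bD - x.N) + 1 + x.bQ * (x.B + 1)
  M := x.M + 1 / x.bη + x.bQ * (1 + x.bQ)
  β := if x.L = [] then x.b else x.β
  νs := if x.L = [] then x.N else x.νs
  c := if x.L = [] then x.bD else x.c
  Q := x.bQ
  ζW := if x.L = [] then x.zWnew else x.ζW
  L := if x.L = [] then x.netL else x.L.tail

noncomputable def st : ℕ → RSt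
  | 0 => ⟨0, 1, 1, 1, 0, 0, 0, 1, 1, []⟩
  | n + 1 => (st n).next

theorem st_b (n : ℕ) : (st n).b = n := by
  induction n with
  | zero => rfl
  | succ n ih => change (st n).b + 1 = _; rw [ih]

theorem Rf_nonneg (b N : ℕ) (M : ℝ) (hM : 1 ≤ M) : 0 ≤ Rf b N M := by
  unfold Rf; have := gam_ge_one b; positivity

/-- basic positivity invariant -/
def Inv (x : RSt) : Prop := 1 ≤ x.B ∧ 1 ≤ x.M ∧ 1 ≤ x.Q

theorem zW_ge (x : RSt) (h : 1 ≤ x.M) : 1 ≤ x.zWnew := by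
  have := Rf_nonneg x.b x.N x.M h
  unfold zWnew
  have : 0 ≤ ((x.b:ℝ) + 1) * (x.N + 1) * Rf x.b x.N x.M := by positivity
  linarith

theorem sum_norm1_nonneg (L : List ℂ[X]) : 0 ≤ (L.map norm1).sum := by
  apply List.sum_nonneg
  intro a ha
  rw [List.mem_map] at ha
  obtain ⟨p, -, rfl⟩ := ha
  exact norm1_nonneg p

theorem Qnew_facts (x : RSt) (h : 1 ≤ x.M) :
    1 ≤ x.Qnew ∧ 2 ^ (x.b + x.netL.length + 1) ≤ x.Qnew ∧ gam x.b ≤ x.Qnew ∧ x.zWnew ≤ x.Qnew ∧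
    (x.N + 1) * Rf x.b x.N x.M ≤ x.Qnew ∧ ∀ p ∈ x.netL, norm1 p ≤ x.Qnew := by
  have h1 := Rf_nonneg x.b x.N x.M h
  have h2 := zW_ge x h
  have h3 := gam_ge_one x.b
  have h4 := sum_norm1_nonneg x.netL
  have h5 : (0:ℝ) ≤ 2 ^ (x.b + x.netL.length + 1) := by positivity
  have h6 : 0 ≤ ((x.N:ℝ) + 1) * Rf x.b x.N x.M := by positivity
  unfold Qnew
  refine ⟨by linarith, by linarith, by linarith, by linarith, by linarith, fun p hp => ?_⟩
  have : norm1 p ≤ (x.netL.map norm1).sum := by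
    apply List.single_le_sum _ _ (List.mem_map.mpr ⟨p, hp, rfl⟩)
    intro a ha
    rw [List.mem_map] at ha
    obtain ⟨p, -, rfl⟩ := ha
    exact norm1_nonneg p
  linarith

theorem bQ_ge (x : RSt) (h : x.Inv) : 1 ≤ x.bQ := by
  unfold bQ
  split_ifs
  · exact (Qnew_facts x h.2.1).1
  · exact h.2.2

theorem bη_pos (x : RSt) (h : x.Inv) : 0 < x.bη := by
  have := bQ_ge x h
  have := h.2.1
  unfold bη; positivity

theorem bD_spec (x : RSt) (h : x.Inv) : 3 * x.N < x.bD ∧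
    3 * (x.N + 1) * 2 ^ x.b * (2 + x.bQ * (x.B + 1)) ≤
      x.bη * (1 + 1 / ((x.N : ℝ) + 1)) ^ (x.bD - x.N) := by
  unfold bD
  rw [dif_pos (bη_pos x h)]
  exact Classical.choose_spec (exists_D x.N x.bη
    (3 * (x.N + 1) * 2 ^ x.b * (2 + x.bQ * (x.B + 1))) (bη_pos x h))

theorem inv_next (x : RSt) (h : x.Inv) : x.next.Inv := by
  have h1 := bQ_ge x h
  have h2 := bη_pos x h
  obtain ⟨hB, hM, hQ⟩ := h
  refine ⟨?_, ?_, h1⟩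
  · have : 0 ≤ x.bη * (1 + 1 / ((x.N : ℝ) + 1)) ^ (x.bD - x.N) := by positivity
    have : 0 ≤ x.bQ * (x.B + 1) := by positivity
    change 1 ≤ x.B + x.bη * (1 + 1 / ((x.N : ℝ) + 1)) ^ (x.bD - x.N) + 1 + x.bQ * (x.B + 1)
    linarith
  · have : 0 ≤ 1 / x.bη := by positivity
    have : 0 ≤ x.bQ * (1 + x.bQ) := by positivity
    change 1 ≤ x.M + 1 / x.bη + x.bQ * (1 + x.bQ)
    linarith

theorem inv_st (n : ℕ) : (st n).Inv := by
  induction n with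
  | zero => exact ⟨le_rfl, le_rfl, le_rfl⟩
  | succ n ih => exact inv_next _ ih

theorem persist (b : ℕ) (hb : (st b).L = []) : ∀ i, i ≤ (st b).netL.length →
    (st (b + 1 + i)).β = b ∧ (st (b + 1 + i)).νs = (st b).N ∧ (st (b + 1 + i)).c = (st b).bD ∧
    (st (b + 1 + i)).Q = (st b).Qnew ∧ (st (b + 1 + i)).ζW = (st b).zWnew ∧
    (st (b + 1 + i)).L = (st b).netL.drop i ∧ (st b).bD + (st b).N ≤ (st (b + 1 + i)).N := by
  intro i
  induction i with
  | zero =>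
    intro _
    change (st b).next.β = b ∧ (st b).next.νs = (st b).N ∧ (st b).next.c = (st b).bD ∧
      (st b).next.Q = (st b).Qnew ∧ (st b).next.ζW = (st b).zWnew ∧
      (st b).next.L = (st b).netL.drop 0 ∧ (st b).bD + (st b).N ≤ (st b).next.N
    simp [next, hb, bQ, st_b]
  | succ i ih =>
    intro hi
    obtain ⟨h1, h2, h3, h4, h5, h6, h7⟩ := ih (by omega)
    have hne : (st (b + 1 + i)).L ≠ [] := by
      rw [h6]
      intro h
      have := congrArg List.length h
      simp at this
      omega
    have hD := (bD_spec _ (inv_st (b + 1 + i))).1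
    change (st (b + 1 + i)).next.β = b ∧ (st (b + 1 + i)).next.νs = (st b).N ∧
      (st (b + 1 + i)).next.c = (st b).bD ∧ (st (b + 1 + i)).next.Q = (st b).Qnew ∧
      (st (b + 1 + i)).next.ζW = (st b).zWnew ∧
      (st (b + 1 + i)).next.L = (st b).netL.drop (i + 1) ∧
      (st b).bD + (st b).N ≤ (st (b + 1 + i)).next.N
    refine ⟨?_, ?_, ?_, ?_, ?_, ?_, ?_⟩
    · simp [next, hne, h1]
    · simp [next, hne, h2]
    · simp [next, hne, h3]
    · simp [next, hne, h4, bQ]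
    · simp [next, hne, h5]
    · simp only [next, if_neg hne]
      rw [h6, List.tail_drop]
    · simp only [next]
      omega

theorem locate (n : ℕ) : (st n).L = [] ∨ ∃ b i, (st b).L = [] ∧ n = b + 1 + i ∧
    i < (st b).netL.length := by
  induction n with
  | zero => left; rfl
  | succ n ih =>
    rcases ih with h | ⟨b, i, hb, hn, hi⟩
    · by_cases h0 : (st n).netL.length = 0
      · left
        have := (persist n h 0 (by omega)).2.2.2.2.2.1
        rw [List.drop_zero, List.length_eq_zero_iff.mp h0] at this
        exact this
      · right; exact ⟨n, 0, h, rfl, by omega⟩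
    · by_cases h0 : i + 1 = (st b).netL.length
      · left
        have := (persist b hb (i+1) (by omega)).2.2.2.2.2.1
        rw [h0, List.drop_length] at this
        rw [hn, add_assoc, h0]; exact this
      · right; exact ⟨b, i + 1, hb, by omega, by omega⟩

theorem netL_spec (x : RSt) (h : 1 ≤ x.B) : (∀ p ∈ x.netL, p.natDegree ≤ x.N) ∧
      ∀ Y q : ℂ[X], (∀ a, ‖Y.coeff a‖ ≤ Rf x.b x.N x.M) → (∀ a, ‖q.coeff a‖ ≤ Rf x.b x.N x.M) →
        1 ≤ ‖Y.coeff 0‖ →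
        ∃ p ∈ x.netL, ∀ a ≤ x.N, ‖(p * Y).coeff a - q.coeff a‖ ≤ epsf x.b x.N x.B := by
  have h0 : 0 < epsf x.b x.N x.B := by unfold epsf; positivity
  unfold netL
  rw [dif_pos h0]
  exact Classical.choose_spec (net_lemma x.N (Rf x.b x.N x.M) (epsf x.b x.N x.B) h0)

/-- W-block facts -/
theorem wfacts (b i : ℕ) (hb : (st b).L = []) (hi : i < (st b).netL.length) :
    (st (b + 1 + i)).L ≠ [] ∧ (st (b + 1 + i)).L.headD 1 = (st b).netL[i] ∧
    (st (b + 1 + i)).L.headD 1 ∈ (st b).netL := by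
  have h := (persist b hb i hi.le).2.2.2.2.2.1
  rw [List.drop_eq_getElem_cons hi] at h
  rw [h]
  exact ⟨List.cons_ne_nil _ _, rfl, List.getElem_mem hi⟩

open Classical in
noncomputable def data : RData where
  N b := (st b).N
  D b := (st b).bD
  ν b := if (st b).L = [] then (st b).N else (st b).νs
  s b := if (st b).L = [] then 0 else (st b).c
  β b := if (st b).L = [] then b else (st b).β
  η b := (st b).bη
  ζ b := if (st b).L = [] then gam b else (st b).ζW
  Q b := (st b).bQ
  B b := (st b).B
  M b := (st b).M
  p b := (st b).L.headD 1
  N0 := rfl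
  Nsucc b := rfl
  hND b := (bD_spec _ (inv_st b)).1
  hν b := by
    rcases locate b with h | ⟨b0, i, h0, rfl, hi⟩
    · simp [h]
    · have h1 := persist b0 h0 i hi.le
      rw [if_neg (wfacts b0 i h0 hi).1]
      omega
  hsν b := by
    rcases locate b with h | ⟨b0, i, h0, rfl, hi⟩
    · simp [h]
    · have h1 := persist b0 h0 i hi.le
      rw [if_neg (wfacts b0 i h0 hi).1, if_neg (wfacts b0 i h0 hi).1]
      omega
  hp b := by
    rcases locate b with h | ⟨b0, i, h0, rfl, hi⟩
    · simp [h]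
    · have h1 := persist b0 h0 i hi.le
      obtain ⟨w1, w2, w3⟩ := wfacts b0 i h0 hi
      rw [if_neg w1, h1.2.1]
      exact (netL_spec _ (inv_st b0).1).1 _ w3
  hp1 b := by
    rcases locate b with h | ⟨b0, i, h0, rfl, hi⟩
    · rw [h]
      have := norm1_X_pow 0
      rw [pow_zero] at this
      exact this.trans (bQ_ge _ (inv_st b))
    · have h1 := persist b0 h0 i hi.le
      obtain ⟨w1, w2, w3⟩ := wfacts b0 i h0 hi
      rw [bQ, if_neg w1, h1.2.2.2.1]
      exact (Qnew_facts _ (inv_st b0).2.1).2.2.2.2.2 _ w3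
  hζ1 b := by
    rcases locate b with h | ⟨b0, i, h0, rfl, hi⟩
    · rw [if_pos h]; exact gam_ge_one b
    · have h1 := persist b0 h0 i hi.le
      obtain ⟨w1, w2, w3⟩ := wfacts b0 i h0 hi
      rw [if_neg w1, h1.2.2.2.2.1]
      exact zW_ge _ (inv_st b0).2.1
  hζQ b := by
    rcases locate b with h | ⟨b0, i, h0, rfl, hi⟩
    · rw [if_pos h, bQ, if_pos h]
      have := (Qnew_facts _ (inv_st b).2.1).2.2.1
      rwa [st_b] at this
    · have h1 := persist b0 h0 i hi.le
      obtain ⟨w1, w2, w3⟩ := wfacts b0 i h0 hi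
      rw [if_neg w1, h1.2.2.2.2.1, bQ, if_neg w1, h1.2.2.2.1]
      exact (Qnew_facts _ (inv_st b0).2.1).2.2.2.1
  h2Q b := by
    rcases locate b with h | ⟨b0, i, h0, rfl, hi⟩
    · rw [bQ, if_pos h]
      have := (Qnew_facts _ (inv_st b).2.1).2.1
      rw [st_b] at this
      exact (pow_le_pow_right₀ (by norm_num) (by omega)).trans this
    · have h1 := persist b0 h0 i hi.le
      obtain ⟨w1, w2, w3⟩ := wfacts b0 i h0 hi
      rw [bQ, if_neg w1, h1.2.2.2.1]
      have := (Qnew_facts _ (inv_st b0).2.1).2.1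
      rw [st_b] at this
      exact (pow_le_pow_right₀ (by norm_num) (by omega)).trans this
  hη b := bη_pos _ (inv_st b)
  hη5 b := by
    have h1 := bQ_ge _ (inv_st b)
    have h2 := (inv_st b).2.1
    rw [bη, st_b]
    apply le_of_eq
    field_simp
  hG b := by
    have := (bD_spec _ (inv_st b)).2
    rwa [st_b] at this
  B0 := (inv_st 0).1
  Bsucc b := rfl
  M0 := (inv_st 0).2.1
  Msucc b := rfl
  hβ b := by
    rcases locate b with h | ⟨b0, i, h0, rfl, hi⟩
    · rw [if_pos h]
    · have h1 := persist b0 h0 i hi.le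
      obtain ⟨w1, w2, w3⟩ := wfacts b0 i h0 hi
      rw [if_neg w1, h1.1]
      omega
  hS b hb := by
    rcases locate b with h | ⟨b0, i, h0, rfl, hi⟩
    · simp [h]
    · have h1 := persist b0 h0 i hi.le
      obtain ⟨w1, w2, w3⟩ := wfacts b0 i h0 hi
      rw [if_neg w1, h1.1] at hb
      omega
  hW b hb := by
    rcases locate b with h | ⟨b0, i, h0, rfl, hi⟩
    · exact absurd (if_pos h) hb
    · have h1 := persist b0 h0 i hi.le
      obtain ⟨w1, w2, w3⟩ := wfacts b0 i h0 hi
      simp only [if_neg w1, h1.1, h1.2.1, h1.2.2.1, h1.2.2.2.2.1, true_and]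
      refine ⟨?_, ?_⟩
      · rw [bQ, if_neg w1, h1.2.2.2.1, bQ, if_pos h0]
      · rw [zWnew, st_b]; linarith
  hββ b j h1 h2 := by
    rcases locate b with h | ⟨b0, i, h0, rfl, hi⟩
    · rw [if_pos h] at h1 ⊢
      have : j = b := le_antisymm h2 h1
      rw [this, if_pos h]
    · have h3 := persist b0 h0 i hi.le
      obtain ⟨w1, w2, w3⟩ := wfacts b0 i h0 hi
      rw [if_neg w1, h3.1] at h1 ⊢
      by_cases hj : j = b0
      · rw [hj, if_pos h0]
      · obtain ⟨i', rfl⟩ : ∃ i', j = b0 + 1 + i' := ⟨j - (b0 + 1), by omega⟩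
        have h4 := persist b0 h0 i' (by omega)
        obtain ⟨w1, w2, w3⟩ := wfacts b0 i' h0 (by omega)
        rw [if_neg w1, h4.1]
  hRQ b hb := by
    rcases locate b with h | ⟨b0, i, h0, rfl, hi⟩
    · rw [bQ, if_pos h]
      have := (Qnew_facts _ (inv_st b).2.1).2.2.2.2.1
      rwa [st_b] at this
    · have h1 := persist b0 h0 i hi.le
      obtain ⟨w1, w2, w3⟩ := wfacts b0 i h0 hi
      rw [if_neg w1, h1.1] at hb
      omega
  hnet b hb Y q hY hq hY0 := by
    rcases locate b with h | ⟨b0, i, h0, rfl, hi⟩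
    · have := (netL_spec _ (inv_st b).1).2 Y q
      rw [st_b] at this
      obtain ⟨p, hp, hpa⟩ := this hY hq hY0
      obtain ⟨i, hi, rfl⟩ := List.getElem_of_mem hp
      have h1 := persist b h i hi.le
      obtain ⟨w1, w2, w3⟩ := wfacts b i h hi
      refine ⟨b + 1 + i, by omega, ?_, ?_⟩
      · rw [if_neg w1, h1.1]
      · rw [w2]; exact hpa
    · have h1 := persist b0 h0 i hi.le
      obtain ⟨w1, w2, w3⟩ := wfacts b0 i h0 hi
      rw [if_neg w1, h1.1] at hb
      omega
  hinf := by
    rw [Set.infinite_iff_exists_gt]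
    intro n
    have key : ∃ b, (st b).L = [] ∧ n < b := by
      have aux : ∀ b, (st b).L = [] → (st (b + 1 + (st b).netL.length)).L = [] := by
        intro b hb
        have := (persist b hb _ le_rfl).2.2.2.2.2.1
        rwa [List.drop_length] at this
      rcases locate n with h | ⟨b0, i, h0, rfl, hi⟩
      · exact ⟨_, aux n h, by omega⟩
      · exact ⟨_, aux b0 h0, by omega⟩
    obtain ⟨b, hb, hn⟩ := key
    exact ⟨b, if_pos hb, hn⟩

end RSt
end SecP3

section SecP4
open Polynomial Filter Topology
set_option linter.unusedSectionVars false

namespace RData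
variable (d : RData)

theorem N_lt_D (b : ℕ) : d.N b < d.D b := by have := d.hND b; omega
theorem N_lt_succ (b : ℕ) : d.N b < d.N (b + 1) := by
  have := d.N_lt_D b; have := d.Nsucc b; omega
theorem N_strictMono : StrictMono d.N := strictMono_nat_of_lt_succ d.N_lt_succ
theorem N_ge (b : ℕ) : b + 1 ≤ d.N b := by
  induction b with
  | zero => rw [d.N0]
  | succ b ih => have := d.N_lt_succ b; omega
theorem D_strictMono : StrictMono d.D := strictMono_nat_of_lt_succ fun b => by
  have := d.N_lt_D (b+1); have := d.Nsucc b; omega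
theorem b_lt_D (b : ℕ) : b < d.D b := by have := d.N_lt_D b; have := d.N_ge b; omega
theorem Q_ge (b : ℕ) : 1 ≤ d.Q b := (d.hζ1 b).trans (d.hζQ b)
theorem ν_eq (b : ℕ) : d.ν b = d.N (d.β b) := by
  by_cases h : d.β b = b
  · rw [h]; exact (d.hS b h).1
  · exact (d.hW b h).1
theorem ν_ge (b : ℕ) : 1 ≤ d.ν b := by rw [d.ν_eq]; have := d.N_ge (d.β b); omega

noncomputable def rho (b : ℕ) : ℝ := 1 + 1 / ((d.N b : ℝ) + 1)
noncomputable def gg (b j : ℕ) : ℝ := d.η b * d.rho b ^ (j - d.N b)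

theorem rho_ge (b : ℕ) : 1 ≤ d.rho b := by
  unfold rho
  have : (0:ℝ) ≤ 1 / ((d.N b : ℝ) + 1) := by positivity
  linarith

theorem rho_pow (b m : ℕ) (hm : m ≤ d.N b + 1) : d.rho b ^ m ≤ 3 := by
  refine (pow_le_pow_right₀ (d.rho_ge b) hm).trans ?_
  have h1 : d.rho b ≤ Real.exp (1 / ((d.N b : ℝ) + 1)) := by
    have := Real.add_one_le_exp (1 / ((d.N b : ℝ) + 1))
    unfold rho; linarith
  have h0 := d.rho_ge b
  refine (pow_le_pow_left₀ (by linarith) h1 _).trans ?_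
  rw [← Real.exp_nat_mul]
  have : ((d.N b + 1 : ℕ) : ℝ) * (1 / ((d.N b : ℝ) + 1)) = 1 := by
    push_cast; field_simp
  rw [this]
  have := Real.exp_one_lt_d9
  linarith

theorem gg_pos (b j : ℕ) : 0 < d.gg b j := by
  have := d.hη b; have := d.rho_ge b; unfold gg; positivity

theorem η_le_gg (b j : ℕ) : d.η b ≤ d.gg b j := by
  have := d.hη b
  have := one_le_pow₀ (d.rho_ge b) (n := j - d.N b)
  unfold gg; nlinarith

theorem gg_mono (b i j : ℕ) (h : i ≤ j) : d.gg b i ≤ d.gg b j := by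
  unfold gg
  exact mul_le_mul_of_nonneg_left (pow_le_pow_right₀ (d.rho_ge b) (by omega)) (d.hη b).le

theorem gg_add (b j m : ℕ) (h : d.N b ≤ j) : d.gg b (j + m) = d.gg b j * d.rho b ^ m := by
  unfold gg
  rw [show j + m - d.N b = (j - d.N b) + m by omega, pow_add, mul_assoc]

theorem gg_small (b j : ℕ) (h : j ≤ 3 * d.N b) : d.gg b j ≤ 9 * d.η b := by
  unfold gg
  have h1 := d.rho_pow b (d.N b) (by omega)
  have h0 := d.rho_ge b
  have h2 : d.rho b ^ (j - d.N b) ≤ d.rho b ^ (d.N b + d.N b) :=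
    pow_le_pow_right₀ h0 (by omega)
  rw [pow_add] at h2
  have h3 : 0 ≤ d.rho b ^ d.N b := by positivity
  have h4 : d.rho b ^ (j - d.N b) ≤ 9 := by nlinarith
  have := d.hη b
  nlinarith

theorem B_le_succ (b : ℕ) (h : 0 ≤ d.B b) : d.B b ≤ d.B (b+1) := by
  rw [d.Bsucc]
  have := d.gg_pos b (d.D b)
  unfold gg rho at this
  have h2 := d.Q_ge b
  have : 0 ≤ d.Q b * (d.B b + 1) := by positivity
  linarith

theorem B_ge (b : ℕ) : 1 ≤ d.B b := by
  induction b with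
  | zero => exact d.B0
  | succ b ih => exact ih.trans (d.B_le_succ b (by linarith))

theorem M_le_succ (b : ℕ) : d.M b ≤ d.M (b+1) := by
  rw [d.Msucc]
  have := d.hη b
  have h2 := d.Q_ge b
  have : 0 ≤ d.Q b * (1 + d.Q b) := by positivity
  have : 0 ≤ 1 / d.η b := by positivity
  linarith

theorem M_ge (b : ℕ) : 1 ≤ d.M b := by
  induction b with
  | zero => exact d.M0
  | succ b ih => exact ih.trans (d.M_le_succ b)

/-- the smallness estimate -/
theorem small5 (b : ℕ) (x : ℝ) (hx : x ≤ (d.N b + 1) * (d.M b + 1) * d.Q b ^ 3) :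
    x * (9 * d.η b) ≤ (1/2) ^ b := by
  have h := d.hη5 b
  have hη := d.hη b
  have h2 : (0:ℝ) < 2 ^ b := by positivity
  rw [one_div, inv_pow, ← one_div, le_div_iff₀ h2]
  have : x * (9 * d.η b) * 2 ^ b ≤ ((d.N b + 1) * (d.M b + 1) * d.Q b ^ 3) * (9 * d.η b) * 2 ^ b := by
    gcongr
  linarith

theorem one_le_big (b : ℕ) : 1 ≤ (d.N b + 1) * (d.M b + 1) * d.Q b ^ 3 := by
  have h1 := d.M_ge b
  have h2 : 1 ≤ d.Q b ^ 3 := one_le_pow₀ (d.Q_ge b)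
  have h3 : (0:ℝ) ≤ d.N b := by positivity
  have : 1 ≤ ((d.N b:ℝ) + 1) * (d.M b + 1) := by nlinarith
  nlinarith

theorem η9 (b : ℕ) : 9 * d.η b ≤ 1 := by
  have := d.small5 b 1 (d.one_le_big b)
  rw [one_mul] at this
  exact this.trans (pow_le_one₀ (by norm_num) (by norm_num))

noncomputable def blk (j : ℕ) : ℕ := Nat.findGreatest (fun b => d.N b < j) j

theorem blk_eq (b j : ℕ) (h1 : d.N b < j) (h2 : j ≤ d.N (b+1)) : d.blk j = b := by
  have h0 : b ≤ j := by have := d.N_ge b; omega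
  apply le_antisymm
  · by_contra h
    push Not at h
    have h3 : d.N (d.blk j) < j := Nat.findGreatest_spec (P := fun b => d.N b < j) h0 h1
    have := d.N_strictMono.monotone (show b + 1 ≤ d.blk j by omega)
    omega
  · exact Nat.le_findGreatest h0 h1

theorem exists_blk (j : ℕ) (hj : 2 ≤ j) : ∃ b, d.N b < j ∧ j ≤ d.N (b+1) := by
  have h1 : d.N (d.blk j) < j :=
    Nat.findGreatest_spec (P := fun b => d.N b < j) (m := 0) (by omega) (by rw [d.N0]; omega)
  refine ⟨d.blk j, h1, ?_⟩
  by_contra h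
  push Not at h
  have h2 : d.blk j + 1 ≤ j := by have := d.N_ge (d.blk j + 1); omega
  have : d.blk j + 1 ≤ d.blk j := Nat.le_findGreatest h2 h
  omega

/-- every index at least 2 is a gap or fan index -/
theorem cases_idx (j : ℕ) (hj : 2 ≤ j) : (∃ b, d.N b < j ∧ j < d.D b) ∨
    ∃ b i, i ≤ d.ν b ∧ j = d.D b + i := by
  obtain ⟨b, h1, h2⟩ := d.exists_blk j hj
  have := d.Nsucc b
  by_cases h : j < d.D b
  · left; exact ⟨b, h1, h⟩
  · right; exact ⟨b, j - d.D b, by omega, by omega⟩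

noncomputable def E (j : ℕ) : ℂ[X] :=
  if j ≤ 1 then X ^ j else
    if j < d.D (d.blk j) then ((d.gg (d.blk j) j : ℂ)⁻¹) • X ^ j
    else (d.ζ (d.blk j) : ℂ) • (X ^ j -
      d.p (d.blk j) * X ^ (d.s (d.blk j) + (j - d.D (d.blk j))))

theorem E_low (j : ℕ) (h : j ≤ 1) : d.E j = X ^ j := by rw [E, if_pos h]

theorem blk_gap (b j : ℕ) (h1 : d.N b < j) (h2 : j < d.D b) : d.blk j = b :=
  d.blk_eq b j h1 (by rw [d.Nsucc]; omega)

theorem blk_fan (b i : ℕ) (h : i ≤ d.ν b) : d.blk (d.D b + i) = b :=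
  d.blk_eq b _ (by have := d.N_lt_D b; omega) (by rw [d.Nsucc]; omega)

theorem E_gap (b j : ℕ) (h1 : d.N b < j) (h2 : j < d.D b) :
    d.E j = ((d.gg b j : ℂ)⁻¹) • X ^ j := by
  have := d.N_ge b
  rw [E, if_neg (by omega), d.blk_gap b j h1 h2, if_pos h2]

theorem E_fan (b i : ℕ) (h : i ≤ d.ν b) :
    d.E (d.D b + i) = (d.ζ b : ℂ) • (X ^ (d.D b + i) - d.p b * X ^ (d.s b + i)) := by
  have := d.N_ge b
  have := d.hND b
  rw [E, if_neg (by omega), d.blk_fan b i h, if_neg (by omega), Nat.add_sub_cancel_left]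

theorem ζ_ne (b : ℕ) : (d.ζ b : ℂ) ≠ 0 := by
  have := d.hζ1 b
  exact_mod_cast (by linarith : d.ζ b ≠ 0)

theorem gg_ne (b j : ℕ) : (d.gg b j : ℂ) ≠ 0 := by
  exact_mod_cast (d.gg_pos b j).ne'

theorem natDegree_pX (b i : ℕ) : (d.p b * X ^ (d.s b + i)).natDegree ≤ d.ν b + d.s b + i := by
  refine natDegree_mul_le.trans ?_
  rw [natDegree_X_pow]
  have := d.hp b
  omega

theorem E_degree (j : ℕ) : (d.E j).degree = j := by
  by_cases hj : j ≤ 1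
  · rw [d.E_low j hj, degree_X_pow]
  rcases d.cases_idx j (by omega) with ⟨b, h1, h2⟩ | ⟨b, i, hi, rfl⟩
  · rw [d.E_gap b j h1 h2, degree_smul_of_isRightRegular_leadingCoeff, degree_X_pow]
    · exact inv_ne_zero (d.gg_ne b j)
    · simpa using isRegular_one
  · rw [d.E_fan b i hi, smul_eq_C_mul, degree_mul, degree_C (d.ζ_ne b), zero_add,
      degree_sub_eq_left_of_degree_lt, degree_X_pow]
    rw [degree_X_pow]
    refine lt_of_le_of_lt degree_le_natDegree ?_
    have h1 := d.natDegree_pX b i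
    have h2 := d.hsν b
    have h3 := d.N_lt_D b
    exact_mod_cast (by omega : (d.p b * X ^ (d.s b + i)).natDegree < d.D b + i)

noncomputable def Eseq : Polynomial.Sequence ℂ := ⟨d.E, d.E_degree⟩

theorem Eseq_unit (i : ℕ) : IsUnit (d.Eseq i).leadingCoeff := by
  rw [isUnit_iff_ne_zero, leadingCoeff_ne_zero]
  exact d.Eseq.ne_zero i

noncomputable def Ebasis : Module.Basis ℕ ℂ ℂ[X] := d.Eseq.basis d.Eseq_unit

theorem Ebasis_apply (j : ℕ) : d.Ebasis j = d.E j := Polynomial.Sequence.basis_eq_self _ _ j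

theorem norm1_E (b : ℕ) : ∀ j ≤ d.N b, norm1 (d.E j) ≤ d.M b := by
  induction b with
  | zero =>
    intro j hj
    rw [d.N0] at hj
    rw [d.E_low j hj]
    exact (norm1_X_pow j).trans d.M0
  | succ b ih =>
    intro j hj
    by_cases hj2 : j ≤ d.N b
    · exact (ih j hj2).trans (d.M_le_succ b)
    have hη := d.hη b
    have hQ := d.Q_ge b
    have hM := d.M_ge b
    have h1 : 0 ≤ 1 / d.η b := by positivity
    have h2 : 0 ≤ d.Q b * (1 + d.Q b) := by positivity
    rw [d.Msucc]
    by_cases h : j < d.D b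
    · rw [d.E_gap b j (by omega) h]
      refine (norm1_smul _ _).trans ?_
      rw [norm_inv, Complex.norm_real, Real.norm_of_nonneg (d.gg_pos b j).le]
      have h3 : (d.gg b j)⁻¹ ≤ 1 / d.η b := by
        rw [one_div]
        exact inv_anti₀ hη (d.η_le_gg b j)
      have h4 := norm1_X_pow j
      have : 0 ≤ (d.gg b j)⁻¹ := inv_nonneg.mpr (d.gg_pos b j).le
      nlinarith
    · obtain ⟨i, rfl⟩ : ∃ i, j = d.D b + i := ⟨j - d.D b, by omega⟩
      rw [d.Nsucc] at hj
      rw [d.E_fan b i (by omega)]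
      refine (norm1_smul _ _).trans ?_
      rw [Complex.norm_real, Real.norm_of_nonneg (by have := d.hζ1 b; linarith)]
      have h3 : norm1 (X ^ (d.D b + i) - d.p b * X ^ (d.s b + i)) ≤ 1 + d.Q b := by
        refine (norm1_sub_le _ _).trans (add_le_add (norm1_X_pow _) ?_)
        rw [mul_comm]
        exact (norm1_X_pow_mul _ _).trans (d.hp1 b)
      have : d.ζ b * norm1 (X ^ (d.D b + i) - d.p b * X ^ (d.s b + i)) ≤ d.Q b * (1 + d.Q b) :=
        mul_le_mul (d.hζQ b) h3 (norm1_nonneg _) (by linarith)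
      linarith

end RData
end SecP4

section SecP4b
open Polynomial Filter Topology
set_option linter.unusedSectionVars false

namespace RData
variable (d : RData)
variable {H : Type} [NormedAddCommGroup H] [InnerProductSpace ℂ H] [CompleteSpace H]
  (e : HilbertBasis ℕ ℂ H)

noncomputable def io : ℂ[X] →ₗ[ℂ] H := d.Ebasis.constr ℂ e

theorem io_E (j : ℕ) : d.io e (d.E j) = e j := by
  rw [← d.Ebasis_apply, io, Module.Basis.constr_basis]

theorem e_norm (j : ℕ) : ‖e j‖ = 1 := e.orthonormal.1 j

theorem io_sum (P : ℂ[X]) : d.io e P = ∑ a ∈ P.support, P.coeff a • d.io e (X ^ a) := by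
  conv_lhs => rw [P.as_sum_support_C_mul_X_pow]
  rw [map_sum]
  exact Finset.sum_congr rfl fun a _ => by rw [← smul_eq_C_mul, map_smul]

theorem io_norm_le (P : ℂ[X]) (K : ℝ) (h : ∀ a, P.coeff a ≠ 0 → ‖d.io e (X ^ a)‖ ≤ K) :
    ‖d.io e P‖ ≤ norm1 P * K := by
  rw [d.io_sum e P, norm1, Finset.sum_mul]
  refine (norm_sum_le _ _).trans (Finset.sum_le_sum fun a ha => ?_)
  rw [norm_smul]
  exact mul_le_mul_of_nonneg_left (h a (mem_support_iff.mp ha)) (norm_nonneg _)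

theorem f_gap (b j : ℕ) (h1 : d.N b < j) (h2 : j < d.D b) :
    d.io e (X ^ j) = (d.gg b j : ℂ) • e j := by
  rw [← d.io_E e j, d.E_gap b j h1 h2, map_smul, smul_inv_smul₀ (d.gg_ne b j)]

theorem f_gap_norm (b j : ℕ) (h1 : d.N b < j) (h2 : j < d.D b) :
    ‖d.io e (X ^ j)‖ = d.gg b j := by
  rw [d.f_gap e b j h1 h2, norm_smul, e_norm, mul_one, Complex.norm_real,
    Real.norm_of_nonneg (d.gg_pos b j).le]

theorem f_fan (b i : ℕ) (h : i ≤ d.ν b) :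
    d.io e (X ^ (d.D b + i)) =
      ((d.ζ b : ℂ)⁻¹) • e (d.D b + i) + d.io e (d.p b * X ^ (d.s b + i)) := by
  rw [← d.io_E e (d.D b + i), d.E_fan b i h, map_smul, inv_smul_smul₀ (d.ζ_ne b), map_sub]
  abel

theorem f_small (b a : ℕ) (h1 : d.N b < a) (h2 : a ≤ 3 * d.N b) :
    ‖d.io e (X ^ a)‖ ≤ 9 * d.η b := by
  have := d.hND b
  rw [d.f_gap_norm e b a h1 (by omega)]
  exact d.gg_small b a h2

/-- shifted polynomials in a small region -/
theorem io_small (b : ℕ) (P : ℂ[X]) (h : ∀ a, P.coeff a ≠ 0 → d.N b < a ∧ a ≤ 3 * d.N b) :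
    ‖d.io e P‖ ≤ norm1 P * (9 * d.η b) :=
  d.io_norm_le e P _ fun a ha => d.f_small e b a (h a ha).1 (h a ha).2

theorem coeff_pX (b n a : ℕ) (h : (d.p b * X ^ n).coeff a ≠ 0) : n ≤ a ∧ a ≤ n + d.ν b := by
  rw [coeff_mul_X_pow'] at h
  split_ifs at h with hn
  · refine ⟨hn, ?_⟩
    have := le_natDegree_of_ne_zero h
    have := d.hp b
    omega
  · exact absurd rfl h

theorem norm1_pX (b n : ℕ) : norm1 (d.p b * X ^ n) ≤ d.Q b := by
  rw [mul_comm]; exact (norm1_X_pow_mul _ _).trans (d.hp1 b)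

theorem f_fan_le (b i : ℕ) (h : i ≤ d.ν b) (hB : ∀ a ≤ d.N b, ‖d.io e (X ^ a)‖ ≤ d.B b) :
    ‖d.io e (X ^ (d.D b + i))‖ ≤ 1 + d.Q b * (d.B b + 1) := by
  rw [d.f_fan e b i h]
  have hBg := d.B_ge b
  refine (norm_add_le _ _).trans (add_le_add ?_ ?_)
  · rw [norm_smul, e_norm, mul_one, norm_inv, Complex.norm_real,
      Real.norm_of_nonneg (by have := d.hζ1 b; linarith)]
    exact inv_le_one_of_one_le₀ (d.hζ1 b)
  · refine (d.io_norm_le e _ (d.B b + 1) ?_).trans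
      (mul_le_mul_of_nonneg_right (d.norm1_pX b _) (by linarith))
    intro a ha
    obtain ⟨h1, h2⟩ := d.coeff_pX b _ a ha
    have h3 := d.hsν b
    have h4 := d.hν b
    by_cases haN : a ≤ d.N b
    · have := hB a haN; linarith
    · have := d.f_small e b a (by omega) (by omega)
      have := d.η9 b
      linarith

theorem f_le_B (b : ℕ) : ∀ a ≤ d.N b, ‖d.io e (X ^ a)‖ ≤ d.B b := by
  induction b with
  | zero =>
    intro a ha
    rw [d.N0] at ha
    rw [← d.E_low a ha, d.io_E, e_norm]; exact d.B0
  | succ b ih =>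
    intro a ha
    have hB := d.B_ge b
    have hQ := d.Q_ge b
    by_cases h : a ≤ d.N b
    · exact (ih a h).trans (d.B_le_succ b (by linarith))
    have hb : d.B (b+1) = d.B b + d.gg b (d.D b) + 1 + d.Q b * (d.B b + 1) := d.Bsucc b
    have hG := d.gg_pos b (d.D b)
    have h0 : 0 ≤ d.Q b * (d.B b + 1) := by positivity
    rw [hb]
    by_cases h2 : a < d.D b
    · rw [d.f_gap_norm e b a (by omega) h2]
      have := d.gg_mono b a (d.D b) h2.le
      linarith
    · obtain ⟨i, rfl⟩ : ∃ i, a = d.D b + i := ⟨a - d.D b, by omega⟩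
      rw [d.Nsucc] at ha
      have := d.f_fan_le e b i (by omega) ih
      linarith

/-- remainder bounds -/
noncomputable def tt (j : ℕ) : ℝ :=
  if j ≤ 1 then 0 else
    if j < d.D (d.blk j) then
      (if d.D (d.blk j) - d.N (d.blk j) ≤ j then (1/2) ^ (d.blk j) / (d.N (d.blk j) + 1) else 0)
    else 2 * (1/2) ^ (d.blk j) / (d.ν (d.blk j) + 1)

theorem tt_nonneg (j : ℕ) : 0 ≤ d.tt j := by
  unfold tt; split_ifs <;> positivity

theorem tt_gap (b j : ℕ) (h1 : d.N b < j) (h2 : j < d.D b) :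
    d.tt j = if d.D b - d.N b ≤ j then (1/2 : ℝ) ^ b / ((d.N b : ℝ) + 1) else (0 : ℝ) := by
  have := d.N_ge b
  rw [tt, if_neg (by omega), d.blk_gap b j h1 h2, if_pos h2]

theorem tt_fan (b i : ℕ) (h : i ≤ d.ν b) : d.tt (d.D b + i) = 2 * (1/2) ^ b / (d.ν b + 1) := by
  have := d.N_ge b
  have := d.hND b
  rw [tt, if_neg (by omega), d.blk_fan b i h, if_neg (by omega)]

theorem tt_block (b : ℕ) : ∑ j ∈ Finset.Ico (d.N b + 1) (d.N (b+1) + 1), d.tt j ≤ 3 * (1/2) ^ b := by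
  have hND := d.hND b
  have hs := d.Nsucc b
  have hN := d.N_ge b
  rw [← Finset.sum_Ico_consecutive d.tt (m := d.N b + 1) (n := d.D b - d.N b) (by omega) (by omega),
    ← Finset.sum_Ico_consecutive d.tt (m := d.D b - d.N b) (n := d.D b) (by omega) (by omega)]
  have h1 : ∑ j ∈ Finset.Ico (d.N b + 1) (d.D b - d.N b), d.tt j = 0 := by
    refine Finset.sum_eq_zero fun j hj => ?_
    rw [Finset.mem_Ico] at hj
    rw [d.tt_gap b j (by omega) (by omega), if_neg (by omega)]
  have h2 : ∑ j ∈ Finset.Ico (d.D b - d.N b) (d.D b), d.tt j ≤ (1/2) ^ b := by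
    have : ∀ j ∈ Finset.Ico (d.D b - d.N b) (d.D b), d.tt j ≤ (1/2) ^ b / (d.N b + 1) := by
      intro j hj
      rw [Finset.mem_Ico] at hj
      rw [d.tt_gap b j (by omega) (by omega), if_pos (by omega)]
    refine (Finset.sum_le_card_nsmul _ _ _ this).trans ?_
    rw [Nat.card_Ico, show d.D b - (d.D b - d.N b) = d.N b by omega, nsmul_eq_mul,
      mul_div_assoc', div_le_iff₀ (by positivity), mul_comm]
    have : (0:ℝ) ≤ (1/2)^b := by positivity
    nlinarith
  have h3 : ∑ j ∈ Finset.Ico (d.D b) (d.N (b+1) + 1), d.tt j ≤ 2 * (1/2) ^ b := by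
    have : ∀ j ∈ Finset.Ico (d.D b) (d.N (b+1) + 1), d.tt j ≤ 2 * (1/2) ^ b / (d.ν b + 1) := by
      intro j hj
      rw [Finset.mem_Ico] at hj
      obtain ⟨i, rfl⟩ : ∃ i, j = d.D b + i := ⟨j - d.D b, by omega⟩
      rw [d.tt_fan b i (by omega)]
    refine (Finset.sum_le_card_nsmul _ _ _ this).trans ?_
    rw [Nat.card_Ico, show d.N (b+1) + 1 - d.D b = d.ν b + 1 by omega, nsmul_eq_mul]
    push_cast
    rw [mul_div_cancel₀ _ (by positivity)]
  linarith

theorem tt_sum (b : ℕ) : ∑ j ∈ Finset.range (d.N b + 1), d.tt j ≤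
    ∑ b' ∈ Finset.range b, 3 * (1/2:ℝ) ^ b' := by
  induction b with
  | zero => rw [d.N0]; simp [Finset.sum_range_succ, tt]
  | succ b ih =>
    rw [Finset.sum_range_succ _ b, ← Finset.sum_range_add_sum_Ico d.tt
      (by have := d.N_lt_succ b; omega : d.N b + 1 ≤ d.N (b+1) + 1)]
    have := d.tt_block b
    linarith

theorem tt_range (n : ℕ) : ∑ j ∈ Finset.range n, d.tt j ≤ 6 := by
  have h1 : ∑ j ∈ Finset.range n, d.tt j ≤ ∑ j ∈ Finset.range (d.N n + 1), d.tt j := by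
    refine Finset.sum_le_sum_of_subset_of_nonneg ?_ fun j _ _ => d.tt_nonneg j
    have := d.N_ge n
    exact Finset.range_mono (by omega)
  refine (h1.trans (d.tt_sum n)).trans ?_
  rw [← Finset.mul_sum]
  have := (summable_geometric_two).sum_le_tsum (Finset.range n) (fun _ _ => by positivity)
  rw [tsum_geometric_two] at this
  linarith

theorem tt_summable : Summable d.tt := summable_of_sum_range_le d.tt_nonneg d.tt_range
theorem tt_tsum : ∑' j, d.tt j ≤ 6 := Real.tsum_le_of_sum_range_le d.tt_nonneg d.tt_range

end RData
end SecP4b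

section SecP4c
open Polynomial Filter Topology
set_option linter.unusedSectionVars false

namespace RData
variable (d : RData)
variable {H : Type} [NormedAddCommGroup H] [InnerProductSpace ℂ H] [CompleteSpace H]
  (e : HilbertBasis ℕ ℂ H)

theorem N_mono {a b : ℕ} (h : a ≤ b) : d.N a ≤ d.N b := d.N_strictMono.monotone h
theorem D_mono {a b : ℕ} (h : a ≤ b) : d.D a ≤ d.D b := d.D_strictMono.monotone h

theorem Q_stage (b i : ℕ) (h1 : d.β b ≤ i) (h2 : i ≤ b) : d.Q i = d.Q b := by
  have hb : d.Q b = d.Q (d.β b) := by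
    by_cases h : d.β b = b
    · rw [h]
    · exact (d.hW b h).2.2.1
  have hi : d.Q i = d.Q (d.β i) := by
    by_cases h : d.β i = i
    · rw [h]
    · exact (d.hW i h).2.2.1
  rw [hb, hi, d.hββ b i h1 h2]

/-- condition on the exponent m at level b0 -/
def TailCond (b0 m : ℕ) : Prop := m ≤ d.N b0 ∧ ∀ b, b0 ≤ b →
  m ≤ d.ν b ∨ (d.β b ≠ b ∧ ∃ k, k + 1 = b0 ∧ m = d.D k ∧ d.β k = d.β b)

theorem div_bound (x ν : ℝ) (b : ℕ) (hν : 0 ≤ ν) (h : x * (ν + 1) ≤ (1/2)^b) :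
    x ≤ (1/2)^b / (ν + 1) := by
  rwa [le_div_iff₀ (by positivity)]

/-- first term of fan end -/
theorem fan_end1 (b i m : ℕ) (hm : m ≤ d.N b) (hi : i ≤ d.ν b) (him : d.ν b < i + m) :
    ‖(d.ζ b : ℂ) • d.io e (X ^ (d.D b + i + m))‖ ≤ (1/2) ^ b / (d.ν b + 1) := by
  have hs := d.Nsucc b
  have hD := d.hND b
  have h1 := d.f_small e (b+1) (d.D b + i + m) (by omega) (by omega)
  rw [norm_smul, Complex.norm_real, Real.norm_of_nonneg (by have := d.hζ1 b; linarith)]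
  apply div_bound _ _ _ (by positivity)
  have hζ : d.ζ b ≤ d.M (b+1) + 1 := by
    rw [d.Msucc]
    have a1 := d.hζQ b
    have a2 := d.Q_ge b
    have a3 := d.M_ge b
    have a4 : 0 ≤ 1 / d.η b := by have := d.hη b; positivity
    nlinarith
  have hν : (d.ν b : ℝ) + 1 ≤ d.N (b+1) + 1 := by
    have : d.ν b ≤ d.N (b+1) := by omega
    have : (d.ν b : ℝ) ≤ d.N (b+1) := by exact_mod_cast this
    linarith
  have h2 : (d.ν b + 1) * d.ζ b ≤ (d.N (b+1) + 1) * (d.M (b+1) + 1) * d.Q (b+1) ^ 3 := by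
    have a1 : ((d.ν b:ℝ) + 1) * d.ζ b ≤ (d.N (b+1) + 1) * (d.M (b+1) + 1) :=
      mul_le_mul hν hζ (by have := d.hζ1 b; linarith) (by positivity)
    have a2 : 1 ≤ d.Q (b+1) ^ 3 := one_le_pow₀ (d.Q_ge _)
    have a3 : 0 ≤ ((d.N (b+1):ℝ) + 1) * (d.M (b+1) + 1) := by
      have := d.M_ge (b+1); positivity
    nlinarith
  have h3 := d.small5 (b+1) _ h2
  have h4 : (1/2:ℝ)^(b+1) ≤ (1/2)^b := pow_le_pow_of_le_one (by norm_num) (by norm_num) (by omega)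
  have h5 : d.ζ b * ‖d.io e (X ^ (d.D b + i + m))‖ * (d.ν b + 1) ≤
      (d.ν b + 1) * d.ζ b * (9 * d.η (b+1)) := by
    have := d.hζ1 b
    calc _ = (d.ν b + 1) * d.ζ b * ‖d.io e (X ^ (d.D b + i + m))‖ := by ring
      _ ≤ _ := by gcongr
  linarith

/-- auxiliary: polynomial piece in small region of an earlier block of the stage -/
theorem fan_end2_aux (b b1 n : ℕ) (h1 : d.β b ≤ b1) (h2 : b1 ≤ b)
    (hlo : d.N b1 < n) (hhi : n + d.ν b ≤ 3 * d.N b1) :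
    ‖(d.ζ b : ℂ) • d.io e (d.p b * X ^ n)‖ ≤ (1/2) ^ b / (d.ν b + 1) := by
  have hP := d.io_small e b1 (d.p b * X ^ n) (fun a ha => by
    have := d.coeff_pX b n a ha; omega)
  have hQ := d.Q_stage b b1 h1 h2
  have hn := d.norm1_pX b n
  have hη := d.hη b1
  have hQ1 := d.Q_ge b
  have hζQ := d.hζQ b
  have hζ1 := d.hζ1 b
  rw [norm_smul, Complex.norm_real, Real.norm_of_nonneg (by linarith)]
  apply div_bound _ _ _ (by positivity)
  have hν : (d.ν b : ℝ) + 1 ≤ d.N b1 + 1 := by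
    have : d.ν b ≤ d.N b1 := by rw [d.ν_eq]; exact d.N_mono h1
    have : (d.ν b : ℝ) ≤ d.N b1 := by exact_mod_cast this
    linarith
  have h3 : (d.ν b + 1) * d.Q b ^ 2 * 2 ^ b ≤ (d.N b1 + 1) * (d.M b1 + 1) * d.Q b1 ^ 3 := by
    rw [hQ]
    have hM := d.M_ge b1
    calc ((d.ν b : ℝ) + 1) * d.Q b ^ 2 * 2 ^ b ≤ ((d.N b1 + 1) * (d.M b1 + 1)) * d.Q b ^ 2 * d.Q b := by
          have := d.h2Q b
          have hnn : (0:ℝ) ≤ d.N b1 := by positivity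
          gcongr
          nlinarith
      _ = _ := by ring
  have h4 := d.small5 b1 _ h3
  have h5 : (1/2:ℝ)^b1 ≤ 1 := pow_le_one₀ (by norm_num) (by norm_num)
  have h6 : (d.ν b + 1) * d.Q b ^ 2 * (9 * d.η b1) ≤ (1/2)^b := by
    rw [one_div, inv_pow, ← one_div, le_div_iff₀ (by positivity)]
    linarith
  refine le_trans ?_ h6
  calc d.ζ b * ‖d.io e (d.p b * X ^ n)‖ * (d.ν b + 1)
      ≤ d.Q b * (d.Q b * (9 * d.η b1)) * (d.ν b + 1) := by
        gcongr
        exact hP.trans (by gcongr)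
    _ = _ := by ring

theorem fan_end2_S (b n : ℕ) (h : d.β b = b) (hlo : d.N b < n) (hhi : n ≤ 2 * d.N b) :
    ‖(d.ζ b : ℂ) • d.io e (d.p b * X ^ n)‖ ≤ (1/2) ^ b / (d.ν b + 1) := by
  have := d.hν b
  exact d.fan_end2_aux e b b n h.le le_rfl hlo (by omega)

theorem tail_fan_end (b0 m : ℕ) (hc : d.TailCond b0 m) (b i : ℕ) (hb : b0 ≤ b) (hi : i ≤ d.ν b)
    (him : d.ν b < i + m) :
    ‖(d.ζ b : ℂ) • d.io e (d.p b * X ^ (d.s b + i + m))‖ ≤ (1/2) ^ b / (d.ν b + 1) := by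
  have hβ := d.hβ b
  rcases hc.2 b hb with hmν | ⟨hW, k, hk, rfl, hkβ⟩
  · by_cases h : d.β b = b
    · obtain ⟨s1, s2, s3, s4⟩ := d.hS b h
      apply d.fan_end2_S e b _ h <;> omega
    · obtain ⟨w1, w2, -, -⟩ := d.hW b h
      have := d.Nsucc (d.β b)
      have h2 := (d.hS (d.β b) (d.hββ b (d.β b) le_rfl hβ)).1
      apply d.fan_end2_aux e b (d.β b + 1) _ (by omega) (by omega) <;> omega
  · obtain ⟨w1, w2, -, -⟩ := d.hW b hW
    have h1 := d.Nsucc k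
    have h2 := d.ν_eq k
    have h3 := d.D_mono (d.hβ k)
    have h4 := d.N_lt_D (d.β k)
    have h5 := d.hβ k
    rw [hkβ] at h2 h3 h4 h5
    apply d.fan_end2_aux e b (k + 1) _ (by omega) (by omega) <;> omega

theorem tail_cross (b0 m : ℕ) (hc : d.TailCond b0 m) (b j : ℕ) (hb : b0 ≤ b) (h1 : d.N b < j)
    (h2 : j < d.D b) (h3 : d.D b ≤ j + m) :
    ‖((d.gg b j : ℂ)⁻¹) • d.io e (X ^ (j + m))‖ ≤ (1/2) ^ b / (d.N b + 1) := by
  have hm : m ≤ d.N b := hc.1.trans (d.N_mono hb)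
  have hB := d.B_ge b
  have hQ := d.Q_ge b
  have hf : ‖d.io e (X ^ (j + m))‖ ≤ 2 + d.Q b * (d.B b + 1) := by
    obtain ⟨i, hi⟩ : ∃ i, j + m = d.D b + i := ⟨j + m - d.D b, by omega⟩
    rw [hi]
    by_cases h : i ≤ d.ν b
    · have := d.f_fan_le e b i h (d.f_le_B e b); linarith
    · have hs := d.Nsucc b
      have hD := d.hND b
      have := d.f_small e (b+1) (d.D b + i) (by omega) (by omega)
      have := d.η9 (b+1)
      have : 0 ≤ d.Q b * (d.B b + 1) := by positivity
      linarith
  have hg : (d.N b + 1) * 2 ^ b * (2 + d.Q b * (d.B b + 1)) ≤ d.gg b j := by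
    have hG : 3 * (d.N b + 1) * 2 ^ b * (2 + d.Q b * (d.B b + 1)) ≤ d.gg b (d.D b) := d.hG b
    have h4 := d.gg_add b j (d.D b - j) h1.le
    rw [show j + (d.D b - j) = d.D b by omega] at h4
    have h5 := d.rho_pow b (d.D b - j) (by omega)
    have h6 := d.gg_pos b j
    nlinarith
  have hgp := d.gg_pos b j
  rw [norm_smul, norm_inv, Complex.norm_real, Real.norm_of_nonneg hgp.le, inv_mul_eq_div,
    div_le_iff₀ hgp]
  refine hf.trans ?_
  have : (1/2:ℝ)^b / (d.N b + 1) * ((d.N b + 1) * 2 ^ b * (2 + d.Q b * (d.B b + 1))) =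
      2 + d.Q b * (d.B b + 1) := by
    rw [one_div, inv_pow]; field_simp
  rw [← this]
  gcongr

theorem tail (b0 m : ℕ) (hc : d.TailCond b0 m) (j : ℕ) (hj : d.N b0 < j) :
    ∃ (a : ℂ) (r : H), d.io e (X ^ m * d.E j) = a • e (j + m) + r ∧ ‖a‖ ≤ 3 ∧ ‖r‖ ≤ d.tt j := by
  have hN0 := d.N_ge b0
  rcases d.cases_idx j (by omega) with ⟨b, h1, h2⟩ | ⟨b, i, hi, rfl⟩
  · have hb : b0 ≤ b := by
      by_contra h
      have := d.N_mono (show b + 1 ≤ b0 by omega)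
      have := d.Nsucc b
      omega
    have hm : m ≤ d.N b := hc.1.trans (d.N_mono hb)
    have hE : d.io e (X ^ m * d.E j) = ((d.gg b j : ℂ)⁻¹) • d.io e (X ^ (j + m)) := by
      rw [d.E_gap b j h1 h2, mul_smul_comm, ← pow_add, map_smul, add_comm m j]
    by_cases h3 : j + m < d.D b
    · refine ⟨(d.rho b : ℂ) ^ m, 0, ?_, ?_, ?_⟩
      · rw [hE, d.f_gap e b (j + m) (by omega) h3, d.gg_add b j m h1.le, smul_smul, add_zero]
        congr 1
        have := d.gg_ne b j
        push_cast
        rw [inv_mul_cancel_left₀ this]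
      · rw [norm_pow, Complex.norm_real, Real.norm_of_nonneg (by have := d.rho_ge b; linarith)]
        exact d.rho_pow b m (by omega)
      · rw [norm_zero]; exact d.tt_nonneg j
    · refine ⟨0, ((d.gg b j : ℂ)⁻¹) • d.io e (X ^ (j + m)), ?_, by simp, ?_⟩
      · rw [hE, zero_smul, zero_add]
      · rw [d.tt_gap b j h1 h2, if_pos (by omega)]
        exact d.tail_cross e b0 m hc b j hb h1 h2 (by omega)
  · have hb : b0 ≤ b := by
      by_contra h
      have := d.N_mono (show b + 1 ≤ b0 by omega)
      have := d.Nsucc b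
      omega
    have hm : m ≤ d.N b := hc.1.trans (d.N_mono hb)
    by_cases h3 : i + m ≤ d.ν b
    · refine ⟨1, 0, ?_, by simp, ?_⟩
      · rw [one_smul, add_zero, ← d.io_E e (d.D b + i + m), d.E_fan b i hi, add_assoc,
          d.E_fan b (i + m) h3]
        congr 1
        rw [mul_smul_comm]
        congr 1
        ring
      · rw [norm_zero]; exact d.tt_nonneg _
    · refine ⟨0, (d.ζ b : ℂ) • d.io e (X ^ (d.D b + i + m)) -
        (d.ζ b : ℂ) • d.io e (d.p b * X ^ (d.s b + i + m)), ?_, by simp, ?_⟩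
      · rw [d.E_fan b i hi, zero_smul, zero_add, ← smul_sub, ← map_sub, ← map_smul]
        congr 1
        rw [mul_smul_comm]
        congr 1
        ring
      · rw [d.tt_fan b i hi]
        have u1 := d.fan_end1 e b i m hm hi (by omega)
        have u2 := d.tail_fan_end e b0 m hc b i hb hi (by omega)
        refine (norm_sub_le _ _).trans ?_
        rw [two_mul, add_div]
        exact add_le_add u1 u2

/-- the tail operator -/
theorem tail_op (b0 m : ℕ) (hc : d.TailCond b0 m) :
    ∃ U : H →L[ℂ] H, (∀ j, d.N b0 < j → U (e j) = d.io e (X ^ m * d.E j)) ∧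
      (∀ j, j ≤ d.N b0 → U (e j) = 0) ∧ ‖U‖ ≤ 9 := by
  have key : ∀ j, ∃ (a : ℂ) (r : H), ((d.N b0 < j → d.io e (X ^ m * d.E j) = a • e (j + m) + r) ∧
      (j ≤ d.N b0 → a • e (j + m) + r = 0)) ∧ ‖a‖ ≤ 3 ∧ ‖r‖ ≤ d.tt j := by
    intro j
    by_cases h : d.N b0 < j
    · obtain ⟨a, r, h1, h2, h3⟩ := d.tail e b0 m hc j h
      exact ⟨a, r, ⟨fun _ => h1, fun h' => by omega⟩, h2, h3⟩
    · exact ⟨0, 0, ⟨fun h' => by omega, fun _ => by simp⟩, by simp, by simpa using d.tt_nonneg j⟩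
  choose a r h1 h2 h3 using key
  obtain ⟨U, hU, hUn⟩ := shift_l1_op e a r 3 6 (by norm_num) m h2 d.tt h3 d.tt_summable d.tt_tsum
  refine ⟨U, fun j hj => ?_, fun j hj => ?_, hUn.trans (by norm_num)⟩
  · rw [hU, (h1 j).1 hj]
  · rw [hU, (h1 j).2 hj]

theorem exists_T : ∃ T : H →L[ℂ] H, ∀ n P, (T ^ n) (d.io e P) = d.io e (X ^ n * P) := by
  have hc : d.TailCond 0 1 := ⟨by rw [d.N0], fun b _ => Or.inl (d.ν_ge b)⟩
  have key : ∀ j, ∃ (a : ℂ) (r : H), d.io e (X ^ 1 * d.E j) = a • e (j + 1) + r ∧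
      ‖a‖ ≤ 3 ∧ ‖r‖ ≤ d.tt j := by
    intro j
    have hD := d.hND 0
    by_cases h : d.N 0 < j
    · exact d.tail e 0 1 hc j h
    · have hN := d.N0
      have hj : j ≤ 1 := by omega
      rw [d.E_low j hj, ← pow_add, add_comm 1 j]
      by_cases hj0 : j + 1 ≤ 1
      · refine ⟨1, 0, ?_, by simp, by simpa using d.tt_nonneg j⟩
        rw [← d.E_low (j+1) hj0, d.io_E]; simp
      · refine ⟨(d.gg 0 (j+1) : ℂ), 0, ?_, ?_, by simpa using d.tt_nonneg j⟩
        · rw [d.f_gap e 0 (j+1) (by omega) (by omega), add_zero]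
        · rw [Complex.norm_real, Real.norm_of_nonneg (d.gg_pos _ _).le]
          have := d.gg_small 0 (j+1) (by omega)
          have := d.η9 0
          linarith
  choose a r h1 h2 h3 using key
  obtain ⟨T, hT, -⟩ := shift_l1_op e a r 3 6 (by norm_num) 1 h2 d.tt h3 d.tt_summable d.tt_tsum
  have h1' : ∀ P, T (d.io e P) = d.io e (X * P) := by
    have : (T : H →ₗ[ℂ] H) ∘ₗ d.io e = d.io e ∘ₗ LinearMap.mulLeft ℂ X := by
      refine d.Ebasis.ext fun j => ?_
      rw [d.Ebasis_apply]
      have h4 := h1 j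
      rw [pow_one] at h4
      rw [LinearMap.comp_apply, LinearMap.comp_apply, LinearMap.mulLeft_apply, d.io_E, h4]
      exact hT j
    intro P
    exact LinearMap.congr_fun this P
  refine ⟨T, fun n => ?_⟩
  induction n with
  | zero => intro P; simp
  | succ n ih =>
    intro P
    rw [pow_succ, ContinuousLinearMap.mul_apply, h1', ih, pow_succ, mul_assoc]

end RData
end SecP4c

section SecP5
open Polynomial Filter Topology
set_option linter.unusedSectionVars false

theorem norm1_le_of_le (p q : ℂ[X]) (h : ∀ a, ‖p.coeff a‖ ≤ ‖q.coeff a‖) : norm1 p ≤ norm1 q := by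
  have hs : p.support ⊆ q.support := by
    intro a ha
    rw [mem_support_iff] at ha ⊢
    intro h0
    have := h a
    rw [h0, norm_zero] at this
    exact ha (norm_le_zero_iff.mp this)
  rw [norm1_eq p _ hs, norm1]
  exact Finset.sum_le_sum fun a _ => h a

noncomputable def trunc (n : ℕ) (p : ℂ[X]) : ℂ[X] :=
  ∑ i ∈ Finset.range (n+1), C (p.coeff i) * X ^ i

theorem coeff_trunc (n : ℕ) (p : ℂ[X]) (a : ℕ) :
    (trunc n p).coeff a = if a ≤ n then p.coeff a else 0 := by
  rw [trunc, finset_sum_coeff]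
  simp only [coeff_C_mul_X_pow]
  rw [Finset.sum_ite_eq]
  simp [Nat.lt_succ_iff]

theorem trunc_natDegree (n : ℕ) (p : ℂ[X]) : (trunc n p).natDegree ≤ n := by
  rw [natDegree_le_iff_coeff_eq_zero]
  intro a ha
  rw [coeff_trunc, if_neg (by omega)]

theorem coeff_sub_trunc (n : ℕ) (p : ℂ[X]) (a : ℕ) :
    (p - trunc n p).coeff a = if a ≤ n then 0 else p.coeff a := by
  rw [coeff_sub, coeff_trunc]; split_ifs <;> simp

theorem norm1_sub_trunc (n : ℕ) (p : ℂ[X]) : norm1 (p - trunc n p) ≤ norm1 p := by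
  refine norm1_le_of_le _ _ fun a => ?_
  rw [coeff_sub_trunc]; split_ifs <;> simp

theorem coeff_X_pow_mul_ne (n : ℕ) (p : ℂ[X]) (a : ℕ) (h : (X ^ n * p).coeff a ≠ 0) :
    ∃ i, a = n + i ∧ p.coeff i ≠ 0 := by
  rw [coeff_X_pow_mul'] at h
  split_ifs at h with hn
  · exact ⟨a - n, by omega, h⟩
  · exact absurd rfl h

theorem gam_ge_succ (b : ℕ) : (b : ℝ) + 1 ≤ gam b := by
  unfold gam
  have h1 : (b + 2)^2 < 4 ^ ((b+2)^2) := Nat.lt_pow_self (by norm_num)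
  have h2 : b + 1 ≤ 4 ^ ((b+2)^2) := by nlinarith
  exact_mod_cast h2

namespace RData
variable (d : RData)
variable {H : Type} [NormedAddCommGroup H] [InnerProductSpace ℂ H] [CompleteSpace H]
  (e : HilbertBasis ℕ ℂ H)

theorem ββ (b : ℕ) : d.β (d.β b) = d.β b := d.hββ b (d.β b) le_rfl (d.hβ b)

theorem coeffE (b j i : ℕ) (h1 : d.N b < j) (h2 : j ≤ d.N (b+1)) (hi : i ≤ d.N (d.β b)) :
    (d.E j).coeff i = if (d.β b = b ∧ j = d.D b + i) then -(gam b : ℂ) else 0 := by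
  have hNb := d.N_mono (d.hβ b)
  have hND := d.N_lt_D b
  by_cases h3 : j < d.D b
  · rw [d.E_gap b j h1 h3, coeff_smul, coeff_X_pow, if_neg (by omega), smul_zero,
      if_neg (by omega)]
  · obtain ⟨l, rfl⟩ : ∃ l, j = d.D b + l := ⟨j - d.D b, by omega⟩
    rw [d.Nsucc] at h2
    rw [d.E_fan b l (by omega), coeff_smul, coeff_sub, coeff_X_pow, if_neg (by omega)]
    by_cases hb : d.β b = b
    · obtain ⟨-, hs, hp, hz⟩ := d.hS b hb
      rw [hs, hp, hz, one_mul, coeff_X_pow]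
      by_cases hl : l = i
      · subst hl; simp [hb]
      · rw [if_neg (by omega), if_neg (by omega)]; simp
    · obtain ⟨-, hs, -, -⟩ := d.hW b hb
      have := d.N_lt_D (d.β b)
      rw [hs, coeff_mul_X_pow', if_neg (by omega), if_neg (by tauto)]; simp

noncomputable def F (b : ℕ) (x : H) : ℂ[X] := ∑ j ∈ Finset.range (d.N b + 1), e.repr x j • d.E j

theorem F_coeff_succ (b i : ℕ) (x : H) (hi : i ≤ d.N (d.β b)) :
    (d.F e (b+1) x).coeff i =
      (d.F e b x).coeff i - if d.β b = b then (gam b : ℂ) * e.repr x (d.D b + i) else 0 := by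
  have hN := d.N_lt_succ b
  have hND := d.N_lt_D b
  rw [F, F, ← Finset.sum_range_add_sum_Ico _ (show d.N b + 1 ≤ d.N (b+1) + 1 by omega), coeff_add,
    sub_eq_add_neg]
  congr 1
  rw [finset_sum_coeff]
  have : ∀ j ∈ Finset.Ico (d.N b + 1) (d.N (b+1) + 1), (e.repr x j • d.E j).coeff i =
      if j = d.D b + i then (if d.β b = b then -((gam b : ℂ) * e.repr x (d.D b + i)) else 0) else 0 := by
    intro j hj
    rw [Finset.mem_Ico] at hj
    rw [coeff_smul, d.coeffE b j i (by omega) (by omega) hi]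
    by_cases h1 : j = d.D b + i
    · subst h1
      by_cases h2 : d.β b = b
      · simp only [h2, and_self, if_true, smul_eq_mul]; ring
      · simp [h2]
    · simp [h1]
  rw [Finset.sum_congr rfl this, Finset.sum_ite_eq']
  have hs := d.Nsucc b
  by_cases h2 : d.β b = b
  · have := (d.hS b h2).1
    rw [h2] at hi
    rw [if_pos (by rw [Finset.mem_Ico]; omega)]
    simp [h2]
  · simp [h2]

theorem F_stage (b k i : ℕ) (x : H) (hb : d.β b = b) (hk : b ≤ k) (hkb : d.β k = b)
    (hi : i ≤ d.N b) : (d.F e (k+1) x).coeff i = (d.F e (b+1) x).coeff i := by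
  induction k, hk using Nat.le_induction with
  | base => rfl
  | succ k hk ih =>
    have h1 : d.β k = b := by rw [d.hββ (k+1) k (by omega) (by omega), hkb]
    rw [d.F_coeff_succ e (k+1) i x (by rw [hkb]; exact hi), if_neg (by omega), sub_zero, ih h1]

theorem norm1_F (b : ℕ) (x : H) : norm1 (d.F e b x) ≤ ‖x‖ * ((d.N b + 1) * d.M b) := by
  rw [F]
  refine (norm1_sum_le _ _).trans ?_
  have : ∀ j ∈ Finset.range (d.N b + 1), norm1 (e.repr x j • d.E j) ≤ ‖x‖ * d.M b := by
    intro j hj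
    rw [Finset.mem_range] at hj
    refine (norm1_smul _ _).trans ?_
    exact mul_le_mul (coord_le e x j) (d.norm1_E b j (by omega)) (norm1_nonneg _) (norm_nonneg _)
  refine (Finset.sum_le_card_nsmul _ _ _ this).trans (le_of_eq ?_)
  rw [Finset.card_range, nsmul_eq_mul]; push_cast; ring

theorem F_natDegree (b : ℕ) (x : H) : (d.F e b x).natDegree ≤ d.N b := by
  refine natDegree_sum_le_of_forall_le _ _ fun j hj => ?_
  rw [Finset.mem_range] at hj
  refine (natDegree_smul_le _ _).trans ?_
  have := natDegree_eq_of_degree_eq_some (d.E_degree j)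
  omega

theorem io_F (b : ℕ) (x : H) :
    d.io e (d.F e b x) = ∑ j ∈ Finset.range (d.N b + 1), e.repr x j • e j := by
  rw [F, map_sum]
  exact Finset.sum_congr rfl fun j _ => by rw [map_smul, d.io_E]

theorem io_F_tendsto (x : H) : Tendsto (fun b => d.io e (d.F e b x)) atTop (𝓝 x) := by
  have h := (e.hasSum_repr x).tendsto_sum_nat
  have h2 : Tendsto (fun b => d.N b + 1) atTop atTop :=
    tendsto_atTop_mono (fun b => (d.N_ge b).trans (Nat.le_succ _)) (tendsto_add_atTop_nat 1)
  refine (h.comp h2).congr fun b => ?_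
  rw [d.io_F]; rfl

theorem tailCond_D (k : ℕ) : d.TailCond (k+1) (d.D k) := by
  refine ⟨by rw [d.Nsucc]; omega, fun b hb => ?_⟩
  by_cases h : d.β b ≤ k
  · exact Or.inr ⟨by omega, k, rfl, rfl, d.hββ b k h (by omega)⟩
  · left
    rw [d.ν_eq]
    refine le_trans ?_ (d.N_mono (show k + 1 ≤ d.β b by omega))
    rw [d.Nsucc]; omega

theorem T_tail (T : H →L[ℂ] H) (hT : ∀ n P, (T ^ n) (d.io e P) = d.io e (X ^ n * P)) (k : ℕ) (x : H) :
    ‖(T ^ (d.D k)) x - d.io e (X ^ (d.D k) * d.F e (k+1) x)‖ ≤ 9 * ‖x - d.io e (d.F e (k+1) x)‖ := by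
  obtain ⟨U, hU1, hU0, hUn⟩ := d.tail_op e (k+1) (d.D k) (d.tailCond_D k)
  set S := T ^ (d.D k) with hS
  have hSe : ∀ j, S (e j) = d.io e (X ^ (d.D k) * d.E j) := by
    intro j; rw [← d.io_E e j, hS, hT]
  have key : ∀ y : H, (S - U) y = ∑ j ∈ Finset.range (d.N (k+1) + 1), e.repr y j • S (e j) := by
    intro y
    have h1 : HasSum (fun j => e.repr y j • (S - U) (e j)) ((S - U) y) := by
      have := (e.hasSum_repr y).mapL (S - U)
      simpa only [map_smul] using this
    refine h1.unique ?_
    have h2 : HasSum (fun j => e.repr y j • (S - U) (e j))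
        (∑ j ∈ Finset.range (d.N (k+1) + 1), e.repr y j • (S - U) (e j)) := by
      refine hasSum_sum_of_ne_finset_zero fun j hj => ?_
      rw [Finset.mem_range] at hj
      rw [ContinuousLinearMap.sub_apply, hU1 j (by omega), hSe, sub_self, smul_zero]
    convert h2 using 1
    refine Finset.sum_congr rfl fun j hj => ?_
    rw [Finset.mem_range] at hj
    rw [ContinuousLinearMap.sub_apply, hU0 j (by omega), sub_zero]
  have h3 : S (d.io e (d.F e (k+1) x)) = ∑ j ∈ Finset.range (d.N (k+1) + 1), e.repr x j • S (e j) := by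
    rw [d.io_F, map_sum]
    exact Finset.sum_congr rfl fun j _ => map_smul _ _ _
  have h4 : U (d.io e (d.F e (k+1) x)) = 0 := by
    rw [d.io_F, map_sum]
    refine Finset.sum_eq_zero fun j hj => ?_
    rw [Finset.mem_range] at hj
    rw [map_smul, hU0 j (by omega), smul_zero]
  have h5 : S x - d.io e (X ^ (d.D k) * d.F e (k+1) x) = U (x - d.io e (d.F e (k+1) x)) := by
    rw [← hT, ← hS, h3, ← key x, map_sub, h4, ContinuousLinearMap.sub_apply]; abel
  rw [h5]
  exact (U.le_opNorm _).trans (mul_le_mul_of_nonneg_right hUn (norm_nonneg _))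

/-- passing through a fan -/
theorem fan_pass (k : ℕ) (Y : ℂ[X]) (hY : Y.natDegree ≤ d.ν k) :
    ‖d.io e (X ^ (d.D k) * Y) - d.io e (d.p k * X ^ (d.s k) * Y)‖ ≤ norm1 Y / d.ζ k := by
  have hz : 0 < d.ζ k := lt_of_lt_of_le one_pos (d.hζ1 k)
  have h1 : ∀ R : ℂ[X], d.io e (R * Y) = ∑ a ∈ Y.support, Y.coeff a • d.io e (R * X ^ a) := by
    intro R
    conv_lhs => rw [Y.as_sum_support_C_mul_X_pow]
    rw [Finset.mul_sum, map_sum]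
    refine Finset.sum_congr rfl fun a _ => ?_
    rw [← smul_eq_C_mul, mul_smul_comm, map_smul]
  rw [h1, h1, ← Finset.sum_sub_distrib, norm1, Finset.sum_div]
  refine (norm_sum_le _ _).trans (Finset.sum_le_sum fun a ha => ?_)
  have ha' := le_natDegree_of_mem_supp a ha
  rw [← smul_sub, ← pow_add, d.f_fan e k a (by omega), mul_assoc, ← pow_add, add_sub_cancel_right,
    norm_smul, norm_smul, e_norm, mul_one, norm_inv, Complex.norm_real, Real.norm_of_nonneg hz.le,
    div_eq_mul_inv]

end RData
end SecP5

section SecP6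
open Polynomial Filter Topology
set_option linter.unusedSectionVars false

namespace RData
variable (d : RData)
variable {H : Type} [NormedAddCommGroup H] [InnerProductSpace ℂ H] [CompleteSpace H]
  (e : HilbertBasis ℕ ℂ H)

theorem head_Z (k : ℕ) (x : H) :
    ‖d.io e (X ^ (d.D k) * (d.F e (k+1) x - trunc (d.ν k) (d.F e (k+1) x)))‖
      ≤ ‖x‖ * (1/2) ^ (k+1) := by
  set W := d.F e (k+1) x with hW
  have hs := d.Nsucc k
  have hM := d.M_ge (k+1)
  have hQ := one_le_pow₀ (n := 3) (d.Q_ge (k+1))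
  have h1 := d.io_small e (k+1) (X ^ (d.D k) * (W - trunc (d.ν k) W)) (by
    intro a ha
    obtain ⟨i, rfl, hi⟩ := coeff_X_pow_mul_ne _ _ _ ha
    rw [coeff_sub_trunc] at hi
    split_ifs at hi with h
    · exact absurd rfl hi
    · have := le_natDegree_of_ne_zero hi
      have := d.F_natDegree e (k+1) x
      rw [← hW] at this
      omega)
  have h2 := d.small5 (k+1) ((d.N (k+1) + 1) * d.M (k+1)) (by
    have h0 : (0:ℝ) ≤ d.N (k+1) + 1 := by positivity
    calc ((d.N (k+1) : ℝ) + 1) * d.M (k+1) ≤ (d.N (k+1) + 1) * (d.M (k+1) + 1) * 1 := by nlinarith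
      _ ≤ _ := mul_le_mul_of_nonneg_left hQ (by positivity))
  have hη := d.hη (k+1)
  calc _ ≤ _ := h1
    _ ≤ (‖x‖ * ((d.N (k+1) + 1) * d.M (k+1))) * (9 * d.η (k+1)) := by
        refine mul_le_mul_of_nonneg_right ?_ (by positivity)
        exact ((norm1_X_pow_mul _ _).trans (norm1_sub_trunc _ _)).trans (d.norm1_F e (k+1) x)
    _ = ‖x‖ * (((d.N (k+1) + 1) * d.M (k+1)) * (9 * d.η (k+1))) := by ring
    _ ≤ _ := mul_le_mul_of_nonneg_left h2 (norm_nonneg _)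

theorem head_low (b : ℕ) (hb : d.β b = b) (R : ℂ[X]) (hR : R.natDegree ≤ d.N b)
    (h : ∀ a ≤ d.N b, ‖R.coeff a‖ ≤ epsf b (d.N b) (d.B b)) :
    ‖d.io e (X ^ (d.D b) * R)‖ ≤ 1 / ((b:ℝ) + 1) := by
  obtain ⟨hν, hs, hp, hz⟩ := d.hS b hb
  have hB := d.B_ge b
  have he : 0 ≤ epsf b (d.N b) (d.B b) := (norm_nonneg _).trans (h 0 (Nat.zero_le _))
  have h1 := d.io_norm_le e (X ^ (d.D b) * R) (d.B b + 2) (by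
    intro a ha
    obtain ⟨i, rfl, hi⟩ := coeff_X_pow_mul_ne _ _ _ ha
    have := le_natDegree_of_ne_zero hi
    rw [d.f_fan e b i (by omega), hs, hp, one_mul, zero_add]
    refine (norm_add_le _ _).trans ?_
    have h2 := d.f_le_B e b i (by omega)
    have h3 : ‖((d.ζ b : ℂ)⁻¹) • e (d.D b + i)‖ ≤ 1 := by
      rw [norm_smul, e_norm, mul_one, norm_inv, Complex.norm_real,
        Real.norm_of_nonneg (by have := d.hζ1 b; linarith)]
      exact inv_le_one_of_one_le₀ (d.hζ1 b)
    linarith)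
  have h2 : norm1 (X ^ (d.D b) * R) ≤ (d.N b + 1) * epsf b (d.N b) (d.B b) := by
    refine (norm1_X_pow_mul _ _).trans (norm1_le_of_coeff R (d.N b) hR _ fun a => ?_)
    by_cases ha : a ≤ d.N b
    · exact h a ha
    · rw [coeff_eq_zero_of_natDegree_lt (by omega), norm_zero]; exact he
  refine h1.trans ((mul_le_mul_of_nonneg_right h2 (by linarith)).trans (le_of_eq ?_))
  unfold epsf
  have : d.B b + 2 ≠ 0 := by linarith
  field_simp

theorem head_high (b k : ℕ) (hb : d.β b = b) (hbk : b < k) (hk : d.β k = b) (Y R : ℂ[X])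
    (hY : Y.natDegree ≤ d.N b) (hY1 : norm1 Y ≤ d.Q b)
    (hR : ∀ a, R.coeff a = if a ≤ d.N b then 0 else (d.p k * Y).coeff a) :
    ‖d.io e (X ^ (d.D b) * R)‖ ≤ (1/2) ^ (b+1) := by
  obtain ⟨hν, hs, hp, hz⟩ := d.hS b hb
  have hQ1 : d.Q b = d.Q k := d.Q_stage k b (by omega) (by omega)
  have hQ2 : d.Q (b+1) = d.Q k := d.Q_stage k (b+1) (by omega) (by omega)
  have hNs := d.Nsucc b
  have hνk : d.ν k = d.N b := by rw [d.ν_eq, hk]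
  have h1 := d.io_small e (b+1) (X ^ (d.D b) * R) (by
    intro a ha
    obtain ⟨i, rfl, hi⟩ := coeff_X_pow_mul_ne _ _ _ ha
    rw [hR] at hi
    split_ifs at hi with h
    · exact absurd rfl hi
    · have := le_natDegree_of_ne_zero hi
      have h2 : (d.p k * Y).natDegree ≤ _ := natDegree_mul_le
      have := d.hp k
      have := d.N_lt_D b
      omega)
  have hη := d.hη (b+1)
  have hQ := d.Q_ge (b+1)
  have hM := d.M_ge (b+1)
  have h2 : norm1 (X ^ (d.D b) * R) ≤ d.Q (b+1) * d.Q (b+1) := by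
    refine (norm1_X_pow_mul _ _).trans ?_
    have : norm1 R ≤ norm1 (d.p k * Y) := by
      refine norm1_le_of_le _ _ fun a => ?_
      rw [hR]; split_ifs <;> simp
    refine this.trans ((norm1_mul_le _ _).trans ?_)
    rw [hQ2]
    exact mul_le_mul (d.hp1 k) (hQ1 ▸ hY1) (norm1_nonneg _) (by linarith)
  refine h1.trans ((mul_le_mul_of_nonneg_right h2 (by positivity)).trans (d.small5 (b+1) _ ?_))
  have h3 : (1:ℝ) ≤ (d.N (b+1) + 1) * (d.M (b+1) + 1) := by
    have : (0:ℝ) ≤ d.N (b+1) := Nat.cast_nonneg _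
    nlinarith
  have h4 : d.Q (b+1) * d.Q (b+1) ≤ d.Q (b+1) ^ 3 := by
    have : 0 ≤ d.Q (b+1) * d.Q (b+1) := by positivity
    nlinarith
  have h5 : 0 ≤ d.Q (b+1) ^ 3 := by positivity
  nlinarith

theorem head (T : H →L[ℂ] H) (hT : ∀ n P, (T ^ n) (d.io e P) = d.io e (X ^ n * P)) (x : H) (q : ℂ[X])
    (b : ℕ) (hb : d.β b = b) (hx : ‖x‖ ≤ b) (hqd : q.natDegree ≤ d.N b) (hq : ∀ a, ‖q.coeff a‖ ≤ b)
    (h0 : 1 ≤ ‖(d.F e (b+1) x).coeff 0‖) :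
    ∃ n k, b < k ∧ ‖(T ^ n) x - d.io e q‖ ≤ 9 * ‖x - d.io e (d.F e (k+1) x)‖ +
      ‖x‖ * (1/2) ^ (k+1) + 2 / ((b:ℝ)+1) + norm1 q / gam b + (1/2) ^ (b+1) := by
  obtain ⟨hν, hs, hp, hz⟩ := d.hS b hb
  have hg := gam_ge_one b
  have hM := d.M_ge b
  have hRf0 := RSt.Rf_nonneg b (d.N b) (d.M b) hM
  have hb0 : (0:ℝ) ≤ b := Nat.cast_nonneg b
  have hNM : 0 ≤ ((d.N b : ℝ) + 1) * d.M b := by positivity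
  set Y := trunc (d.N b) (d.F e (b+1) x) with hYdef
  have hYd : Y.natDegree ≤ d.N b := trunc_natDegree _ _
  have hYR : ∀ a, ‖Y.coeff a‖ ≤ Rf b (d.N b) (d.M b) := by
    intro a
    rw [hYdef, coeff_trunc]
    split_ifs with ha
    · rw [d.F_coeff_succ e b a x (by rw [hb]; exact ha), if_pos hb]
      refine (norm_sub_le _ _).trans ?_
      have h1 : ‖(d.F e b x).coeff a‖ ≤ b * ((d.N b + 1) * d.M b) :=
        (coeff_le_norm1 _ _).trans ((d.norm1_F e b x).trans (mul_le_mul_of_nonneg_right hx hNM))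
      have h2 : ‖(gam b : ℂ) * e.repr x (d.D b + a)‖ ≤ b * gam b := by
        rw [norm_mul, Complex.norm_real, Real.norm_of_nonneg (by linarith), mul_comm]
        exact mul_le_mul_of_nonneg_right ((coord_le e x _).trans hx) (by linarith)
      unfold Rf
      linarith
    · rw [norm_zero]; exact hRf0
  have hqR : ∀ a, ‖q.coeff a‖ ≤ Rf b (d.N b) (d.M b) := by
    intro a
    refine (hq a).trans ?_
    unfold Rf
    have : 0 ≤ b * ((d.N b + 1) * d.M b + gam b) := by positivity
    linarith
  have hY0 : Y.coeff 0 = (d.F e (b+1) x).coeff 0 := by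
    rw [hYdef, coeff_trunc, if_pos (Nat.zero_le _)]
  obtain ⟨k, hbk, hk, hnet⟩ := d.hnet b hb Y q hYR hqR (by rw [hY0]; exact h0)
  obtain ⟨hν', hs', hQ', hζ'⟩ := d.hW k (by omega)
  rw [hk] at hν' hs' hQ' hζ'
  have hYk : trunc (d.ν k) (d.F e (k+1) x) = Y := by
    ext a
    rw [hYdef, hν', coeff_trunc, coeff_trunc]
    split_ifs with ha
    · exact d.F_stage e b k a x hb hbk.le hk ha
    · rfl
  have hY1 : norm1 Y ≤ (d.N b + 1) * Rf b (d.N b) (d.M b) := norm1_le_of_coeff Y _ hYd _ hYR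
  refine ⟨d.D k, k, hbk, ?_⟩
  -- pieces
  have e1 := d.T_tail e T hT k x
  have e2 := d.head_Z e k x
  rw [hYk] at e2
  have e3 := d.fan_pass e k Y (by rw [hν']; exact hYd)
  rw [hs'] at e3
  have e3' : norm1 Y / d.ζ k ≤ 1 / ((b:ℝ) + 1) := by
    have hz1 := d.hζ1 k
    rw [div_le_div_iff₀ (by linarith) (by positivity)]
    nlinarith
  have e4 := d.fan_pass e b q (by rw [hν]; exact hqd)
  rw [hs, hp, hz, pow_zero, one_mul, one_mul] at e4
  set R := d.p k * Y - q with hR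
  have e5 := d.head_low e b hb (trunc (d.N b) R) (trunc_natDegree _ _) (by
    intro a ha
    rw [coeff_trunc, if_pos ha, hR, coeff_sub]
    exact hnet a ha)
  have e6 := d.head_high e b k hb hbk hk Y (R - trunc (d.N b) R) hYd (hY1.trans (d.hRQ b hb)) (by
    intro a
    rw [coeff_sub_trunc]
    split_ifs with ha
    · rfl
    · rw [hR, coeff_sub, coeff_eq_zero_of_natDegree_lt (p := q) (by omega), sub_zero])
  set W := d.F e (k+1) x with hWdef
  have split : (T ^ (d.D k)) x - d.io e q =
      ((T ^ (d.D k)) x - d.io e (X ^ (d.D k) * W)) + d.io e (X ^ (d.D k) * (W - Y)) +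
      (d.io e (X ^ (d.D k) * Y) - d.io e (d.p k * X ^ (d.D b) * Y)) +
      d.io e (X ^ (d.D b) * trunc (d.N b) R) + d.io e (X ^ (d.D b) * (R - trunc (d.N b) R)) +
      (d.io e (X ^ (d.D b) * q) - d.io e q) := by
    have a1 : d.io e (X ^ (d.D k) * (W - Y)) = d.io e (X ^ (d.D k) * W) - d.io e (X ^ (d.D k) * Y) := by
      rw [mul_sub, map_sub]
    have a2 : d.io e (X ^ (d.D b) * (R - trunc (d.N b) R)) = d.io e (d.p k * X ^ (d.D b) * Y) -
        d.io e (X ^ (d.D b) * q) - d.io e (X ^ (d.D b) * trunc (d.N b) R) := by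
      rw [← map_sub, ← map_sub, hR]; congr 1; ring
    rw [a1, a2]; abel
  rw [split]
  have n1 := norm_add_le (((T ^ (d.D k)) x - d.io e (X ^ (d.D k) * W)) + d.io e (X ^ (d.D k) * (W - Y)) +
      (d.io e (X ^ (d.D k) * Y) - d.io e (d.p k * X ^ (d.D b) * Y)) +
      d.io e (X ^ (d.D b) * trunc (d.N b) R) + d.io e (X ^ (d.D b) * (R - trunc (d.N b) R)))
      (d.io e (X ^ (d.D b) * q) - d.io e q)
  have n2 := norm_add_le (((T ^ (d.D k)) x - d.io e (X ^ (d.D k) * W)) + d.io e (X ^ (d.D k) * (W - Y)) +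
      (d.io e (X ^ (d.D k) * Y) - d.io e (d.p k * X ^ (d.D b) * Y)) +
      d.io e (X ^ (d.D b) * trunc (d.N b) R)) (d.io e (X ^ (d.D b) * (R - trunc (d.N b) R)))
  have n3 := norm_add_le (((T ^ (d.D k)) x - d.io e (X ^ (d.D k) * W)) + d.io e (X ^ (d.D k) * (W - Y)) +
      (d.io e (X ^ (d.D k) * Y) - d.io e (d.p k * X ^ (d.D b) * Y)))
      (d.io e (X ^ (d.D b) * trunc (d.N b) R))
  have n4 := norm_add_le (((T ^ (d.D k)) x - d.io e (X ^ (d.D k) * W)) + d.io e (X ^ (d.D k) * (W - Y)))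
      (d.io e (X ^ (d.D k) * Y) - d.io e (d.p k * X ^ (d.D b) * Y))
  have n5 := norm_add_le ((T ^ (d.D k)) x - d.io e (X ^ (d.D k) * W)) (d.io e (X ^ (d.D k) * (W - Y)))
  have t : 2 / ((b:ℝ)+1) = 1 / ((b:ℝ)+1) + 1 / ((b:ℝ)+1) := by ring
  rw [t]
  linarith

theorem dense_of (T : H →L[ℂ] H) (hT : ∀ n P, (T ^ n) (d.io e P) = d.io e (X ^ n * P)) (x : H)
    (h : ∃ᶠ b in atTop, d.β b = b ∧ 1 ≤ ‖(d.F e (b+1) x).coeff 0‖) :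
    Dense (Set.range fun n : ℕ => (T ^ n) x) := by
  rw [Metric.dense_iff]
  intro y ε hε
  obtain ⟨B, hB⟩ := ((Metric.tendsto_nhds.mp (d.io_F_tendsto e y)) (ε/2) (by linarith)).exists
  set q := d.F e B y with hq
  obtain ⟨A, hA⟩ := eventually_atTop.mp
    ((Metric.tendsto_nhds.mp (d.io_F_tendsto e x)) (ε/36) (by linarith))
  set K : ℝ := ‖x‖ + 3 + norm1 q with hK
  have hK0 : 0 ≤ K := by have := norm1_nonneg q; positivity
  have hlim : Tendsto (fun b : ℕ => K * (1 / ((b:ℝ) + 1))) atTop (𝓝 (K * 0)) :=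
    tendsto_one_div_add_atTop_nhds_zero_nat.const_mul K
  rw [mul_zero] at hlim
  have hev1 := hlim.eventually_lt_const (show (0:ℝ) < ε/4 by linarith)
  have hev2 : ∀ᶠ b : ℕ in atTop, ‖x‖ + norm1 q ≤ b :=
    tendsto_natCast_atTop_atTop.eventually_ge_atTop _
  obtain ⟨b, ⟨hb, h0⟩, h1, h2, h3, h4⟩ := (h.and_eventually (hev1.and (hev2.and
    ((eventually_ge_atTop A).and (eventually_ge_atTop B))))).exists
  have hn := norm1_nonneg q
  have hx0 := norm_nonneg x
  obtain ⟨n, k, hbk, hmain⟩ := d.head e T hT x q b hb (by linarith)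
    ((d.F_natDegree e B y).trans (d.N_mono h4))
    (fun a => (coeff_le_norm1 q a).trans (by linarith)) h0
  refine ⟨(T ^ n) x, ?_, n, rfl⟩
  have hAk := hA (k+1) (by omega)
  rw [dist_comm, dist_eq_norm] at hAk
  rw [dist_eq_norm] at hB
  rw [Metric.mem_ball, dist_eq_norm]
  have hpow : ∀ j : ℕ, b + 1 ≤ j → ((1:ℝ)/2) ^ j ≤ 1 / ((b:ℝ) + 1) := by
    intro j hj
    rw [one_div, inv_pow, ← one_div]
    refine one_div_le_one_div_of_le (by positivity) ?_
    have : j < 2 ^ j := Nat.lt_two_pow_self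
    have : b + 1 ≤ 2 ^ j := by omega
    exact_mod_cast this
  have p1 := mul_le_mul_of_nonneg_left (hpow (k+1) (by omega)) hx0
  have p2 := hpow (b+1) le_rfl
  have p3 : norm1 q / gam b ≤ norm1 q * (1 / ((b:ℝ)+1)) := by
    rw [div_eq_mul_one_div]
    exact mul_le_mul_of_nonneg_left (one_div_le_one_div_of_le (by positivity) (gam_ge_succ b)) hn
  have p4 : (T ^ n) x - y = ((T ^ n) x - d.io e q) + (d.io e q - y) := by abel
  rw [p4]
  have p5 := norm_add_le ((T ^ n) x - d.io e q) (d.io e q - y)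
  have t : 2 / ((b:ℝ)+1) = 2 * (1 / ((b:ℝ)+1)) := by ring
  rw [t] at hmain
  have : K * (1 / ((b:ℝ)+1)) = ‖x‖ * (1 / ((b:ℝ)+1)) + 3 * (1 / ((b:ℝ)+1)) +
    norm1 q * (1 / ((b:ℝ)+1)) := by rw [hK]; ring
  linarith

theorem small_of (x : H)
    (h : ¬ ∃ᶠ b in atTop, d.β b = b ∧ 1 ≤ ‖(d.F e (b+1) x).coeff 0‖) :
    ∀ᶠ b in atTop, d.β b = b → ‖e.repr x (d.D b)‖ ≤ 2 / gam b := by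
  rw [not_frequently] at h
  obtain ⟨A, hA⟩ := eventually_atTop.mp h
  -- an S-block beyond A
  obtain ⟨b1, hb1, hb1A⟩ := d.hinf.exists_gt A
  filter_upwards [eventually_gt_atTop b1] with b hb hS
  have hprev : d.β (d.β (b-1)) = d.β (b-1) := d.ββ (b-1)
  have hge : b1 ≤ d.β (b-1) := by
    by_contra hlt
    have := d.hββ (b-1) b1 (by omega) (by omega)
    have h' : d.β b1 = b1 := hb1
    omega
  have hle := d.hβ (b-1)
  have h1 := hA (d.β (b-1)) (by omega)
  have h2 := hA b (by omega)
  have h3 := d.F_stage e (d.β (b-1)) (b-1) 0 x hprev hle rfl (Nat.zero_le _)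
  rw [Nat.sub_add_cancel (by omega)] at h3
  have h4 := d.F_coeff_succ e b 0 x (Nat.zero_le _)
  rw [if_pos hS, h3, add_zero] at h4
  have h1' : ‖(d.F e (d.β (b-1) + 1) x).coeff 0‖ < 1 := by
    by_contra hh; exact h1 ⟨hprev, not_lt.mp hh⟩
  have h2' : ‖(d.F e (b+1) x).coeff 0‖ < 1 := by
    by_contra hh; exact h2 ⟨hS, not_lt.mp hh⟩
  have hg := gam_ge_one b
  rw [le_div_iff₀ (by linarith)]
  have h5 : (gam b : ℂ) * e.repr x (d.D b) =
      (d.F e (d.β (b-1) + 1) x).coeff 0 - (d.F e (b+1) x).coeff 0 := by rw [h4]; ring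
  have h6 : ‖(gam b : ℂ) * e.repr x (d.D b)‖ ≤ 2 := by
    rw [h5]; refine (norm_sub_le _ _).trans ?_; linarith
  rw [norm_mul, Complex.norm_real, Real.norm_of_nonneg (by linarith)] at h6
  linarith

end RData

end SecP6

/-- There exist a bounded linear operator `T` and a unitary operator `V` on a complex separable
infinite-dimensional Hilbert space `H` such that for every non-zero `x ∈ H`, either the orbit
of `x` or the orbit of `V x` under `T` is dense in `H`. -/
theorem stmt_0 (H : Type) [NormedAddCommGroup H] [InnerProductSpace ℂ H] [CompleteSpace H]
    [TopologicalSpace.SeparableSpace H] (hdim : ¬ FiniteDimensional ℂ H) :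
    ∃ (T : H →L[ℂ] H) (V : H ≃ₗᵢ[ℂ] H), ∀ x : H, x ≠ 0 →
      Dense (Set.range fun n : ℕ => (T ^ n) x) ∨
      Dense (Set.range fun n : ℕ => (T ^ n) (V x)) := by
  obtain ⟨e⟩ := hb_nat H hdim
  let d := RSt.data
  obtain ⟨T, hT⟩ := d.exists_T e
  obtain ⟨V, hV⟩ := exists_V e d.D d.D_strictMono d.b_lt_D (fun b => d.β b = b) d.hinf
  refine ⟨T, V, fun x hx => ?_⟩
  by_contra hcon
  rw [not_or] at hcon
  exact hx (hV x (d.small_of e x fun h => hcon.1 (d.dense_of e T hT x h))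
    (d.small_of e (V x) fun h => hcon.2 (d.dense_of e T hT (V x) h)))
end

section
/- There exist two bounded linear operators T₀ and T₁ on a complex separable infinite-dimensional Hilbert space H such that for every non-zero vector x of H, the set {T_{ω₀} T_{ω₁} ⋯ T_{ωₙ} x : n ≥ 0, ω₀,…,ωₙ ∈ {0,1}} of all images of x under finite compositions of T₀ and T₁ is dense in H. In other words, there exists a minimal action of the free semigroup with two generators 𝔽₂⁺ on H. -/
open Filter Topology in
theorem aux_hypercyclic {H : Type} [NormedAddCommGroup H] [InnerProductSpace ℂ H] [CompleteSpace H]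
    [TopologicalSpace.SeparableSpace H] (T R : H →L[ℂ] H)
    (hR : ∀ n, ∀ x, (T ^ n) ((R ^ n) x) = x)
    (hR0 : ∀ x, Tendsto (fun n => (R ^ n) x) atTop (𝓝 0))
    (hK : Dense {x : H | ∃ N, ∀ n ≥ N, (T ^ n) x = 0}) :
    ∃ v : H, Dense (Set.range fun n : ℕ => (T ^ n) v) := by
  have : SecondCountableTopology H := UniformSpace.secondCountable_of_separable H
  let B := TopologicalSpace.countableBasis H
  have hd : Dense (⋂ s ∈ B, ⋃ n : ℕ, (fun x => (T ^ n) x) ⁻¹' s) := by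
    apply dense_biInter_of_isOpen
    · intro s hs
      exact isOpen_iUnion fun n =>
        (TopologicalSpace.isOpen_of_mem_countableBasis hs).preimage (T ^ n).continuous
    · exact TopologicalSpace.countable_countableBasis H
    · intro s hs
      obtain ⟨y, hy⟩ := TopologicalSpace.nonempty_of_mem_countableBasis hs
      rw [dense_iff_inter_open]
      intro U hU hUne
      obtain ⟨x, hxU, N, hN⟩ := hK.inter_open_nonempty U hU hUne
      have h1 : Tendsto (fun n => x + (R ^ n) y) atTop (𝓝 x) := by
        simpa using (tendsto_const_nhds (x := x)).add (hR0 y)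
      obtain ⟨n, hn1, hn2⟩ :=
        ((h1.eventually (hU.mem_nhds hxU)).and (eventually_ge_atTop N)).exists
      refine ⟨x + (R ^ n) y, hn1, Set.mem_iUnion.2 ⟨n, ?_⟩⟩
      change (T ^ n) (x + (R ^ n) y) ∈ s
      rw [map_add, hN n hn2, hR, zero_add]
      exact hy
  obtain ⟨v, hv⟩ := hd.nonempty
  refine ⟨v, ?_⟩
  rw [(TopologicalSpace.isBasis_countableBasis H).dense_iff]
  intro o ho _
  obtain ⟨n, hn⟩ := Set.mem_iUnion.1 (Set.mem_iInter₂.1 hv o ho)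
  exact ⟨_, hn, n, rfl⟩

theorem aux_basis {H : Type} [NormedAddCommGroup H] [InnerProductSpace ℂ H] [CompleteSpace H]
    [TopologicalSpace.SeparableSpace H] (hdim : ¬ FiniteDimensional ℂ H) :
    Nonempty (HilbertBasis ℕ ℂ H) := by
  obtain ⟨w, b, hb⟩ := exists_hilbertBasis ℂ H
  have hc : Countable w := by
    have : (Set.univ : Set w).Countable := by
      refine Set.PairwiseDisjoint.countable_of_isOpen (s := fun i : w => Metric.ball (b i) (1/2))
        ?_ (fun _ _ => Metric.isOpen_ball) (fun i _ => ⟨b i, by simp⟩)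
      intro i _ j _ hij
      apply Metric.ball_disjoint_ball
      have h0 := b.orthonormal.2 hij
      have h1 := norm_sub_sq (𝕜 := ℂ) (b i) (b j)
      rw [h0, b.orthonormal.1 i, b.orthonormal.1 j] at h1
      rw [dist_eq_norm]
      simp at h1
      nlinarith [norm_nonneg (b i - b j)]
    exact Set.countable_univ_iff.1 this
  have hi : Infinite w := by
    by_contra hf
    rw [not_infinite_iff_finite] at hf
    have := Fintype.ofFinite w
    exact hdim (b.toOrthonormalBasis.toBasis.finiteDimensional_of_finite)
  obtain ⟨e⟩ := nonempty_equiv_of_countable (α := ℕ) (β := w)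
  refine ⟨HilbertBasis.mk (v := b ∘ e) (b.orthonormal.comp e e.injective) ?_⟩
  rw [e.surjective.range_comp, b.dense_span]

open Filter Topology in
/-- There exist two bounded linear operators `T 0` and `T 1` on a complex separable
infinite-dimensional Hilbert space `H` such that for every non-zero `x ∈ H`, the set of all
images of `x` under finite (non-empty) compositions of `T 0` and `T 1` is dense in `H`:
a minimal action of the free semigroup on two generators on `H`. -/
theorem stmt_1 (H : Type) [NormedAddCommGroup H] [InnerProductSpace ℂ H] [CompleteSpace H]
    [TopologicalSpace.SeparableSpace H] (hdim : ¬ FiniteDimensional ℂ H) :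
    ∃ T : Fin 2 → (H →L[ℂ] H), ∀ x : H, x ≠ 0 →
      Dense {y : H | ∃ ω : List (Fin 2), ω ≠ [] ∧ (ω.map T).prod x = y} := by
  obtain ⟨b⟩ := aux_basis hdim
  let V : lp (fun _ : ℕ => ℂ) 2 →ₗᵢ[ℂ] H :=
    (b.orthonormal.comp Nat.succ Nat.succ_injective).orthogonalFamily.linearIsometry
  let S₀ : H →ₗᵢ[ℂ] H := V.comp b.repr.toLinearIsometry
  let S : H →L[ℂ] H := S₀.toContinuousLinearMap
  have hSn : ∀ x, ‖S x‖ = ‖x‖ := fun x => S₀.norm_map x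
  have hSb : ∀ n, S (b n) = b (n + 1) := by
    intro n
    change V (b.repr (b n)) = _
    rw [b.repr_self]
    simp [V, OrthogonalFamily.linearIsometry_apply_single]
  let A := ContinuousLinearMap.adjoint S
  have hAS : ∀ x, A (S x) = x := by
    intro x
    have := (ContinuousLinearMap.norm_map_iff_adjoint_comp_self S).1 hSn
    exact congrArg (fun f : H →L[ℂ] H => f x) this
  have hA0 : A (b 0) = 0 := by
    have h : ∀ i, b.repr (A (b 0)) i = 0 := by
      intro i
      rw [b.repr_apply_apply, ContinuousLinearMap.adjoint_inner_right, hSb]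
      exact b.orthonormal.2 (by simp)
    apply b.repr.injective
    ext i
    simp [h i]
  have hAb : ∀ n, A (b (n + 1)) = b n := fun n => by rw [← hSb, hAS]
  have hSbn : ∀ n, (S ^ n) (b 0) = b n := by
    intro n
    induction n with
    | zero => simp
    | succ n ih => rw [pow_succ', mul_apply_eq_comp, ih, hSb]
  let T : H →L[ℂ] H := (2 : ℂ) • A
  let R : H →L[ℂ] H := (2⁻¹ : ℂ) • S
  have hTR : ∀ x, T (R x) = x := by
    intro x
    simp [T, R, hAS]
  have hR : ∀ n, ∀ x, (T ^ n) ((R ^ n) x) = x := by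
    intro n
    induction n with
    | zero => simp
    | succ n ih =>
      intro x
      rw [pow_succ, pow_succ', mul_apply_eq_comp, mul_apply_eq_comp, hTR, ih]
  have hRn : ∀ n x, ‖(R ^ n) x‖ = (2⁻¹ : ℝ) ^ n * ‖x‖ := by
    intro n x
    induction n with
    | zero => simp
    | succ n ih =>
      rw [pow_succ', mul_apply_eq_comp]
      change ‖(2⁻¹ : ℂ) • S ((R ^ n) x)‖ = _
      rw [norm_smul, hSn, ih]
      simp
      ring
  have hR0 : ∀ x, Tendsto (fun n => (R ^ n) x) atTop (𝓝 0) := by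
    intro x
    rw [tendsto_zero_iff_norm_tendsto_zero]
    simp only [hRn]
    simpa using (tendsto_pow_atTop_nhds_zero_of_lt_one (r := (2⁻¹ : ℝ)) (by norm_num)
      (by norm_num)).mul_const ‖x‖
  have hTb : ∀ k, ∀ n ≥ k + 1, (T ^ n) (b k) = 0 := by
    intro k
    induction k with
    | zero =>
      intro n hn
      obtain ⟨m, rfl⟩ : ∃ m, n = m + 1 := ⟨n - 1, by omega⟩
      rw [pow_succ, mul_apply_eq_comp]
      have : T (b 0) = 0 := by simp [T, hA0]
      rw [this, map_zero]
    | succ k ih =>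
      intro n hn
      obtain ⟨m, rfl⟩ : ∃ m, n = m + 1 := ⟨n - 1, by omega⟩
      rw [pow_succ, mul_apply_eq_comp]
      have : T (b (k + 1)) = (2 : ℂ) • b k := by simp [T, hAb]
      rw [this, map_smul, ih m (by omega), smul_zero]
  have hK : Dense {x : H | ∃ N, ∀ n ≥ N, (T ^ n) x = 0} := by
    have h1 : Dense (Submodule.span ℂ (Set.range b) : Set H) :=
      Submodule.dense_iff_topologicalClosure_eq_top.2 b.dense_span
    refine h1.mono ?_
    intro x hx
    induction hx using Submodule.span_induction with
    | mem x h =>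
      obtain ⟨k, rfl⟩ := h
      exact ⟨k + 1, hTb k⟩
    | zero => exact ⟨0, by simp⟩
    | add x y _ _ hx hy =>
      obtain ⟨N, hN⟩ := hx
      obtain ⟨M, hM⟩ := hy
      refine ⟨max N M, fun n hn => ?_⟩
      rw [map_add, hN n (le_trans (le_max_left _ _) hn), hM n (le_trans (le_max_right _ _) hn),
        add_zero]
    | smul a x _ hx =>
      obtain ⟨N, hN⟩ := hx
      exact ⟨N, fun n hn => by rw [map_smul, hN n hn, smul_zero]⟩
  obtain ⟨v, hv⟩ := aux_hypercyclic T R hR hR0 hK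
  have hin : ∀ n x, inner ℂ (b 0) ((T ^ n) x) = (2 : ℂ) ^ n * inner ℂ (b n) x := by
    intro n
    have key : ∀ n, ∀ y x, inner ℂ y ((T ^ n) x) = (2 : ℂ) ^ n * inner ℂ ((S ^ n) y) x := by
      intro n
      induction n with
      | zero => simp
      | succ n ih =>
        intro y x
        rw [pow_succ, mul_apply_eq_comp, ih]
        change _ * inner ℂ _ ((2 : ℂ) • A x) = _
        rw [inner_smul_right, ContinuousLinearMap.adjoint_inner_right, pow_succ' S,
          mul_apply_eq_comp]
        ring
    intro x
    rw [key, hSbn]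
  let P : H →L[ℂ] H := (innerSL ℂ (b 0)).smulRight v
  refine ⟨![T, P], fun x hx => ?_⟩
  obtain ⟨n, hn⟩ : ∃ n, inner ℂ (b n) x ≠ 0 := by
    by_contra! h
    apply hx
    apply b.repr.injective
    ext i
    simp [b.repr_apply_apply, h i]
  set c : ℂ := inner ℂ (b 0) ((T ^ n) x) with hc
  have hc0 : c ≠ 0 := by
    rw [hc, hin]
    exact mul_ne_zero (by simp) hn
  have hd : Dense ((fun y : H => c • y) '' (Set.range fun m : ℕ => (T ^ m) v)) :=
    ((Homeomorph.smulOfNeZero c hc0).surjective.denseRange).dense_image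
      (continuous_const_smul c) hv
  refine hd.mono ?_
  rintro _ ⟨_, ⟨m, rfl⟩, rfl⟩
  refine ⟨List.replicate m 0 ++ 1 :: List.replicate n 0, by simp, ?_⟩
  simp [P, hc]
end

section
/- Let H be a complex separable infinite-dimensional Hilbert space and let T be a bounded linear operator on H such that: T = B + K with B power-bounded and K compact; (P1) for every x ∈ H the closure of the orbit Orb(x,T) is a linear subspace of H; and (P2) the family of orbit closures is totally ordered by inclusion. Then HC(T)^c is a dense linear subspace of H, and T has a non-trivial closed invariant subspace, i.e. a closed linear subspace M with {0} ≠ M ≠ H and T(M) ⊆ M. -/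
open Filter Topology

section aux
variable {H : Type} [NormedAddCommGroup H] [InnerProductSpace ℂ H] [CompleteSpace H]

theorem aux_spec_B [Nontrivial H] (B : H →L[ℂ] H) (M : ℝ) (hB : ∀ n : ℕ, ‖B ^ n‖ ≤ M) (l : ℂ)
    (hl : 1 < ‖l‖) : l ∉ spectrum ℂ B := by
  intro h
  obtain ⟨n, hn⟩ := pow_unbounded_of_one_lt M hl
  have h1 := spectrum.norm_le_norm_of_mem (spectrum.pow_mem_pow B n h)
  rw [norm_pow] at h1
  linarith [hB n]

theorem aux_spec_T [Nontrivial H] (T B K : H →L[ℂ] H) (hT : T = B + K)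
    (M : ℝ) (hB : ∀ n : ℕ, ‖B ^ n‖ ≤ M) (hK : IsCompactOperator K)
    (heig : ∀ (l : ℂ) (x : H), 1 < ‖l‖ → T x = l • x → x = 0) (l : ℂ)
    (hl : l ∈ spectrum ℂ T) : ‖l‖ ≤ 1 := by
  by_contra! h
  have h1 := aux_spec_B B M hB l h
  rw [spectrum.notMem_iff] at h1
  obtain ⟨u, hu⟩ := h1
  let L : H →L[ℂ] H := ↑u⁻¹
  have hLu : L * u = 1 := u.inv_mul
  have huL : (u : H →L[ℂ] H) * L = 1 := u.mul_inv
  have hLK : IsCompactOperator (L * K) := hK.clm_comp L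
  rcases hLK.hasEigenvalue_or_mem_resolventSet (one_ne_zero (α := ℂ)) with h2 | h2
  · obtain ⟨x, hx⟩ := h2.exists_hasEigenvector
    have hx1 : L (K x) = x := by simpa using hx.apply_eq_smul
    apply hx.2
    apply heig l x h
    have h3 : (u : H →L[ℂ] H) (L (K x)) = K x := by
      change ((u : H →L[ℂ] H) * L) (K x) = K x
      rw [huL]; rfl
    rw [hx1, hu] at h3
    have h4 : l • x - B x = K x := by
      rw [← h3]; simp [Algebra.algebraMap_eq_smul_one]
    rw [hT, ContinuousLinearMap.add_apply, ← h4]; abel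
  · rw [spectrum.mem_resolventSet_iff] at h2
    apply hl
    rw [spectrum.mem_resolventSet_iff]
    have : algebraMap ℂ (H →L[ℂ] H) l - T = u * (algebraMap ℂ (H →L[ℂ] H) 1 - L * K) := by
      rw [mul_sub, ← mul_assoc, huL, hu, hT]; simp; abel
    rw [this]
    exact u.isUnit.mul h2

theorem aux_growth [Nontrivial H] (T : H →L[ℂ] H) (h : ∀ l ∈ spectrum ℂ T, ‖l‖ ≤ 1)
    (ρ : ℝ) (hρ : 1 < ρ) : ∃ A : ℝ, ∀ n : ℕ, ‖T ^ n‖ ≤ A * ρ ^ n := by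
  have h1 : spectralRadius ℂ T < ENNReal.ofReal ρ := by
    apply spectrum.spectralRadius_lt_of_forall_lt
    intro z hz
    rw [← NNReal.coe_lt_coe, coe_nnnorm, Real.coe_toNNReal _ (by linarith)]
    linarith [h z hz]
  have h2 := (spectrum.pow_norm_pow_one_div_tendsto_nhds_spectralRadius T).eventually_lt_const h1
  obtain ⟨N, hN⟩ := eventually_atTop.1 (h2.and (eventually_gt_atTop 0))
  have h3 : ∀ n ≥ N, ‖T ^ n‖ ≤ ρ ^ n := by
    intro n hn
    obtain ⟨h4, h5⟩ := hN n hn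
    rw [ENNReal.ofReal_lt_ofReal_iff (by linarith)] at h4
    have h6 := pow_le_pow_left₀ (by positivity) h4.le n
    rwa [one_div, Real.rpow_inv_natCast_pow (norm_nonneg _) h5.ne'] at h6
  refine ⟨1 + ∑ n ∈ Finset.range N, ‖T ^ n‖, fun n => ?_⟩
  have hp : 1 ≤ ρ ^ n := one_le_pow₀ hρ.le
  have hs : 0 ≤ ∑ n ∈ Finset.range N, ‖T ^ n‖ := Finset.sum_nonneg fun _ _ => norm_nonneg _
  rcases lt_or_ge n N with h4 | h4
  · have := Finset.single_le_sum (f := fun n => ‖T ^ n‖) (fun _ _ => norm_nonneg _)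
      (Finset.mem_range.2 h4)
    nlinarith
  · nlinarith [h3 n h4]

theorem aux_cpt (T B K : H →L[ℂ] H) (hT : T = B + K) (hK : IsCompactOperator K) (n : ℕ) :
    IsCompactOperator (T ^ n - B ^ n : H →L[ℂ] H) := by
  induction n with
  | zero => simpa using (isCompactOperator_zero : IsCompactOperator (0 : H → H))
  | succ n ih =>
    have : T ^ (n+1) - B ^ (n+1) = T * (T ^ n - B ^ n) + K * B ^ n := by
      rw [pow_succ' T, pow_succ' B, hT]; noncomm_ring
    rw [this]
    exact (ih.clm_comp T).add (hK.comp_clm (B ^ n))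

/-- weak compactness of balls, in ultrafilter form, with compact operators made continuous -/
theorem aux_weak (x0 : H) (r : ℝ) (u : ℕ → H) (hu : ∀ m, ‖u m - x0‖ ≤ r) (U : Ultrafilter ℕ) :
    ∃ x : H, ‖x - x0‖ ≤ r ∧ ∀ S : H →L[ℂ] H, IsCompactOperator S →
      Tendsto (fun m => S (u m)) U (𝓝 (S x)) := by
  let J := InnerProductSpace.toDual ℂ H
  have hc := WeakDual.isCompact_closedBall (𝕜 := ℂ) (J x0) r
  let v : ℕ → WeakDual ℂ H := fun m => StrongDual.toWeakDual (J (u m))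
  obtain ⟨f, hf, hfl⟩ := hc.ultrafilter_le_nhds (U.map v) (by
    rw [le_principal_iff, Ultrafilter.coe_map, mem_map]
    apply univ_mem'
    intro m
    change J (u m) ∈ Metric.closedBall (J x0) r
    rw [mem_closedBall_iff_norm, ← map_sub, LinearIsometryEquiv.norm_map]
    exact hu m)
  let x := J.symm (WeakDual.toStrongDual f)
  have hJx : J x = WeakDual.toStrongDual f := J.apply_symm_apply _
  have hlim : ∀ z, Tendsto (fun m => inner ℂ (u m) z) U (𝓝 (inner ℂ x z)) := by
    intro z
    have h1 : Tendsto v U (𝓝 f) := hfl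
    have h2 := ((WeakDual.eval_continuous z).tendsto f).comp h1
    have h3 : f z = inner ℂ x z := by
      rw [← InnerProductSpace.toDual_apply_apply (𝕜 := ℂ)]
      change f z = J x z
      rw [hJx]; rfl
    rw [← h3]
    exact h2
  refine ⟨x, ?_, ?_⟩
  · have : WeakDual.toStrongDual f ∈ Metric.closedBall (J x0) r := hf
    rwa [← hJx, mem_closedBall_iff_norm, ← map_sub, LinearIsometryEquiv.norm_map] at this
  · intro S hS
    obtain ⟨C, hC, hC'⟩ := hS.image_closedBall_subset_compact (f := (S : H →ₗ[ℂ] H)) (‖x0‖ + r)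
    obtain ⟨y, hy, hyl⟩ := hC.ultrafilter_le_nhds (U.map fun m => S (u m)) (by
      rw [le_principal_iff, Ultrafilter.coe_map, mem_map]
      apply univ_mem'
      intro m
      apply hC'
      refine ⟨u m, ?_, rfl⟩
      rw [mem_closedBall_zero_iff]
      calc ‖u m‖ = ‖x0 + (u m - x0)‖ := by congr 1; abel
        _ ≤ _ := (norm_add_le _ _).trans (by linarith [hu m]))
    have h1 : Tendsto (fun m => S (u m)) U (𝓝 y) := hyl
    have : y = S x := by
      apply ext_inner_right ℂ
      intro z
      have h2 : Tendsto (fun m => inner ℂ (S (u m)) z) U (𝓝 (inner ℂ y z)) :=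
        h1.inner tendsto_const_nhds
      have h3 := hlim (ContinuousLinearMap.adjoint S z)
      simp only [ContinuousLinearMap.adjoint_inner_right] at h3
      exact tendsto_nhds_unique h2 h3
    rwa [← this]

theorem aux_main [Nontrivial H] (T B K : H →L[ℂ] H) (hT : T = B + K)
    (C : ℝ) (hB : ∀ n : ℕ, ‖B ^ n‖ ≤ C) (hK : IsCompactOperator K)
    (heig : ∀ (l : ℂ) (x : H), 1 < ‖l‖ → T x = l • x → x = 0)
    (x0 : H) (r : ℝ) (hr : 0 < r) (h0 : r < ‖x0‖)
    (hd : ∀ x, ‖x - x0‖ ≤ r → Dense (Set.range fun n : ℕ => (T ^ n) x)) : False := by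
  have hC : 0 ≤ C := (norm_nonneg _).trans (hB 0)
  obtain ⟨R, hR1, hR⟩ : ∃ R : ℝ, 1 < R ∧ 2 + C * (2 * r) ≤ R * r := by
    refine ⟨2 + (2 + C * (2 * r)) / r, ?_, ?_⟩
    · have : 0 ≤ (2 + C * (2 * r)) / r := by positivity
      linarith
    · rw [add_mul, div_mul_cancel₀ _ hr.ne']; linarith
  -- finitely many powers
  obtain ⟨N, hN⟩ : ∃ N : ℕ, ∀ x, ‖x - x0‖ ≤ r → ∃ n ≤ N, ‖(T ^ n) x - (R : ℂ) • x0‖ ≤ R * r := by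
    by_contra! hcon
    choose u hu hu2 using hcon
    obtain ⟨x, hx, hlim⟩ := aux_weak x0 r u hu (hyperfilter ℕ)
    obtain ⟨_, ⟨n, rfl⟩, hn⟩ := (hd x hx).exists_dist_lt ((R : ℂ) • x0) one_pos
    have h1 := hlim _ (aux_cpt T B K hT hK n)
    have h2 := (Metric.tendsto_nhds.1 h1) 1 one_pos
    have h3 : ∀ᶠ m in (hyperfilter ℕ : Filter ℕ), n ≤ m :=
      Nat.hyperfilter_le_atTop (eventually_ge_atTop n)
    obtain ⟨m, hm1, hm2⟩ := (h2.and h3).exists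
    have h4 := hu2 m n hm2
    rw [dist_eq_norm] at hm1 hn
    rw [norm_sub_rev] at hn
    simp only at hn
    have h5 : (T ^ n) (u m) - (R : ℂ) • x0 = ((T ^ n) x - (R : ℂ) • x0)
        + ((T ^ n - B ^ n) (u m) - (T ^ n - B ^ n) x) + (B ^ n) (u m - x) := by
      simp only [ContinuousLinearMap.sub_apply, map_sub]; abel
    have h6 : ‖(B ^ n) (u m - x)‖ ≤ C * (2 * r) := by
      refine ((B ^ n).le_opNorm _).trans ?_
      have : ‖u m - x‖ ≤ 2 * r := by
        have : u m - x = (u m - x0) - (x - x0) := by abel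
        rw [this]
        exact (norm_sub_le _ _).trans (by linarith [hu m])
      gcongr
      exact hB n
    have h7 : ‖(T ^ n) (u m) - (R : ℂ) • x0‖ ≤ _ := h5 ▸ norm_add₃_le
    linarith
  have hRc : ‖(R : ℂ)‖ = R := by rw [Complex.norm_real, Real.norm_of_nonneg (by linarith)]
  have hR0 : (R : ℂ) ≠ 0 := by
    rw [← norm_ne_zero_iff, hRc]; linarith
  -- iterate
  have hit : ∀ j : ℕ, ∃ m ≤ N * j, ∃ y, ‖y - x0‖ ≤ r ∧ (T ^ m) x0 = (R : ℂ) ^ j • y := by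
    intro j
    induction j with
    | zero => exact ⟨0, by simp, x0, by simpa using hr.le, by simp⟩
    | succ j ih =>
      obtain ⟨m, hm, y, hy, hmy⟩ := ih
      obtain ⟨n, hn, hny⟩ := hN y hy
      refine ⟨n + m, by rw [mul_add]; omega, (R : ℂ)⁻¹ • (T ^ n) y, ?_, ?_⟩
      · have : (R : ℂ)⁻¹ • (T ^ n) y - x0 = (R : ℂ)⁻¹ • ((T ^ n) y - (R : ℂ) • x0) := by
          rw [smul_sub, inv_smul_smul₀ hR0]
        rw [this, norm_smul, norm_inv, hRc, inv_mul_le_iff₀ (by linarith)]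
        exact hny
      · rw [pow_add, ContinuousLinearMap.mul_apply, hmy, map_smul, pow_succ, mul_smul,
          smul_inv_smul₀ hR0]
  -- growth contradiction
  obtain ⟨ρ, hρ1, hρ⟩ : ∃ ρ : ℝ, 1 < ρ ∧ ρ ^ N < R := by
    have h1 : Tendsto (fun t : ℝ => t ^ N) (𝓝[>] 1) (𝓝 (1 ^ N)) :=
      ((continuous_pow N).tendsto 1).mono_left nhdsWithin_le_nhds
    rw [one_pow] at h1
    obtain ⟨ρ, h2, h3⟩ := ((h1.eventually_lt_const hR1).and self_mem_nhdsWithin).exists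
    exact ⟨ρ, h3, h2⟩
  obtain ⟨A, hA⟩ := aux_growth T (aux_spec_T T B K hT C hB hK heig) ρ hρ1
  have hA0 : 0 ≤ A := by simpa using (norm_nonneg _).trans (hA 0)
  set S := ρ ^ N with hS
  have hS0 : 0 < S := by positivity
  have hkey : ∀ j : ℕ, (R / S) ^ j ≤ A * ‖x0‖ / (‖x0‖ - r) := by
    intro j
    obtain ⟨m, hm, y, hy, hmy⟩ := hit j
    have h1 : ‖x0‖ - r ≤ ‖y‖ := by
      have := norm_sub_norm_le x0 y
      rw [norm_sub_rev] at this
      linarith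
    have h2 : ‖(T ^ m) x0‖ = R ^ j * ‖y‖ := by rw [hmy, norm_smul, norm_pow, hRc]
    have h3 : ‖(T ^ m) x0‖ ≤ A * S ^ j * ‖x0‖ := by
      refine ((T ^ m).le_opNorm _).trans ?_
      gcongr
      refine (hA m).trans ?_
      gcongr
      rw [hS, ← pow_mul]
      exact pow_le_pow_right₀ hρ1.le hm
    have h4 : R ^ j * (‖x0‖ - r) ≤ A * S ^ j * ‖x0‖ := by
      rw [h2] at h3
      refine le_trans ?_ h3
      gcongr
    rw [le_div_iff₀ (by linarith), div_pow, div_mul_eq_mul_div, div_le_iff₀ (by positivity)]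
    linarith
  obtain ⟨j, hj⟩ := pow_unbounded_of_one_lt (A * ‖x0‖ / (‖x0‖ - r)) ((one_lt_div hS0).2 hρ)
  linarith [hkey j]

end aux

/-- Let `T = B + K` be a bounded operator on a complex separable infinite-dimensional Hilbert
space `H`, with `B` power-bounded and `K` compact, satisfying (P1): every orbit closure is a
linear subspace, and (P2): the orbit closures are totally ordered by inclusion. Then the set of
non-hypercyclic vectors of `T` is a dense linear subspace of `H`, and `T` has a non-trivial
closed invariant subspace. -/
theorem stmt_8 (H : Type) [NormedAddCommGroup H] [InnerProductSpace ℂ H] [CompleteSpace H]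
    [TopologicalSpace.SeparableSpace H] (hdim : ¬ FiniteDimensional ℂ H)
    (T B K : H →L[ℂ] H) (hT : T = B + K)
    (hB : ∃ M : ℝ, ∀ n : ℕ, ‖B ^ n‖ ≤ M) (hK : IsCompactOperator K)
    (hP1 : ∀ x : H, closure (Set.range fun n : ℕ => (T ^ n) x) =
      closure (Submodule.span ℂ (Set.range fun n : ℕ => (T ^ n) x) : Set H))
    (hP2 : ∀ x y : H,
      closure (Set.range fun n : ℕ => (T ^ n) x) ⊆ closure (Set.range fun n : ℕ => (T ^ n) y) ∨
      closure (Set.range fun n : ℕ => (T ^ n) y) ⊆ closure (Set.range fun n : ℕ => (T ^ n) x)) :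
    (∃ N : Submodule ℂ H,
        (N : Set H) = {x : H | ¬ Dense (Set.range fun n : ℕ => (T ^ n) x)} ∧
        Dense (N : Set H)) ∧
    ∃ M : Submodule ℂ H, IsClosed (M : Set H) ∧ M ≠ ⊥ ∧ M ≠ ⊤ ∧ ∀ x ∈ M, T x ∈ M := by
  obtain ⟨C, hB⟩ := hB
  have hnt : Nontrivial H := by
    by_contra h
    rw [not_nontrivial_iff_subsingleton] at h
    exact hdim inferInstance
  let O : H → Set H := fun x => closure (Set.range fun n : ℕ => (T ^ n) x)
  let W : H → Submodule ℂ H := fun x =>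
    (Submodule.span ℂ (Set.range fun n : ℕ => (T ^ n) x)).topologicalClosure
  have hOW : ∀ x, O x = (W x : Set H) := hP1
  have hxO : ∀ x, x ∈ O x := fun x => subset_closure ⟨0, by simp⟩
  have hTO : ∀ x, ∀ y ∈ O x, T y ∈ O x := by
    intro x y hy
    refine map_mem_closure T.continuous hy ?_
    rintro _ ⟨n, rfl⟩
    exact ⟨n + 1, by simp [pow_succ']⟩
  have hTnO : ∀ x, ∀ y ∈ O x, ∀ n : ℕ, (T ^ n) y ∈ O x := by
    intro x y hy n
    induction n with
    | zero => simpa using hy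
    | succ n ih => rw [pow_succ']; exact hTO x _ ih
  have hsub : ∀ x, ∀ y ∈ O x, O y ⊆ O x := by
    intro x y hy
    apply closure_minimal _ isClosed_closure
    rintro _ ⟨n, rfl⟩
    exact hTnO x y hy n
  have hnd : ∀ x, ∀ y ∈ O x, ¬ Dense (Set.range fun n : ℕ => (T ^ n) x) →
      ¬ Dense (Set.range fun n : ℕ => (T ^ n) y) := by
    intro x y hy hx hd
    apply hx
    rw [dense_iff_closure_eq] at hd ⊢
    exact Set.eq_univ_of_univ_subset (hd ▸ hsub x y hy)
  have heig : ∀ (l : ℂ) (x : H), 1 < ‖l‖ → T x = l • x → x = 0 := by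
    intro l x hl hx
    by_contra hx0
    have hn : ∀ n : ℕ, (T ^ n) x = l ^ n • x := by
      intro n
      induction n with
      | zero => simp
      | succ n ih =>
        rw [pow_succ', ContinuousLinearMap.mul_apply, ih, map_smul, hx, smul_smul, pow_succ]
    have h0 : (0 : H) ∈ O x := by rw [hOW]; exact (W x).zero_mem
    obtain ⟨_, ⟨n, rfl⟩, h1⟩ := Metric.mem_closure_iff.1 h0 ‖x‖ (norm_pos_iff.2 hx0)
    simp only [hn, dist_zero_left, norm_smul, norm_pow] at h1
    have h2 : 1 ≤ ‖l‖ ^ n := one_le_pow₀ hl.le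
    nlinarith [norm_nonneg x]
  let N : Submodule ℂ H :=
    { carrier := {x : H | ¬ Dense (Set.range fun n : ℕ => (T ^ n) x)}
      zero_mem' := by
        intro hd
        obtain ⟨y, hy⟩ := exists_ne (0 : H)
        have := hd y
        simp at this
        exact hy this
      add_mem' := by
        intro x y hx hy
        rcases hP2 x y with h | h
        · refine hnd y _ ?_ hy
          have h1 : x ∈ O y := h (hxO x)
          have h2 := hxO y
          rw [hOW] at h1 h2 ⊢
          exact (W y).add_mem h1 h2
        · refine hnd x _ ?_ hx
          have h1 : y ∈ O x := h (hxO y)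
          have h2 := hxO x
          rw [hOW] at h1 h2 ⊢
          exact (W x).add_mem h2 h1
      smul_mem' := by
        intro c x hx
        refine hnd x _ ?_ hx
        have h2 := hxO x
        rw [hOW] at h2 ⊢
        exact (W x).smul_mem c h2 }
  have hmem : ∀ x, x ∈ N ↔ ¬ Dense (Set.range fun n : ℕ => (T ^ n) x) := fun x => Iff.rfl
  have hdense : Dense (N : Set H) := by
    by_contra hcon
    rw [dense_iff_closure_eq, Set.eq_univ_iff_forall] at hcon
    push Not at hcon
    obtain ⟨x0, hx0⟩ := hcon
    obtain ⟨e, he, hball⟩ := Metric.isOpen_iff.1 (isClosed_closure (s := (N : Set H))).isOpen_compl x0 hx0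
    have hb : ∀ x, ‖x - x0‖ < e → x ∉ N := by
      intro x hx hxN
      exact hball (mem_ball_iff_norm.2 hx) (subset_closure hxN)
    refine aux_main T B K hT C hB hK heig x0 (e / 2) (by positivity) ?_ ?_
    · by_contra! h
      refine hb 0 ?_ N.zero_mem
      rw [zero_sub, norm_neg]; linarith
    · intro x hx
      have := hb x (by linarith)
      rw [hmem] at this
      exact not_not.1 this
  refine ⟨⟨N, rfl, hdense⟩, ?_⟩
  have hNbot : ∃ x ∈ N, x ≠ 0 := by
    by_contra! h
    obtain ⟨y, hy⟩ := exists_ne (0 : H)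
    have h1 : (N : Set H) ⊆ {0} := fun x hx => h x hx
    have h2 := closure_minimal h1 isClosed_singleton (hdense y)
    exact hy h2
  obtain ⟨x, hxN, hx0⟩ := hNbot
  refine ⟨W x, Submodule.isClosed_topologicalClosure _, ?_, ?_, ?_⟩
  · intro h
    have h1 := hxO x
    rw [hOW, h] at h1
    exact hx0 h1
  · intro h
    apply (hmem x).1 hxN
    rw [dense_iff_closure_eq]
    change O x = _
    rw [hOW, h]; rfl
  · intro y hy
    have h1 : y ∈ O x := by rw [hOW]; exact hy
    have h2 := hTO x y h1
    rw [hOW] at h2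
    exact h2
end

section
/- Let H be a complex separable infinite-dimensional Hilbert space and let T be a bounded linear operator on H satisfying: T = B + K with B power-bounded and K compact; (P1) for every x ∈ H the closure of the orbit Orb(x,T) is a linear subspace of H; (P2) the family of orbit closures is totally ordered by inclusion; and (P') for every closed subspace M of H invariant under T there exists x ∈ M with cl(Orb(x,T)) = M. Then there exists an increasing sequence (M_n)_{n ≥ 0} of infinite-dimensional closed subspaces of H such that M_n has infinite codimension as a subspace of M_{n+1} for each n ≥ 0, the union ∪_{n ≥ 0} M_n is dense in H, and HC(T)^c = ∪_{n ≥ 0} M_n. -/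
open Filter Topology

set_option linter.unusedSectionVars false

namespace Stmt10

variable {H : Type} [NormedAddCommGroup H] [InnerProductSpace ℂ H] [CompleteSpace H]

/-- closed linear span of the orbit -/
noncomputable def O (T : H →L[ℂ] H) (x : H) : Submodule ℂ H :=
  (Submodule.span ℂ (Set.range fun n : ℕ => (T ^ n) x)).topologicalClosure

lemma O_closed (T : H →L[ℂ] H) (x : H) : IsClosed (O T x : Set H) :=
  Submodule.isClosed_topologicalClosure _

lemma pow_mem_O (T : H →L[ℂ] H) (x : H) (n : ℕ) : (T ^ n) x ∈ O T x :=
  Submodule.le_topologicalClosure _ (Submodule.subset_span ⟨n, rfl⟩)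

lemma mem_O (T : H →L[ℂ] H) (x : H) : x ∈ O T x := by
  simpa using pow_mem_O T x 0

lemma O_le (T : H →L[ℂ] H) (x : H) (M : Submodule ℂ H) (hM : IsClosed (M : Set H))
    (hinv : ∀ x ∈ M, T x ∈ M) (hx : x ∈ M) : O T x ≤ M := by
  refine Submodule.topologicalClosure_minimal _ ?_ hM
  rw [Submodule.span_le]
  rintro _ ⟨n, rfl⟩
  induction n with
  | zero => simpa using hx
  | succ n ih => simpa [pow_succ'] using hinv _ ih

lemma closure_inv (T : H →L[ℂ] H) (M : Submodule ℂ H) (h : ∀ x ∈ M, T x ∈ M) :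
    ∀ x ∈ M.topologicalClosure, T x ∈ M.topologicalClosure := by
  intro x hx
  exact map_mem_closure T.continuous (s := (M : Set H)) (t := (M : Set H)) hx h

lemma O_inv (T : H →L[ℂ] H) (x : H) : ∀ y ∈ O T x, T y ∈ O T x := by
  apply closure_inv
  intro y hy
  induction hy using Submodule.span_induction with
  | mem y h =>
    obtain ⟨n, rfl⟩ := h
    refine Submodule.subset_span ⟨n + 1, ?_⟩
    simp [pow_succ']
  | zero => simp
  | add a b _ _ ha hb => simpa using Submodule.add_mem _ ha hb
  | smul c a _ ha => simpa using Submodule.smul_mem _ c ha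

lemma not_dense_geom (l a : ℂ) : ¬ Dense (Set.range fun n : ℕ => l ^ n * a) := by
  intro hd
  by_cases hl : ‖l‖ ≤ 1
  · have : Set.range (fun n : ℕ => l ^ n * a) ⊆ Metric.closedBall 0 ‖a‖ := by
      rintro _ ⟨n, rfl⟩
      simp only [mem_closedBall_zero_iff, norm_mul, norm_pow]
      exact mul_le_of_le_one_left (norm_nonneg _) (pow_le_one₀ (norm_nonneg _) hl)
    have h2 := closure_minimal this Metric.isClosed_closedBall
    rw [hd.closure_eq] at h2
    have := h2 (Set.mem_univ ((‖a‖ + 1 : ℝ) : ℂ))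
    rw [mem_closedBall_zero_iff, Complex.norm_real, Real.norm_of_nonneg (by positivity)] at this
    linarith
  · push Not at hl
    by_cases ha : a = 0
    · subst ha
      have h2 := closure_minimal (s := Set.range fun n : ℕ => l ^ n * 0) (t := {(0 : ℂ)})
        (by rintro _ ⟨n, rfl⟩; simp) isClosed_singleton
      rw [hd.closure_eq] at h2
      simpa using h2 (Set.mem_univ (1 : ℂ))
    · obtain ⟨_, ⟨n, rfl⟩, h1⟩ := hd.exists_mem_open Metric.isOpen_ball
        (⟨0, Metric.mem_ball_self (norm_pos_iff.2 ha)⟩ : (Metric.ball (0 : ℂ) ‖a‖).Nonempty)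
      simp only [mem_ball_zero_iff, norm_mul, norm_pow] at h1
      have := one_le_pow₀ hl.le (n := n)
      nlinarith [norm_nonneg a]

lemma quot (T : H →L[ℂ] H) (x : H)
    (hP1 : closure (Set.range fun n : ℕ => (T ^ n) x) = (O T x : Set H))
    (M : Submodule ℂ H) (hM : IsClosed (M : Set H)) (hinv : ∀ x ∈ M, T x ∈ M)
    (hfin : FiniteDimensional ℂ (↥(O T x) ⧸ Submodule.comap (O T x).subtype M)) :
    O T x ≤ M := by
  by_contra hne
  set N := O T x with hN
  set M' := Submodule.comap N.subtype M with hM'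
  have hcl : IsClosed (M' : Set N) := hM.preimage continuous_subtype_val
  let TN : N →ₗ[ℂ] N := (T : H →ₗ[ℂ] H).restrict (O_inv T x)
  let S : (N ⧸ M') →ₗ[ℂ] (N ⧸ M') := M'.mapQ M' TN (fun y hy => hinv _ hy)
  have : Nontrivial (N ⧸ M') := by
    rw [Submodule.Quotient.nontrivial_iff]
    intro h
    apply hne
    intro y hy
    have : (⟨y, hy⟩ : N) ∈ M' := h ▸ Submodule.mem_top
    exact this
  obtain ⟨l, hl⟩ := Module.End.exists_eigenvalue (K := ℂ)
    (Module.Dual.transpose (R := ℂ) S : Module.End ℂ (Module.Dual ℂ (N ⧸ M')))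
  obtain ⟨f, hf⟩ := hl.exists_hasEigenvector
  have hf0 := hf.2
  have hfS : ∀ q, f (S q) = l * f q := fun q => by
    exact LinearMap.congr_fun hf.apply_eq_smul q
  have : IsClosed (M' : Set N) := hcl
  have hfc : Continuous f := f.continuous_of_finiteDimensional
  let g : N → ℂ := fun y => f (M'.mkQ y)
  have hg : Continuous g := hfc.comp (by exact continuous_quot_mk)
  have hgs : Function.Surjective g :=
    (LinearMap.surjective hf0).comp (Submodule.mkQ_surjective M')
  let o : ℕ → N := fun n => ⟨(T ^ n) x, pow_mem_O T x n⟩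
  have ho : Dense (Set.range o) := by
    rw [dense_iff_closure_eq, Set.eq_univ_iff_forall]
    intro y
    rw [closure_subtype]
    have : (Subtype.val '' Set.range o) = Set.range fun n : ℕ => (T ^ n) x := by
      rw [← Set.range_comp]; rfl
    rw [this, hP1]
    exact y.2
  have hgo : ∀ n, g (o n) = l ^ n * g (o 0) := by
    intro n
    induction n with
    | zero => simp
    | succ n ih =>
      have h1 : o (n + 1) = TN (o n) := by
        apply Subtype.ext
        simp [o, TN, pow_succ']
      have h2 : g (TN (o n)) = l * g (o n) := hfS (M'.mkQ (o n))
      rw [h1, h2, ih, pow_succ']; ring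
  refine not_dense_geom l (g (o 0)) ?_
  have := hgs.denseRange.dense_image hg ho
  rw [← Set.range_comp] at this
  convert this using 2
  ext n
  exact (hgo n).symm

lemma O_finite (T : H →L[ℂ] H) (x : H)
    (hP1 : closure (Set.range fun n : ℕ => (T ^ n) x) = (O T x : Set H))
    (hfin : FiniteDimensional ℂ (O T x)) : x = 0 := by
  have := quot T x hP1 ⊥ (by simp) (by simp) inferInstance
  simpa using this (mem_O T x)

lemma no_eig (T : H →L[ℂ] H) (x : H) (l : ℂ) (hx : T x = l • x)
    (hP1 : closure (Set.range fun n : ℕ => (T ^ n) x) = (O T x : Set H)) : x = 0 := by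
  apply O_finite T x hP1
  have h : O T x ≤ Submodule.span ℂ {x} := by
    apply O_le
    · exact Submodule.closed_of_finiteDimensional _
    · intro y hy
      obtain ⟨c, rfl⟩ := Submodule.mem_span_singleton.1 hy
      rw [map_smul, hx]
      exact Submodule.smul_mem _ _ (Submodule.smul_mem _ _ (Submodule.mem_span_singleton_self x))
    · exact Submodule.mem_span_singleton_self x
  exact Submodule.finiteDimensional_of_le h

lemma spec_T (T B K : H →L[ℂ] H) (hT : T = B + K)
    (hB : ∃ C : ℝ, ∀ n : ℕ, ‖B ^ n‖ ≤ C) (hK : IsCompactOperator K)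
    (hP1 : ∀ x, closure (Set.range fun n : ℕ => (T ^ n) x) = (O T x : Set H))
    (l : ℂ) (hl : 1 < ‖l‖) : l ∉ spectrum ℂ T := by
  have hlB : l ∉ spectrum ℂ B := by
    intro h
    obtain ⟨C, hC⟩ := hB
    obtain ⟨n, hn⟩ := pow_unbounded_of_one_lt (C * ‖(1 : H →L[ℂ] H)‖) hl
    have := spectrum.norm_le_norm_mul_of_mem (spectrum.pow_mem_pow B n h)
    rw [norm_pow] at this
    have := this.trans (mul_le_mul_of_nonneg_right (hC n) (norm_nonneg _))
    linarith
  rw [spectrum.notMem_iff] at hlB ⊢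
  obtain ⟨u, hu⟩ := hlB
  set R : H →L[ℂ] H := ↑u⁻¹ with hR
  have hcomp : IsCompactOperator (R * K : H →L[ℂ] H) := hK.clm_comp R
  have hTu : algebraMap ℂ (H →L[ℂ] H) l - T = u * (1 - R * K) := by
    rw [mul_sub, ← mul_assoc, hR, Units.mul_inv, hu, hT]; simp; abel
  rcases hcomp.hasEigenvalue_or_mem_resolventSet (one_ne_zero (α := ℂ)) with h | h
  · exfalso
    obtain ⟨v, hv⟩ := h.exists_hasEigenvector
    have h1 : (R * K) v = v := by simpa using hv.apply_eq_smul
    apply hv.2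
    apply no_eig T v l _ (hP1 v)
    have : (algebraMap ℂ (H →L[ℂ] H) l - T) v = 0 := by
      rw [hTu, mul_apply_eq_comp, sub_apply, h1]
      simp
    rw [sub_apply, sub_eq_zero] at this
    rw [← this]
    simp [Algebra.algebraMap_eq_smul_one]
  · rw [spectrum.mem_resolventSet_iff] at h
    rw [hTu]
    refine u.isUnit.mul ?_
    simpa using h

lemma growth (T : H →L[ℂ] H) (h : ∀ l : ℂ, 1 < ‖l‖ → l ∉ spectrum ℂ T)
    (ρ : ℝ) (hρ : 1 < ρ) : ∃ A : ℝ, 0 < A ∧ ∀ n, ‖T ^ n‖ ≤ A * ρ ^ n := by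
  have hr : spectralRadius ℂ T ≤ 1 := by
    refine iSup₂_le fun l hl => ?_
    by_contra hh
    apply h l _ hl
    push Not at hh
    exact_mod_cast hh
  have hr2 : spectralRadius ℂ T < ENNReal.ofReal ρ :=
    hr.trans_lt (by simpa using hρ)
  have hev := (spectrum.pow_norm_pow_one_div_tendsto_nhds_spectralRadius T).eventually_lt_const hr2
  obtain ⟨N, hN⟩ := eventually_atTop.1 hev
  refine ⟨1 + ∑ i ∈ Finset.range (N + 1), ‖T ^ i‖, by positivity, fun n => ?_⟩
  have hp : 1 ≤ ρ ^ n := one_le_pow₀ hρ.le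
  have hs : 0 ≤ ∑ i ∈ Finset.range (N + 1), ‖T ^ i‖ := by positivity
  by_cases hn : n ∈ Finset.range (N + 1)
  · have := Finset.single_le_sum (f := fun i => ‖T ^ i‖) (fun i _ => norm_nonneg _) hn
    nlinarith
  · simp only [Finset.mem_range, not_lt] at hn
    have h1 := hN n (by omega)
    have h2 := (ENNReal.ofReal_lt_ofReal_iff (by linarith)).1 h1
    have h3 : ‖T ^ n‖ ≤ ρ ^ n := by
      have := pow_le_pow_left₀ (by positivity) h2.le n
      rwa [one_div, Real.rpow_inv_natCast_pow (norm_nonneg _) (by omega)] at this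
    nlinarith

lemma comp_pow (T B K : H →L[ℂ] H) (hT : T = B + K) (hK : IsCompactOperator K) (n : ℕ) :
    IsCompactOperator (T ^ n - B ^ n : H →L[ℂ] H) := by
  induction n with
  | zero => simpa using isCompactOperator_zero
  | succ n ih =>
    have : T ^ (n + 1) - B ^ (n + 1) = T * (T ^ n - B ^ n) + K * B ^ n := by
      rw [pow_succ', pow_succ', mul_sub, hT]; noncomm_ring
    rw [this]
    exact IsCompactOperator.add (ih.clm_comp T) (hK.comp_clm (B ^ n))

lemma weak_seq [TopologicalSpace.SeparableSpace H] (x0 : H) (r : ℝ) (x : ℕ → H)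
    (hx : ∀ n, x n ∈ Metric.closedBall x0 r) :
    ∃ y ∈ Metric.closedBall x0 r, ∃ φ : ℕ → ℕ, StrictMono φ ∧
      ∀ z : H, Tendsto (fun n => inner ℂ (x (φ n)) z) atTop (𝓝 (inner ℂ y z)) := by
  have key := WeakDual.isSeqCompact_closedBall (𝕜 := ℂ) (E := H)
    (InnerProductSpace.toDual ℂ H x0) r
  obtain ⟨f, hf, φ, hφ, hlim⟩ := key
    (x := fun n => StrongDual.toWeakDual (InnerProductSpace.toDual ℂ H (x n)))
    (fun n => by
      have := hx n
      simp only [Set.mem_preimage, Metric.mem_closedBall] at this ⊢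
      rw [← (InnerProductSpace.toDual ℂ H).dist_map] at this
      exact this)
  refine ⟨(InnerProductSpace.toDual ℂ H).symm (WeakDual.toStrongDual f), ?_, φ, hφ, ?_⟩
  · have : dist (WeakDual.toStrongDual f) (InnerProductSpace.toDual ℂ H x0) ≤ r := hf
    rw [Metric.mem_closedBall]
    rw [← (InnerProductSpace.toDual ℂ H).dist_map]
    simpa using this
  · intro z
    have h1 := ((WeakDual.eval_continuous (𝕜 := ℂ) (E := H) z).tendsto f).comp hlim
    rw [InnerProductSpace.toDual_symm_apply]
    exact h1

lemma comp_weak (K : H →L[ℂ] H) (hK : IsCompactOperator K) (x0 : H) (r : ℝ) (x : ℕ → H)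
    (hx : ∀ n, x n ∈ Metric.closedBall x0 r) (y : H)
    (hw : ∀ z : H, Tendsto (fun n => inner ℂ (x n) z) atTop (𝓝 (inner ℂ y z))) :
    Tendsto (fun n => K (x n)) atTop (𝓝 (K y)) := by
  apply tendsto_of_subseq_tendsto
  intro ns hns
  obtain ⟨C, hC, hC'⟩ := hK.image_subset_compact_of_bounded
    (f := (K : H →ₗ[ℂ] H)) (Metric.isBounded_closedBall (x := x0) (r := r))
  obtain ⟨w, -, ψ, hψ, hlim⟩ := hC.tendsto_subseq (x := fun n => K (x (ns n)))
    (fun n => hC' ⟨_, hx _, rfl⟩)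
  refine ⟨ψ, ?_⟩
  have : w = K y := by
    apply ext_inner_right ℂ
    intro z
    have h1 : Tendsto (fun n => inner ℂ (K (x (ns (ψ n)))) z) atTop (𝓝 (inner ℂ w z)) :=
      hlim.inner tendsto_const_nhds
    have h2 := (hw (ContinuousLinearMap.adjoint K z)).comp (hns.comp hψ.tendsto_atTop)
    simp only [Function.comp_def, ContinuousLinearMap.adjoint_inner_right] at h2
    exact tendsto_nhds_unique h1 h2
  rw [← this]
  exact hlim

lemma key [TopologicalSpace.SeparableSpace H] (T B K : H →L[ℂ] H) (hT : T = B + K)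
    (hB : ∃ C : ℝ, ∀ n : ℕ, ‖B ^ n‖ ≤ C) (hK : IsCompactOperator K)
    (hP1 : ∀ x, closure (Set.range fun n : ℕ => (T ^ n) x) = (O T x : Set H))
    (N : Submodule ℂ H) (hN : IsClosed (N : Set H)) (hne : N ≠ ⊤) :
    ∃ x, x ∉ N ∧ ¬ Dense (Set.range fun n : ℕ => (T ^ n) x) := by
  by_contra! hcon
  obtain ⟨C, hC⟩ := hB
  have hC0 : 0 ≤ C := (norm_nonneg _).trans (hC 0)
  obtain ⟨x0, hx0⟩ : ∃ x0, x0 ∉ N := by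
    by_contra! h
    exact hne (eq_top_iff.2 fun x _ => h x)
  obtain ⟨r, hr, hball⟩ := Metric.nhds_basis_closedBall.mem_iff.1
    (hN.isOpen_compl.mem_nhds (show x0 ∈ (N : Set H)ᶜ from hx0))
  have hR : 0 < C * (‖x0‖ + r) + 1 := by positivity
  obtain ⟨α, hα0, hα1, hα⟩ : ∃ α : ℝ, 0 < α ∧ α < 1 ∧ α * (C * (‖x0‖ + r)) ≤ r / 4 := by
    refine ⟨min (1 / 2) (r / 4 / (C * (‖x0‖ + r) + 1)), by positivity,
      (min_le_left _ _).trans_lt (by norm_num), ?_⟩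
    have h1 := min_le_right (1 / 2) (r / 4 / (C * (‖x0‖ + r) + 1))
    rw [le_div_iff₀ hR] at h1
    have h2 : 0 ≤ min (1 / 2) (r / 4 / (C * (‖x0‖ + r) + 1)) := by positivity
    linarith
  have hBx : ∀ n, ∀ x ∈ Metric.closedBall x0 r, ‖(α : ℂ) • (B ^ n) x‖ ≤ r / 4 := by
    intro n x hx
    have hxn : ‖x‖ ≤ ‖x0‖ + r := by
      rw [mem_closedBall_iff_norm] at hx
      calc ‖x‖ = ‖x0 + (x - x0)‖ := by simp
        _ ≤ _ := (norm_add_le _ _).trans (by gcongr)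
    rw [norm_smul, Complex.norm_real, Real.norm_of_nonneg hα0.le]
    refine le_trans ?_ hα
    gcongr
    exact ((B ^ n).le_opNorm x).trans (by gcongr; exact hC n)
  -- uniform bound on return times
  obtain ⟨m, hm⟩ : ∃ m : ℕ, ∀ x ∈ Metric.closedBall x0 r, ∃ n ≤ m,
      (α : ℂ) • (T ^ n) x ∈ Metric.closedBall x0 r := by
    by_contra! hno
    choose x hx hxn using hno
    obtain ⟨y, hy, φ, hφ, hw⟩ := weak_seq x0 r x hx
    have hyd := hcon y (fun h => hball hy h)
    obtain ⟨_, ⟨n, rfl⟩, hz⟩ := hyd.exists_mem_open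
      (Metric.isOpen_ball (x := (α : ℂ)⁻¹ • x0) (ε := α⁻¹ * (r / 4)))
      ⟨_, Metric.mem_ball_self (by positivity)⟩
    have hαc : (α : ℂ) ≠ 0 := by exact_mod_cast hα0.ne'
    have hz2 : ‖(α : ℂ) • (T ^ n) y - x0‖ < r / 4 := by
      rw [mem_ball_iff_norm] at hz
      have : (α : ℂ) • (T ^ n) y - x0 = (α : ℂ) • ((T ^ n) y - (α : ℂ)⁻¹ • x0) := by
        rw [smul_sub, smul_inv_smul₀ hαc]
      rw [this, norm_smul, Complex.norm_real, Real.norm_of_nonneg hα0.le]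
      calc _ < α * (α⁻¹ * (r / 4)) := by gcongr
        _ = r / 4 := by field_simp
    have hlim := comp_weak (T ^ n - B ^ n) (comp_pow T B K hT hK n) x0 r (fun k => x (φ k))
      (fun k => hx _) y hw
    have hlim2 := ((hlim.const_smul (α : ℂ)).sub_const x0).norm
    have hlt : ‖(α : ℂ) • (T ^ n - B ^ n) y - x0‖ < 3 * r / 4 := by
      have e : (α : ℂ) • (T ^ n - B ^ n) y - x0
          = ((α : ℂ) • (T ^ n) y - x0) - (α : ℂ) • (B ^ n) y := by
        rw [sub_apply, smul_sub]; abel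
      rw [e]
      have := norm_sub_le ((α : ℂ) • (T ^ n) y - x0) ((α : ℂ) • (B ^ n) y)
      have := hBx n y hy
      linarith
    obtain ⟨k, hk1, hk2⟩ := ((hlim2.eventually_lt_const hlt).and
      (eventually_ge_atTop n)).exists
    apply hxn (φ k) n (hk2.trans (hφ.id_le k))
    rw [mem_closedBall_iff_norm]
    have e : (α : ℂ) • (T ^ n) (x (φ k)) - x0
          = ((α : ℂ) • (T ^ n - B ^ n) (x (φ k)) - x0) + (α : ℂ) • (B ^ n) (x (φ k)) := by
        rw [sub_apply, smul_sub]; abel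
    rw [e]
    have := norm_add_le ((α : ℂ) • (T ^ n - B ^ n) (x (φ k)) - x0) ((α : ℂ) • (B ^ n) (x (φ k)))
    have := hBx n (x (φ k)) (hx _)
    linarith
  -- iterate
  have hit : ∀ k : ℕ, ∃ n ≤ k * m, (α : ℂ) ^ k • (T ^ n) x0 ∈ Metric.closedBall x0 r := by
    intro k
    induction k with
    | zero => exact ⟨0, by simp, by simpa using hr.le⟩
    | succ k ih =>
      obtain ⟨n, hn, hmem⟩ := ih
      obtain ⟨n', hn', hmem'⟩ := hm _ hmem
      refine ⟨n' + n, by rw [add_mul, one_mul]; omega, ?_⟩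
      rw [map_smul, smul_smul, ← pow_succ', ← mul_apply_eq_comp, ← pow_add] at hmem'
      exact hmem'
  -- lower bound on the ball
  have hlow : ∃ d > 0, ∀ x ∈ Metric.closedBall x0 r, d ≤ ‖x‖ := by
    have h0 : (0 : H) ∈ (Metric.closedBall x0 r)ᶜ := fun h => hball h N.zero_mem
    obtain ⟨d, hd, hdb⟩ := Metric.nhds_basis_ball.mem_iff.1
      (Metric.isClosed_closedBall.isOpen_compl.mem_nhds h0)
    refine ⟨d, hd, fun x hx => ?_⟩
    by_contra! hlt
    exact hdb (by simpa using hlt) hx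
  obtain ⟨d, hd, hlow⟩ := hlow
  obtain ⟨ρ, hρ, hρα⟩ : ∃ ρ : ℝ, 1 < ρ ∧ α * ρ ^ m < 1 := by
    have hc : Continuous fun ρ : ℝ => α * ρ ^ m := by fun_prop
    have h1 : ∀ᶠ ρ in 𝓝[>] (1 : ℝ), α * ρ ^ m < 1 :=
      (hc.tendsto 1).mono_left nhdsWithin_le_nhds |>.eventually_lt_const (by simpa using hα1)
    obtain ⟨ρ, h, h'⟩ := (h1.and self_mem_nhdsWithin).exists
    exact ⟨ρ, h', h⟩
  obtain ⟨A, hA, hgr⟩ := growth T (spec_T T B K hT ⟨C, hC⟩ hK hP1) ρ hρ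
  have hbd : ∀ k : ℕ, d ≤ A * ‖x0‖ * (α * ρ ^ m) ^ k := by
    intro k
    obtain ⟨n, hn, hmem⟩ := hit k
    refine (hlow _ hmem).trans ?_
    rw [norm_smul, norm_pow, Complex.norm_real, Real.norm_of_nonneg hα0.le]
    calc α ^ k * ‖(T ^ n) x0‖ ≤ α ^ k * (A * ρ ^ (k * m) * ‖x0‖) := by
          gcongr
          refine ((T ^ n).le_opNorm x0).trans ?_
          gcongr
          refine (hgr n).trans ?_
          gcongr
          exact hρ.le
      _ = _ := by rw [mul_pow, ← pow_mul, mul_comm k m]; ring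
  have hz : Tendsto (fun k : ℕ => A * ‖x0‖ * (α * ρ ^ m) ^ k) atTop (𝓝 (A * ‖x0‖ * 0)) :=
    (tendsto_pow_atTop_nhds_zero_of_lt_one (by positivity) hρα).const_mul _
  have := ge_of_tendsto' hz hbd
  simp at this
  linarith

end Stmt10

/-- Let `T = B + K` be a bounded operator on a complex separable infinite-dimensional Hilbert
space `H`, with `B` power-bounded and `K` compact, satisfying (P1): every orbit closure is a
linear subspace, (P2): the orbit closures are totally ordered by inclusion, and (P'): on every
closed invariant subspace `M` there is a vector whose orbit closure is all of `M`. Then there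
is an increasing sequence `(M n)` of infinite-dimensional closed subspaces of `H`, each of
infinite codimension in the next (the quotient `M (n+1) / M n` is infinite-dimensional), whose
union is dense in `H` and equals the set of non-hypercyclic vectors of `T`. -/
theorem stmt_10 (H : Type) [NormedAddCommGroup H] [InnerProductSpace ℂ H] [CompleteSpace H]
    [TopologicalSpace.SeparableSpace H] (hdim : ¬ FiniteDimensional ℂ H)
    (T B K : H →L[ℂ] H) (hT : T = B + K)
    (hB : ∃ C : ℝ, ∀ n : ℕ, ‖B ^ n‖ ≤ C) (hK : IsCompactOperator K)
    (hP1 : ∀ x : H, closure (Set.range fun n : ℕ => (T ^ n) x) =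
      closure (Submodule.span ℂ (Set.range fun n : ℕ => (T ^ n) x) : Set H))
    (hP2 : ∀ x y : H,
      closure (Set.range fun n : ℕ => (T ^ n) x) ⊆ closure (Set.range fun n : ℕ => (T ^ n) y) ∨
      closure (Set.range fun n : ℕ => (T ^ n) y) ⊆ closure (Set.range fun n : ℕ => (T ^ n) x))
    (hP' : ∀ M : Submodule ℂ H, IsClosed (M : Set H) → (∀ x ∈ M, T x ∈ M) →
      ∃ x ∈ M, closure (Set.range fun n : ℕ => (T ^ n) x) = M) :
    ∃ M : ℕ → Submodule ℂ H,
      (∀ n, IsClosed (M n : Set H)) ∧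
      (∀ n, M n ≤ M (n + 1)) ∧
      (∀ n, ¬ FiniteDimensional ℂ (M n)) ∧
      (∀ n, ¬ FiniteDimensional ℂ
        (↥(M (n + 1)) ⧸ Submodule.comap (M (n + 1)).subtype (M n))) ∧
      Dense (⋃ n, (M n : Set H)) ∧
      {x : H | ¬ Dense (Set.range fun n : ℕ => (T ^ n) x)} = ⋃ n, (M n : Set H) := by
  classical
  have hP1' : ∀ x, closure (Set.range fun n : ℕ => (T ^ n) x) = (Stmt10.O T x : Set H) := hP1
  have htot : ∀ x y, Stmt10.O T x ≤ Stmt10.O T y ∨ Stmt10.O T y ≤ Stmt10.O T x := by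
    intro x y
    have := hP2 x y
    rw [hP1', hP1'] at this
    exact this
  have hdense : ∀ x, Dense (Set.range fun n : ℕ => (T ^ n) x) ↔ Stmt10.O T x = ⊤ := by
    intro x
    rw [dense_iff_closure_eq, hP1', ← SetLike.coe_set_eq (p := Stmt10.O T x), Submodule.top_coe]
  have hkey := Stmt10.key T B K hT hB hK hP1'
  set S : Set H := {x : H | ¬ Dense (Set.range fun n : ℕ => (T ^ n) x)} with hS
  have hSO : ∀ x, x ∈ S ↔ Stmt10.O T x ≠ ⊤ := fun x => not_congr (hdense x)
  have hOmono : ∀ x y, y ∈ Stmt10.O T x → Stmt10.O T y ≤ Stmt10.O T x := fun x y h =>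
    Stmt10.O_le T y _ (Stmt10.O_closed T x) (Stmt10.O_inv T x) h
  -- a starting vector
  obtain ⟨a, ha0, haS⟩ : ∃ a, a ≠ 0 ∧ a ∈ S := by
    have hnt : (⊥ : Submodule ℂ H) ≠ ⊤ := by
      intro h
      apply hdim
      have : FiniteDimensional ℂ (⊤ : Submodule ℂ H) := h ▸ inferInstance
      exact Module.finite_def.2 (Submodule.fg_top _ |>.1 (Module.finite_def.1 this))
    obtain ⟨a, h1, h2⟩ := hkey ⊥ (by simp) hnt
    exact ⟨a, by simpa using h1, h2⟩
  -- a dense sequence in S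
  obtain ⟨d, hdS, hdd⟩ : ∃ d : ℕ → H, (∀ n, d n ∈ S) ∧ S ⊆ closure (Set.range d) := by
    have : Nonempty S := ⟨⟨a, haS⟩⟩
    have : TopologicalSpace.SeparableSpace S := inferInstance
    refine ⟨fun n => (TopologicalSpace.denseSeq S n : H), fun n => Subtype.property _, ?_⟩
    intro y hy
    have h1 := TopologicalSpace.denseRange_denseSeq S ⟨y, hy⟩
    rw [closure_subtype, ← Set.range_comp] at h1
    exact h1
  -- successor step
  have hstep : ∀ x d : H, ∃ y, x ∈ S → d ∈ S →
      y ∈ S ∧ Stmt10.O T x ≤ Stmt10.O T y ∧ ¬ Stmt10.O T y ≤ Stmt10.O T x ∧ d ∈ Stmt10.O T y := by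
    intro x d
    by_cases hx : x ∈ S
    swap
    · exact ⟨0, fun h => absurd h hx⟩
    by_cases hd : d ∈ S
    swap
    · exact ⟨0, fun _ h => absurd h hd⟩
    obtain ⟨z, hz, hxz, hdz⟩ : ∃ z ∈ S, Stmt10.O T x ≤ Stmt10.O T z ∧
        Stmt10.O T d ≤ Stmt10.O T z := by
      rcases htot x d with h | h
      · exact ⟨d, hd, h, le_rfl⟩
      · exact ⟨x, hx, le_rfl, h⟩
    obtain ⟨y, hyz, hyS⟩ := hkey _ (Stmt10.O_closed T z) ((hSO z).1 hz)
    have hzy : Stmt10.O T z ≤ Stmt10.O T y := by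
      rcases htot z y with h | h
      · exact h
      · exact absurd (h (Stmt10.mem_O T y)) hyz
    refine ⟨y, fun _ _ => ⟨hyS, hxz.trans hzy, fun h => hyz (hxz (h (Stmt10.mem_O T y))),
      hzy (hdz (Stmt10.mem_O T d))⟩⟩
  choose g hg using hstep
  let x : ℕ → H := fun n => Nat.rec a (fun k v => g v (d k)) n
  have hxs : ∀ n, x (n + 1) = g (x n) (d n) := fun n => rfl
  have hxz : x 0 = a := rfl
  clear_value x
  have hxS : ∀ n, x n ∈ S := by
    intro n
    induction n with
    | zero => rw [hxz]; exact haS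
    | succ n ih => rw [hxs]; exact (hg _ _ ih (hdS n)).1
  have hle : ∀ n, Stmt10.O T (x n) ≤ Stmt10.O T (x (n + 1)) := fun n => by
    rw [hxs]; exact (hg _ _ (hxS n) (hdS n)).2.1
  have hnle : ∀ n, ¬ Stmt10.O T (x (n + 1)) ≤ Stmt10.O T (x n) := fun n => by
    rw [hxs]; exact (hg _ _ (hxS n) (hdS n)).2.2.1
  have hdm : ∀ n, d n ∈ Stmt10.O T (x (n + 1)) := fun n => by
    rw [hxs]; exact (hg _ _ (hxS n) (hdS n)).2.2.2
  have hmono : Monotone fun n => Stmt10.O T (x n) := monotone_nat_of_le_succ hle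
  have hx0 : ∀ n, x n ≠ 0 := by
    intro n h
    have h1 : a ∈ Stmt10.O T (x n) := hmono (Nat.zero_le n) (by simpa [hxz] using Stmt10.mem_O T a)
    have h2 : Stmt10.O T (x n) ≤ ⊥ := Stmt10.O_le T _ ⊥ (by simp) (by simp) (by simpa using h)
    exact ha0 (by simpa using h2 h1)
  have hunion : S = ⋃ n, (Stmt10.O T (x n) : Set H) := by
    apply Set.Subset.antisymm
    · intro y hy
      by_contra hno
      simp only [Set.mem_iUnion, not_exists, SetLike.mem_coe] at hno
      have h1 : ∀ n, Stmt10.O T (x n) ≤ Stmt10.O T y := by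
        intro n
        rcases htot (x n) y with h | h
        · exact h
        · exact absurd (h (Stmt10.mem_O T y)) (hno n)
      have h2 : S ⊆ Stmt10.O T y := by
        refine hdd.trans (closure_minimal ?_ (Stmt10.O_closed T y))
        rintro _ ⟨n, rfl⟩
        exact h1 (n + 1) (hdm n)
      obtain ⟨z, hz, hzS⟩ := hkey _ (Stmt10.O_closed T y) ((hSO y).1 hy)
      exact hz (h2 hzS)
    · intro y hy
      obtain ⟨n, hn⟩ := Set.mem_iUnion.1 hy
      rw [hSO]
      intro htop
      apply (hSO _).1 (hxS n)
      rw [eq_top_iff, ← htop]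
      exact hOmono _ _ hn
  refine ⟨fun n => Stmt10.O T (x n), fun n => Stmt10.O_closed T _, hle, ?_, ?_, ?_, hunion⟩
  · intro n hfin
    exact hx0 n (Stmt10.O_finite T _ (hP1' _) hfin)
  · intro n hfin
    exact hnle n (Stmt10.quot T _ (hP1' _) _ (Stmt10.O_closed T _) (Stmt10.O_inv T _) hfin)
  · have hcoe : ((⨆ n, Stmt10.O T (x n) : Submodule ℂ H) : Set H)
        = ⋃ n, (Stmt10.O T (x n) : Set H) :=
      Submodule.coe_iSup_of_directed _ hmono.directed_le
    by_contra hnd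
    obtain ⟨z, hz, hzS⟩ := hkey (⨆ n, Stmt10.O T (x n)).topologicalClosure
      (Submodule.isClosed_topologicalClosure _) (by
        intro h
        apply hnd
        rw [← hcoe]
        exact Submodule.dense_iff_topologicalClosure_eq_top.2 h)
    apply hz
    apply Submodule.le_topologicalClosure
    have : z ∈ S := hzS
    rw [hunion, ← hcoe] at this
    exact this
end
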